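/- For every K ≥ 1 and C ≥ 0 there exist constants K′ ≥ 1, C′ ≥ 0 and D ≥ 0, depending only on K and C, such that for every (K,C)-quasi-isometry φ : Sol → Sol there is a height-respecting (K′,C′)-quasi-isometry φ̂ : Sol → Sol with d_Sol(φ(p), φ̂(p)) ≤ D for all p ∈ Sol. -/

import Mathlib

open Set

noncomputable section

/-- A path `γ : ℝ → E` is piecewise `C¹` on `[0,1]`. -/
def PiecewiseC1 {E : Type*} [NormedAddCommGroup E] [NormedSpace ℝ E] (γ : ℝ → E) : Prop :=
  ∃ (n : ℕ) (τ : ℕ → ℝ), τ 0 = 0 ∧ τ n = 1 ∧ (∀ i < n, τ i ≤ τ (i + 1)) ∧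
    ∀ i < n, ContDiffOn ℝ 1 γ (Set.Icc (τ i) (τ (i + 1)))

/-- The `Sol` length of a path `γ(t) = (x(t), y(t), z(t))`, for the metric
`ds² = e^{-z} dx² + e^{z} dy² + dz²`. -/
def solLength (γ : ℝ → ℝ × ℝ × ℝ) : ℝ :=
  ∫ t in (0:ℝ)..1,
    Real.sqrt (Real.exp (-(γ t).2.2) * (deriv (fun s => (γ s).1) t) ^ 2 +
      Real.exp ((γ t).2.2) * (deriv (fun s => (γ s).2.1) t) ^ 2 +
      (deriv (fun s => (γ s).2.2) t) ^ 2)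

/-- The left-invariant distance on `Sol = ℝ³`. -/
def dSol (p q : ℝ × ℝ × ℝ) : ℝ :=
  sInf {ℓ : ℝ | ∃ γ : ℝ → ℝ × ℝ × ℝ,
    γ 0 = p ∧ γ 1 = q ∧ PiecewiseC1 γ ∧ solLength γ = ℓ}

/-- Height function on `Sol`. -/
def solHeight (p : ℝ × ℝ × ℝ) : ℝ := p.2.2

/-- `f` is a `(K, C)`-quasi-isometric embedding with respect to the given distances. -/
def IsQIE {X Y : Type*} (dX : X → X → ℝ) (dY : Y → Y → ℝ) (K C : ℝ) (f : X → Y) : Prop :=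
  ∀ a b : X, (1 / K) * dX a b - C ≤ dY (f a) (f b) ∧ dY (f a) (f b) ≤ K * dX a b + C

/-- `f` is a `(K, C)`-quasi-isometry with respect to the given distances. -/
def IsQI {X Y : Type*} (dX : X → X → ℝ) (dY : Y → Y → ℝ) (K C : ℝ) (f : X → Y) : Prop :=
  IsQIE dX dY K C f ∧ ∀ y : Y, ∃ x : X, dY (f x) y ≤ C

/-- Two "metric spaces", given by distance functions, are quasi-isometric. -/
def QuasiIsometric {X Y : Type*} (dX : X → X → ℝ) (dY : Y → Y → ℝ) : Prop :=
  ∃ (K C : ℝ) (f : X → Y), 1 ≤ K ∧ 0 ≤ C ∧ IsQI dX dY K C f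

/-- A self-map of `Sol` is height-respecting if it permutes the level sets of the height
function to within uniformly bounded distance. -/
def HeightRespectingSol (φ : ℝ × ℝ × ℝ → ℝ × ℝ × ℝ) : Prop :=
  ∃ B : ℝ, 0 ≤ B ∧ ∃ g : ℝ → ℝ, ∀ p : ℝ × ℝ × ℝ, |solHeight (φ p) - g (solHeight p)| ≤ B

/-! ### The discrete model -/

/-- A point of the half-discretised `Sol`: real horizontal coordinates and an integer height. -/
@[ext] structure Pt where
  x : ℝ
  y : ℝ
  k : ℤ

/-- A cell at height `k`: a dyadic box of size `2 ^ k × 2 ^ (-k)`. -/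
@[ext] structure Cell where
  i : ℤ
  j : ℤ
  k : ℤ
deriving DecidableEq

/-- The lower left corner of a cell. -/
def Cell.corner (s : Cell) : Pt := ⟨s.i * 2 ^ s.k, s.j * 2 ^ (-s.k), s.k⟩

/-- The cell containing a point. -/
def Pt.cell (a : Pt) : Cell := ⟨⌊a.x * 2 ^ (-a.k)⌋, ⌊a.y * 2 ^ a.k⌋, a.k⟩

/-- Coarse closeness of points. -/
def Near (R : ℕ) (a b : Pt) : Prop :=
  |a.k - b.k| ≤ R ∧ |a.x - b.x| ≤ 2 ^ (a.k + R) ∧ |a.y - b.y| ≤ 2 ^ (-a.k + R)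

/-- Vertical translation. -/
def Pt.up (h : ℤ) (a : Pt) : Pt := ⟨a.x, a.y, a.k + h⟩

/-- Translation in the `y` direction by `c` times the size of a cell. -/
def Pt.ys (c : ℝ) (a : Pt) : Pt := ⟨a.x, a.y + c * 2 ^ (-a.k), a.k⟩

/-- The symmetry exchanging the two horizontal directions. -/
def Pt.flip (a : Pt) : Pt := ⟨a.y, a.x, -a.k⟩

/-- The symmetry exchanging the two horizontal directions. -/
def Cell.flip (s : Cell) : Cell := ⟨s.j, s.i, -s.k⟩

@[simp] lemma Pt.up_x (h : ℤ) (a : Pt) : (a.up h).x = a.x := rfl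
@[simp] lemma Pt.up_y (h : ℤ) (a : Pt) : (a.up h).y = a.y := rfl
@[simp] lemma Pt.up_k (h : ℤ) (a : Pt) : (a.up h).k = a.k + h := rfl
@[simp] lemma Pt.ys_x (c : ℝ) (a : Pt) : (a.ys c).x = a.x := rfl
@[simp] lemma Pt.ys_y (c : ℝ) (a : Pt) : (a.ys c).y = a.y + c * 2 ^ (-a.k) := rfl
@[simp] lemma Pt.ys_k (c : ℝ) (a : Pt) : (a.ys c).k = a.k := rfl
@[simp] lemma Pt.flip_x (a : Pt) : a.flip.x = a.y := rfl
@[simp] lemma Pt.flip_y (a : Pt) : a.flip.y = a.x := rfl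
@[simp] lemma Pt.flip_k (a : Pt) : a.flip.k = -a.k := rfl
@[simp] lemma Pt.flip_flip (a : Pt) : a.flip.flip = a := by ext <;> simp
@[simp] lemma Cell.flip_i (s : Cell) : s.flip.i = s.j := rfl
@[simp] lemma Cell.flip_j (s : Cell) : s.flip.j = s.i := rfl
@[simp] lemma Cell.flip_k (s : Cell) : s.flip.k = -s.k := rfl
@[simp] lemma Cell.flip_flip (s : Cell) : s.flip.flip = s := by ext <;> simp
@[simp] lemma Cell.corner_x (s : Cell) : s.corner.x = s.i * 2 ^ s.k := rfl
@[simp] lemma Cell.corner_y (s : Cell) : s.corner.y = s.j * 2 ^ (-s.k) := rfl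
@[simp] lemma Cell.corner_k (s : Cell) : s.corner.k = s.k := rfl
@[simp] lemma Pt.cell_i (a : Pt) : a.cell.i = ⌊a.x * 2 ^ (-a.k)⌋ := rfl
@[simp] lemma Pt.cell_j (a : Pt) : a.cell.j = ⌊a.y * 2 ^ a.k⌋ := rfl
@[simp] lemma Pt.cell_k (a : Pt) : a.cell.k = a.k := rfl
@[simp] lemma Cell.flip_corner (s : Cell) : s.flip.corner = s.corner.flip := by
  ext <;> simp
@[simp] lemma Pt.flip_cell (a : Pt) : a.flip.cell = a.cell.flip := by
  ext <;> simp
lemma Pt.up_up (h h' : ℤ) (a : Pt) : (a.up h).up h' = a.up (h + h') := by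
  ext <;> simp [add_assoc]
@[simp] lemma Pt.up_zero (a : Pt) : a.up 0 = a := by ext <;> simp

lemma two_zpow_pos (k : ℤ) : (0:ℝ) < 2 ^ k := by positivity

lemma two_zpow_add (k l : ℤ) : (2:ℝ) ^ (k + l) = 2 ^ k * 2 ^ l := zpow_add₀ two_ne_zero k l

lemma two_zpow_succ (k : ℤ) : (2:ℝ) ^ (k + 1) = 2 * 2 ^ k := by
  rw [two_zpow_add]; simp [mul_comm]

lemma two_zpow_le {k l : ℤ} (h : k ≤ l) : (2:ℝ) ^ k ≤ 2 ^ l :=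
  zpow_le_zpow_right₀ one_le_two h

lemma two_zpow_le_iff {k l : ℤ} : (2:ℝ) ^ k ≤ 2 ^ l ↔ k ≤ l :=
  zpow_le_zpow_iff_right₀ one_lt_two

lemma two_zpow_neg_mul (k : ℤ) : (2:ℝ) ^ (-k) * 2 ^ k = 1 := by
  rw [← two_zpow_add]; simp

lemma two_zpow_mul_neg (k : ℤ) : (2:ℝ) ^ k * 2 ^ (-k) = 1 := by
  rw [← two_zpow_add]; simp

lemma Near.flip {R : ℕ} {a b : Pt} (h : Near R a b) : Near R a.flip b.flip := by
  obtain ⟨h1, h2, h3⟩ := h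
  refine ⟨?_, h3, by simpa using h2⟩
  simpa [abs_sub_comm, neg_add_eq_sub] using h1

lemma Near.flip_iff {R : ℕ} {a b : Pt} : Near R a.flip b.flip ↔ Near R a b :=
  ⟨fun h => by simpa using h.flip, Near.flip⟩

lemma Near.symm {R : ℕ} {a b : Pt} (h : Near R a b) : Near (2 * R) b a := by
  obtain ⟨h1, h2, h3⟩ := h
  rw [abs_le] at h1
  refine ⟨?_, ?_, ?_⟩
  · rw [abs_le]; push_cast; constructor <;> linarith
  · rw [abs_sub_comm]; exact h2.trans (two_zpow_le (by push_cast; linarith))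
  · rw [abs_sub_comm]; exact h3.trans (two_zpow_le (by push_cast; linarith))

lemma Near.trans {R S : ℕ} {a b c : Pt} (h : Near R a b) (h' : Near S b c) :
    Near (R + S + 1) a c := by
  obtain ⟨h1, h2, h3⟩ := h
  obtain ⟨h1', h2', h3'⟩ := h'
  have e1 := abs_sub_le a.x b.x c.x
  have e2 := abs_sub_le a.y b.y c.y
  have e3 := abs_sub_le a.k b.k c.k
  rw [abs_le] at h1
  refine ⟨by push_cast; linarith [abs_le.2 h1], ?_, ?_⟩
  · have : (2:ℝ) ^ (a.k + ((R + S + 1 : ℕ) : ℤ)) = 2 * 2 ^ (a.k + R + S) := by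
      rw [← two_zpow_succ]; push_cast; ring_nf
    have l1 : (2:ℝ) ^ (a.k + (R:ℤ)) ≤ 2 ^ (a.k + R + S) := two_zpow_le (by linarith [S.cast_nonneg (α := ℤ)])
    have l2 : (2:ℝ) ^ (b.k + (S:ℤ)) ≤ 2 ^ (a.k + R + S) := two_zpow_le (by linarith)
    linarith
  · have : (2:ℝ) ^ (-a.k + ((R + S + 1 : ℕ) : ℤ)) = 2 * 2 ^ (-a.k + R + S) := by
      rw [← two_zpow_succ]; push_cast; ring_nf
    have l1 : (2:ℝ) ^ (-a.k + (R:ℤ)) ≤ 2 ^ (-a.k + R + S) := two_zpow_le (by linarith [S.cast_nonneg (α := ℤ)])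
    have l2 : (2:ℝ) ^ (-b.k + (S:ℤ)) ≤ 2 ^ (-a.k + R + S) := two_zpow_le (by linarith)
    linarith

lemma Near.mono {R S : ℕ} (hRS : R ≤ S) {a b : Pt} (h : Near R a b) : Near S a b := by
  have hz : (R:ℤ) ≤ S := by exact_mod_cast hRS
  exact ⟨h.1.trans hz, h.2.1.trans (two_zpow_le (by linarith)),
    h.2.2.trans (two_zpow_le (by linarith))⟩

lemma Near.refl (R : ℕ) (a : Pt) : Near R a a := by
  refine ⟨by simp, ?_, ?_⟩ <;> simp <;> positivity

lemma Pt.floor_x (a : Pt) : (a.cell.i : ℝ) * 2 ^ a.k ≤ a.x ∧ a.x < (a.cell.i : ℝ) * 2 ^ a.k + 2 ^ a.k := by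
  have h1 := Int.floor_le (a.x * 2 ^ (-a.k))
  have h2 := Int.lt_floor_add_one (a.x * 2 ^ (-a.k))
  have hp := two_zpow_pos a.k
  have e : a.x * 2 ^ (-a.k) * 2 ^ a.k = a.x := by
    rw [mul_assoc, two_zpow_neg_mul, mul_one]
  constructor
  · have := mul_le_mul_of_nonneg_right h1 hp.le
    rwa [e] at this
  · have := mul_lt_mul_of_pos_right h2 hp
    rw [e] at this; simpa [add_mul] using this

lemma Pt.floor_y (a : Pt) : (a.cell.j : ℝ) * 2 ^ (-a.k) ≤ a.y ∧
    a.y < (a.cell.j : ℝ) * 2 ^ (-a.k) + 2 ^ (-a.k) := by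
  simpa using a.flip.floor_x

lemma Pt.near_corner (a : Pt) : Near 0 a.cell.corner a := by
  have h1 := a.floor_x
  have h2 := a.floor_y
  refine ⟨by simp, ?_, ?_⟩
  · rw [abs_le]; simp at h1 ⊢; constructor <;> linarith
  · rw [abs_le]; simp at h2 ⊢; constructor <;> linarith

lemma Cell.cell_corner (s : Cell) : s.corner.cell = s := by
  ext <;> simp [mul_assoc, -zpow_neg, two_zpow_mul_neg, two_zpow_neg_mul]

/-- The coarse equivalences of the discrete model. -/
structure CQI (A : ℕ) (φ ψ : Cell → Cell) : Prop where
  lip : ∀ s u : Cell, Near 1 s.corner u.corner → Near A (φ s).corner (φ u).corner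
  lip' : ∀ s u : Cell, Near 1 s.corner u.corner → Near A (ψ s).corner (ψ u).corner
  right_inv : ∀ s : Cell, Near A (φ (ψ s)).corner s.corner
  left_inv : ∀ s : Cell, Near A (ψ (φ s)).corner s.corner

lemma CQI.symm {A : ℕ} {φ ψ : Cell → Cell} (h : CQI A φ ψ) : CQI A ψ φ :=
  ⟨h.lip', h.lip, h.left_inv, h.right_inv⟩

lemma CQI.flip_source {A : ℕ} {φ ψ : Cell → Cell} (h : CQI A φ ψ) :
    CQI A (fun s => φ s.flip) (fun s => (ψ s).flip) where
  lip s u hs := h.lip _ _ (by simpa [Near.flip_iff] using hs)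
  lip' s u hs := by simpa [Near.flip_iff] using h.lip' _ _ hs
  right_inv s := by simpa using h.right_inv s
  left_inv s := by
    have := h.left_inv s.flip
    rw [← Near.flip_iff] at this
    simpa using this

lemma CQI.flip_target {A : ℕ} {φ ψ : Cell → Cell} (h : CQI A φ ψ) :
    CQI A (fun s => (φ s).flip) (fun s => ψ s.flip) := h.symm.flip_source.symm

/-- The point of the target associated with a point. -/
def img (φ : Cell → Cell) (a : Pt) : Pt := (φ a.cell).corner

/-- The height of the image of a point. -/
def ht (φ : Cell → Cell) (a : Pt) : ℤ := (φ a.cell).k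

@[simp] lemma img_k (φ : Cell → Cell) (a : Pt) : (img φ a).k = ht φ a := rfl

lemma Pt.near_one_up (a : Pt) : Near 1 a.cell.corner (a.up 1).cell.corner := by
  have h1 := a.floor_x
  have h2 := a.floor_y
  have h3 := (a.up 1).floor_x
  have h4 := (a.up 1).floor_y
  have e : (2:ℝ) ^ (-a.k) = 2 * 2 ^ (-(a.k + 1)) := by rw [← two_zpow_succ]; ring_nf
  have hp := two_zpow_pos (-(a.k+1))
  refine ⟨by simp, ?_, ?_⟩
  · simp only [Pt.up_x, Pt.up_k, two_zpow_succ, Cell.corner_x, Cell.corner_k, Pt.cell_k, Nat.cast_one] at *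
    rw [abs_le]; constructor <;> linarith
  · simp only [Pt.up_y, Pt.up_k, two_zpow_succ, Cell.corner_y, Cell.corner_k, Pt.cell_k, Nat.cast_one] at *
    rw [abs_le]; constructor <;> linarith

lemma Pt.near_one_down (a : Pt) : Near 1 (a.up 1).cell.corner a.cell.corner := by
  have := (a.up 1).flip.near_one_up
  have e : (a.up 1).flip.up 1 = a.flip := by ext <;> simp
  rw [e] at this
  simpa [Near.flip_iff] using this

lemma Pt.near_one_jump {a b : Pt} (hk : a.k = b.k) (hx : |a.x - b.x| ≤ 2 ^ a.k)
    (hy : |a.y - b.y| ≤ 2 ^ (-a.k)) : Near 1 a.cell.corner b.cell.corner := by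
  have h1 := a.floor_x
  have h2 := a.floor_y
  have h3 := b.floor_x
  have h4 := b.floor_y
  rw [abs_le] at hx hy
  refine ⟨by simp [hk], ?_, ?_⟩
  · simp only [two_zpow_succ, Cell.corner_x, Cell.corner_k, Pt.cell_k, Nat.cast_one, ← hk] at *
    rw [abs_le]; constructor <;> linarith
  · simp only [two_zpow_succ, Cell.corner_y, Cell.corner_k, Pt.cell_k, Nat.cast_one, ← hk] at *
    rw [abs_le]; constructor <;> linarith

section
variable {A : ℕ} {φ ψ : Cell → Cell} (H : CQI A φ ψ)
include H

lemma CQI.img_up (a : Pt) : Near A (img φ a) (img φ (a.up 1)) := H.lip _ _ a.near_one_up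

lemma CQI.img_down (a : Pt) : Near A (img φ (a.up 1)) (img φ a) := H.lip _ _ a.near_one_down

lemma CQI.img_jump {a b : Pt} (hk : a.k = b.k) (hx : |a.x - b.x| ≤ 2 ^ a.k)
    (hy : |a.y - b.y| ≤ 2 ^ (-a.k)) : Near A (img φ a) (img φ b) :=
  H.lip _ _ (Pt.near_one_jump hk hx hy)

lemma CQI.img_up_nat (a : Pt) (n : ℕ) : Near (n * (A + 1)) (img φ a) (img φ (a.up n)) := by
  induction n with
  | zero => simpa using Near.refl 0 _
  | succ n ih =>
    have := ih.trans (H.img_up (a.up n))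
    rw [Pt.up_up] at this
    refine Near.mono ?_ (by exact_mod_cast this)
    linarith

lemma CQI.img_down_nat (a : Pt) (n : ℕ) : Near (n * (A + 1)) (img φ (a.up n)) (img φ a) := by
  induction n with
  | zero => simpa using Near.refl 0 _
  | succ n ih =>
    have := (H.img_down (a.up n)).trans ih
    rw [Pt.up_up] at this
    refine Near.mono ?_ (by exact_mod_cast this)
    linarith

lemma CQI.img_near {R : ℕ} {a b : Pt} (h : Near R a b) :
    Near ((5 * R + 4) * (A + 1)) (img φ a) (img φ b) := by
  obtain ⟨h1, h2, h3⟩ := h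
  have s1 := H.img_up_nat a R
  let b1 : Pt := ⟨b.x, a.y, a.k + R⟩
  have s2 : Near A (img φ (a.up R)) (img φ b1) := H.img_jump rfl (by simpa [b1] using h2) (by simp [b1]; positivity)
  have e3 : b1 = (⟨b.x, a.y, a.k - R⟩ : Pt).up ((2 * R : ℕ) : ℤ) := by
    ext <;> simp [b1]; ring
  have s3 := H.img_down_nat (⟨b.x, a.y, a.k - R⟩ : Pt) (2 * R)
  rw [← e3] at s3
  have s4 : Near A (img φ ⟨b.x, a.y, a.k - R⟩) (img φ ⟨b.x, b.y, a.k - R⟩) :=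
    H.img_jump rfl (by simp; positivity) (by simpa [neg_add_eq_sub] using h3)
  rw [abs_le] at h1
  have e5 : b = (⟨b.x, b.y, a.k - R⟩ : Pt).up (((b.k - a.k + R).toNat : ℕ) : ℤ) := by
    ext <;> simp
    rw [max_eq_left (by linarith)]; ring
  have s5 := H.img_up_nat (⟨b.x, b.y, a.k - R⟩ : Pt) (b.k - a.k + R).toNat
  rw [← e5] at s5
  have hn : (b.k - a.k + R).toNat ≤ 2 * R := by omega
  have hn' := Nat.mul_le_mul_right (A + 1) hn
  refine Near.mono ?_ ((((s1.trans s2).trans s3).trans s4).trans s5)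
  nlinarith

lemma CQI.near_of_img_eq {a b : Pt} {R : ℕ} (h : Near R (img φ a) (img φ b)) :
    Near ((5 * R + 4) * (A + 1) + 3 * A + 2) a.cell.corner b.cell.corner := by
  have h1 := H.symm.img_near h
  simp only [img, Cell.cell_corner] at h1
  refine Near.mono ?_ (((H.left_inv a.cell).symm.trans h1).trans (H.left_inv b.cell))
  linarith

lemma CQI.ht_up (a : Pt) (n : ℕ) : |ht φ (a.up n) - ht φ a| ≤ n * A := by
  induction n with
  | zero => simp
  | succ n ih =>
    have := (H.img_down (a.up n)).1
    rw [Pt.up_up] at this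
    have t := abs_sub_le (ht φ (a.up (n+1))) (ht φ (a.up n)) (ht φ a)
    push_cast at *
    simp only [img_k] at this
    linarith

end

/-! ### Counting cells -/

lemma card_int_le (I : Finset ℤ) {w U X : ℝ} (hw : 0 < w) (hU : w ≤ U)
    (h : ∀ i ∈ I, |(i:ℝ) * w - X| ≤ U) : (I.card : ℝ) ≤ 3 * (U / w) := by
  have hsub : I ⊆ Finset.Icc ⌈(X - U) / w⌉ ⌊(X + U) / w⌋ := by
    intro i hi
    have := abs_le.1 (h i hi)
    rw [Finset.mem_Icc, Int.ceil_le, Int.le_floor, div_le_iff₀ hw, le_div_iff₀ hw]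
    constructor <;> linarith
  have h1 : (1:ℝ) ≤ U / w := by rwa [le_div_iff₀ hw, one_mul]
  have h2 : ((I.card : ℤ):ℝ) ≤ ((⌊(X + U) / w⌋ + 1 - ⌈(X - U) / w⌉).toNat : ℤ) := by
    exact_mod_cast (Finset.card_le_card hsub).trans (by simp)
  rw [Int.toNat_eq_max] at h2
  push_cast at h2
  have h3 := Int.floor_le ((X + U) / w)
  have h4 := Int.le_ceil ((X - U) / w)
  have e : (X + U) / w - (X - U) / w = 2 * (U / w) := by ring
  refine h2.trans (max_le ?_ ?_) <;> linarith

lemma card_cells_le (T : Finset Cell) {X Y U V : ℝ} {α β : ℤ} (hU : 2 ^ α ≤ U)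
    (hV : 2 ^ (-β) ≤ V) (hβα : β ≤ α)
    (h : ∀ s ∈ T, |s.corner.x - X| ≤ U ∧ |s.corner.y - Y| ≤ V ∧ β ≤ s.k ∧ s.k ≤ α) :
    (T.card : ℝ) ≤ 9 * U * V * (α - β + 1) := by
  have hmap : ∀ s ∈ T, s.k ∈ Finset.Icc β α := fun s hs => Finset.mem_Icc.2 (h s hs).2.2
  have key : ∀ k ∈ Finset.Icc β α, ((T.filter (fun s => s.k = k)).card : ℝ) ≤ 9 * U * V := by
    intro k hk
    rw [Finset.mem_Icc] at hk
    set T' := T.filter (fun s => s.k = k)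
    have hc : T'.card ≤ (T'.image Cell.i).card * (T'.image Cell.j).card := by
      rw [← Finset.card_product]
      refine Finset.card_le_card_of_injOn (fun s => (s.i, s.j)) ?_ ?_
      · intro s hs
        simp only [Finset.coe_product, Set.mem_prod]
        exact ⟨Finset.mem_coe.2 (Finset.mem_image_of_mem _ hs), Finset.mem_coe.2 (Finset.mem_image_of_mem _ hs)⟩
      · intro s hs u hu e
        have h1 := (Finset.mem_filter.1 hs).2
        have h2 := (Finset.mem_filter.1 hu).2
        simp only [Prod.mk.injEq] at e
        exact Cell.ext e.1 e.2 (h1.trans h2.symm)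
    have hi : ((T'.image Cell.i).card : ℝ) ≤ 3 * (U / 2 ^ k) := by
      refine card_int_le (X := X) _ (by positivity) ((two_zpow_le hk.2).trans hU) ?_
      intro i hi
      obtain ⟨s, hs, rfl⟩ := Finset.mem_image.1 hi
      have := (h s (Finset.mem_filter.1 hs).1).1
      rwa [Cell.corner_x, (Finset.mem_filter.1 hs).2] at this
    have hj : ((T'.image Cell.j).card : ℝ) ≤ 3 * (V / 2 ^ (-k)) := by
      refine card_int_le (X := Y) _ (by positivity) ((two_zpow_le (by linarith)).trans hV) ?_
      intro i hi
      obtain ⟨s, hs, rfl⟩ := Finset.mem_image.1 hi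
      have := (h s (Finset.mem_filter.1 hs).1).2.1
      rwa [Cell.corner_y, (Finset.mem_filter.1 hs).2] at this
    calc (T'.card : ℝ) ≤ (T'.image Cell.i).card * (T'.image Cell.j).card := by exact_mod_cast hc
      _ ≤ 3 * (U / 2 ^ k) * (3 * (V / 2 ^ (-k))) := mul_le_mul hi hj (by positivity) ((Nat.cast_nonneg _).trans hi)
      _ = 9 * U * V * (1 / (2 ^ k * 2 ^ (-k))) := by rw [one_div, mul_inv]; ring
      _ = 9 * U * V := by rw [two_zpow_mul_neg]; ring
  rw [Finset.card_eq_sum_card_fiberwise hmap]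
  push_cast
  refine (Finset.sum_le_sum key).trans ?_
  have : (((α + 1 - β).toNat : ℤ) : ℝ) = α + 1 - β := by
    rw [Int.toNat_of_nonneg (by linarith)]; push_cast; ring
  rw [Finset.sum_const, Int.card_Icc, nsmul_eq_mul, ← Int.cast_natCast (R := ℝ), this]
  linarith

/-- The size of a coarse ball of radius `R`. -/
def ballCard (R : ℕ) : ℕ := 9 * 4 ^ R * (2 * R + 1)

lemma card_near_le (T : Finset Cell) (R : ℕ) (c : Pt) (h : ∀ s ∈ T, Near R c s.corner) :
    T.card ≤ ballCard R := by
  have := card_cells_le T (X := c.x) (Y := c.y) (U := 2 ^ (c.k + R)) (V := 2 ^ (-c.k + R))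
    (α := c.k + R) (β := c.k - R) le_rfl (two_zpow_le (by linarith)) (by linarith) (by
      intro s hs
      obtain ⟨h1, h2, h3⟩ := h s hs
      rw [abs_le] at h1
      rw [abs_sub_comm, abs_sub_comm s.corner.y]
      simp only [Cell.corner_k] at h1
      exact ⟨h2, h3, by linarith, by linarith⟩)
  have e : (2:ℝ) ^ (c.k + (R:ℤ)) * 2 ^ (-c.k + (R:ℤ)) = 4 ^ R := by
    rw [← two_zpow_add, show c.k + (R:ℤ) + (-c.k + R) = ((2 * R : ℕ) : ℤ) by push_cast; ring,
      zpow_natCast, pow_mul]; norm_num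
  rw [mul_assoc 9, e] at this
  rw [← Nat.cast_le (α := ℝ), ballCard]
  push_cast at *
  linarith

/-- A bound for the multiplicity of the maps of a coarse equivalence. -/
def mult (A : ℕ) : ℕ := ballCard (7 * A + 6)

section
variable {A : ℕ} {φ ψ : Cell → Cell} (H : CQI A φ ψ)
include H

lemma CQI.card_fiber (S : Finset Cell) (u : Cell) : (S.filter (fun s => φ s = u)).card ≤ mult A := by
  rcases (S.filter (fun s => φ s = u)).eq_empty_or_nonempty with h | ⟨s, hs⟩
  · simp [h]
  refine card_near_le _ _ s.corner ?_
  intro v hv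
  have e : φ s = φ v := ((Finset.mem_filter.1 hs).2).trans ((Finset.mem_filter.1 hv).2).symm
  have := H.near_of_img_eq (a := s.corner) (b := v.corner) (R := 0) (by
    simp only [img, Cell.cell_corner, e]; exact Near.refl _ _)
  simp only [Cell.cell_corner] at this
  exact this.mono (by linarith)

lemma CQI.count (S : Finset Cell) {X Y U V : ℝ} {α β : ℤ} (hU : 2 ^ α ≤ U)
    (hV : 2 ^ (-β) ≤ V) (hβα : β ≤ α)
    (h : ∀ s ∈ S, |(φ s).corner.x - X| ≤ U ∧ |(φ s).corner.y - Y| ≤ V ∧ β ≤ (φ s).k ∧ (φ s).k ≤ α) :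
    (S.card : ℝ) ≤ mult A * (9 * U * V * (α - β + 1)) := by
  have h1 : S.card ≤ mult A * (S.image φ).card :=
    Finset.card_le_mul_card_image S _ fun u _ => H.card_fiber S u
  have h2 := card_cells_le (S.image φ) hU hV hβα (by
    intro s hs
    obtain ⟨u, hu, rfl⟩ := Finset.mem_image.1 hs
    exact h u hu)
  calc (S.card : ℝ) ≤ mult A * (S.image φ).card := by exact_mod_cast h1
    _ ≤ _ := by gcongr

lemma CQI.vert_x (a : Pt) (n : ℕ) {α : ℤ} (h : ∀ i < n, ht φ (a.up i) ≤ α) :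
    |(img φ (a.up n)).x - (img φ a).x| ≤ n * 2 ^ (α + A) := by
  induction n with
  | zero => simp
  | succ n ih =>
    have h1 := ih fun i hi => h i (by omega)
    have h2 := (H.img_up (a.up n)).2.1
    rw [Pt.up_up, abs_sub_comm] at h2
    have h3 : (2:ℝ) ^ ((img φ (a.up n)).k + (A:ℤ)) ≤ 2 ^ (α + A) :=
      two_zpow_le (by linarith [h n (by omega), img_k φ (a.up n)])
    have h4 := abs_sub_le (img φ (a.up (n+1))).x (img φ (a.up n)).x (img φ a).x
    push_cast
    linarith

lemma CQI.vert_y (a : Pt) (n : ℕ) {β : ℤ} (h : ∀ i < n, β ≤ ht φ (a.up i)) :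
    |(img φ (a.up n)).y - (img φ a).y| ≤ n * 2 ^ (-β + A) := by
  induction n with
  | zero => simp
  | succ n ih =>
    have h1 := ih fun i hi => h i (by omega)
    have h2 := (H.img_up (a.up n)).2.2
    rw [Pt.up_up, abs_sub_comm] at h2
    have h3 : (2:ℝ) ^ (-(img φ (a.up n)).k + (A:ℤ)) ≤ 2 ^ (-β + A) :=
      two_zpow_le (by linarith [h n (by omega), img_k φ (a.up n)])
    have h4 := abs_sub_le (img φ (a.up (n+1))).y (img φ (a.up n)).y (img φ a).y
    push_cast
    linarith

end

lemma poly_mul_two_rpow_le (C : ℝ) (d : ℕ) {ε ε' : ℝ} (hε : 0 < ε) (hε' : 0 < ε') :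
    ∃ n₀ : ℕ, ∀ n ≥ n₀, ∀ m : ℤ, (m : ℝ) ≤ (1 - ε) * n →
      C * ((n:ℝ) + 1) ^ d * 2 ^ m ≤ ε' * 2 ^ n := by
  set r : ℝ := (2:ℝ) ^ (-ε)
  have hr0 : 0 < r := by positivity
  have hr : |r| < 1 := by
    rw [abs_of_pos hr0]
    exact Real.rpow_lt_one_of_one_lt_of_neg one_lt_two (by linarith)
  have h1 := (tendsto_pow_const_mul_const_pow_of_abs_lt_one d hr).comp (Filter.tendsto_add_atTop_nat 1)
  have h2 := h1.const_mul (|C| / r)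
  rw [mul_zero] at h2
  obtain ⟨n₀, hn₀⟩ := Filter.eventually_atTop.1 (h2.eventually_le_const hε')
  refine ⟨n₀, fun n hn m hm => ?_⟩
  have h3 := hn₀ n hn
  simp only [Function.comp] at h3
  have h4 : (2:ℝ) ^ m ≤ 2 ^ n * r ^ n := by
    rw [← Real.rpow_intCast, ← Real.rpow_natCast, ← Real.rpow_natCast, ← Real.rpow_mul (by norm_num),
      ← Real.rpow_add (by norm_num)]
    exact Real.rpow_le_rpow_of_exponent_le one_le_two (by linarith)
  calc C * ((n:ℝ) + 1) ^ d * 2 ^ m ≤ |C| * ((n:ℝ) + 1) ^ d * (2 ^ n * r ^ n) := by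
        gcongr; exact le_abs_self C
    _ = (|C| / r * (((n + 1 : ℕ) : ℝ) ^ d * r ^ (n + 1))) * 2 ^ n := by
        push_cast; field_simp; ring
    _ ≤ ε' * 2 ^ n := by gcongr

section
variable {A : ℕ} {φ ψ : Cell → Cell} (H : CQI A φ ψ)
include H

lemma CQI.count_small (D : ℕ) {ε ε' : ℝ} (hε : 0 < ε) (hε' : 0 < ε') :
    ∃ n₀ : ℕ, ∀ n ≥ n₀, ∀ (S : Finset Cell) (X Y : ℝ) (α β : ℤ), ((α - β : ℤ) : ℝ) ≤ (1 - ε) * n →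
      (∀ s ∈ S, |(φ s).corner.x - X| ≤ D * (n + 1) * 2 ^ (α + D) ∧
        |(φ s).corner.y - Y| ≤ D * (n + 1) * 2 ^ (-β + D) ∧ β ≤ (φ s).k ∧ (φ s).k ≤ α) →
      (n + 1) * (S.card : ℝ) ≤ ε' * 2 ^ n := by
  obtain ⟨n₀, hn₀⟩ := poly_mul_two_rpow_le (mult A * (9 * ((D + 1) * 2 ^ D) ^ 2)) 4 hε hε'
  refine ⟨n₀, fun n hn S X Y α β hαβ h => ?_⟩
  rcases S.eq_empty_or_nonempty with rfl | ⟨s, hs⟩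
  · simp; positivity
  have hβα : β ≤ α := (h s hs).2.2.1.trans (h s hs).2.2.2
  have hle : ∀ m : ℤ, (2:ℝ) ^ m ≤ (D + 1) * (n + 1) * 2 ^ (m + D) := by
    intro m
    calc (2:ℝ) ^ m ≤ 1 * 2 ^ (m + (D:ℤ)) := by rw [one_mul]; exact two_zpow_le (by linarith [D.cast_nonneg (α := ℤ)])
      _ ≤ _ := by
        gcongr
        nlinarith [D.cast_nonneg (α := ℝ), n.cast_nonneg (α := ℝ), mul_nonneg (D.cast_nonneg (α := ℝ)) (n.cast_nonneg (α := ℝ))]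
  have h1 := H.count S (X := X) (Y := Y) (U := (D + 1) * (n + 1) * 2 ^ (α + D))
    (V := (D + 1) * (n + 1) * 2 ^ (-β + D)) (hle _) (hle _) hβα (by
      intro s hs
      obtain ⟨a1, a2, a3⟩ := h s hs
      refine ⟨a1.trans ?_, a2.trans ?_, a3⟩ <;> gcongr <;> linarith)
  have h2 := hn₀ n hn (α - β) hαβ
  have hn1 : ((α:ℝ) - β + 1) ≤ n + 1 := by
    have : (1 - ε) * n ≤ n := by nlinarith [n.cast_nonneg (α := ℝ)]
    push_cast at hαβ
    linarith
  refine le_trans ?_ h2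
  calc ((n:ℝ) + 1) * (S.card : ℝ) ≤ (n + 1) * (mult A * (9 * ((D + 1) * (n + 1) * 2 ^ (α + (D:ℤ))) *
        ((D + 1) * (n + 1) * 2 ^ (-β + (D:ℤ))) * (n + 1))) := by
        refine mul_le_mul_of_nonneg_left (h1.trans ?_) (by positivity)
        gcongr
    _ = _ := by
        rw [two_zpow_add, two_zpow_add, sub_eq_add_neg, two_zpow_add]
        simp only [zpow_natCast]; ring

end

lemma Pt.leaf_j (a : Pt) (n i : ℕ) :
    ((a.ys (i / 2 ^ n)).up n).cell.j = ⌊a.y * 2 ^ (a.k + n)⌋ + i := by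
  have : (i / 2 ^ n * 2 ^ (-a.k)) * (2:ℝ) ^ (a.k + n) = i := by
    rw [two_zpow_add, zpow_natCast]
    have := two_zpow_neg_mul a.k
    field_simp
    linear_combination (i:ℝ) * this
  simp only [Pt.cell_j, Pt.up_y, Pt.ys_y, Pt.up_k, Pt.ys_k, add_mul, this]
  simp

/-- Most vertical lines issued from a cell have an image spreading over many levels. -/
lemma CQI.range_bound {A : ℕ} {φ ψ : Cell → Cell} (H : CQI A φ ψ) {ε : ℝ} (hε : 0 < ε) :
    ∃ n₀ : ℕ, ∀ n ≥ n₀, ∀ (a : Pt) (B : Finset ℕ), B ⊆ Finset.range (2 ^ n) →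
      (∀ i ∈ B, ∀ h ≤ n, ∀ h' ≤ n, ((ht φ ((a.ys (i / 2 ^ n)).up (h:ℕ)) : ℝ) -
        ht φ ((a.ys (i / 2 ^ n)).up (h':ℕ))) ≤ (1 - ε) * n) → (B.card : ℝ) ≤ ε * 2 ^ n := by
  obtain ⟨n₀, hn₀⟩ := H.count_small (2 * A + 1) hε (ε' := ε / (2 * A + 1)) (by positivity)
  refine ⟨n₀, fun n hn a B hB hbad => ?_⟩
  set F : ℕ → ℕ → ℤ := fun i h => ht φ ((a.ys (i / 2 ^ n)).up (h:ℕ)) with hF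
  have hmin : ∀ i, ∃ h₀ ≤ n, ∀ h ≤ n, F i h₀ ≤ F i h := by
    intro i
    obtain ⟨h₀, h1, h2⟩ := Finset.exists_min_image (Finset.range (n + 1)) (F i) ⟨0, by simp⟩
    exact ⟨h₀, by simpa [Nat.lt_succ_iff] using h1, fun h hh => h2 h (by simpa [Nat.lt_succ_iff] using hh)⟩
  choose m hmn hm using hmin
  have hjump : ∀ i ∈ B, Near A (img φ a) (img φ (a.ys (i / 2 ^ n))) := by
    intro i hi
    refine H.img_jump rfl (by simp; positivity) ?_
    have hi' : (i:ℝ) / 2 ^ n ≤ 1 := by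
      rw [div_le_one (by positivity)]
      exact_mod_cast (Finset.mem_range.1 (hB hi)).le
    have : a.y - (a.ys (i / 2 ^ n)).y = - ((i:ℝ) / 2 ^ n * 2 ^ (-a.k)) := by simp
    rw [this, abs_neg, abs_of_nonneg (by positivity)]
    nlinarith [two_zpow_pos (-a.k)]
  have hmap : ∀ i ∈ B, F i (m i) ∈ Finset.Icc (ht φ a - A - n * A) (ht φ a + A) := by
    intro i hi
    have h1 := H.ht_up (a.ys (i / 2 ^ n)) (m i)
    have h2 := abs_le.1 (hjump i hi).1
    have h3 := hm i 0 (by omega)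
    have h4 : (m i : ℤ) * A ≤ n * A := by have := hmn i; gcongr
    rw [abs_le] at h1
    simp only [hF, img_k, Nat.cast_zero, Pt.up_zero] at *
    rw [Finset.mem_Icc]
    constructor <;> linarith
  have key : ∀ μ ∈ Finset.Icc (ht φ a - A - n * A) (ht φ a + A),
      (n + 1) * ((B.filter (fun i => F i (m i) = μ)).card : ℝ) ≤ ε / (2 * A + 1) * 2 ^ n := by
    intro μ _
    set B' := B.filter (fun i => F i (m i) = μ) with hB'
    have hcard : (B'.image fun i : ℕ => ((a.ys (i / 2 ^ n)).up n).cell).card = B'.card := by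
      refine Finset.card_image_of_injective _ ?_
      intro i i' e
      have := congrArg Cell.j e
      simp only [Pt.leaf_j] at this
      omega
    rw [← hcard]
    refine hn₀ n hn _ (img φ a).x (img φ a).y (μ + ⌊(1 - ε) * n⌋) μ ?_ ?_
    · simp [Int.floor_le]
    · intro s hs
      obtain ⟨i, hi, rfl⟩ := Finset.mem_image.1 hs
      obtain ⟨hiB, hiμ⟩ := Finset.mem_filter.1 hi
      have hlow : ∀ h ≤ n, μ ≤ F i h := fun h hh => hiμ ▸ hm i h hh
      have hup : ∀ h ≤ n, F i h ≤ μ + ⌊(1 - ε) * n⌋ := by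
        intro h hh
        have := hbad i hiB h hh (m i) (hmn i)
        have h2 : F i h - μ ≤ ⌊(1 - ε) * n⌋ := by
          rw [Int.le_floor]; push_cast; rw [← hiμ]; exact this
        linarith
      obtain ⟨j1, j2, j3⟩ := hjump i hiB
      rw [abs_le] at j1
      have h0 : img φ (a.ys (i / 2 ^ n)) = img φ ((a.ys (i / 2 ^ n)).up ((0:ℕ):ℤ)) := by simp
      have l0 := hlow 0 (by omega)
      have u0 := hup 0 (by omega)
      simp only [hF, img_k, Nat.cast_zero, Pt.up_zero] at l0 u0 j1
      have v1 := H.vert_x (a.ys (i / 2 ^ n)) n (fun h hh => hup h hh.le)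
      have v2 := H.vert_y (a.ys (i / 2 ^ n)) n (fun h hh => hlow h hh.le)
      refine ⟨?_, ?_, hlow n le_rfl, hup n le_rfl⟩
      · refine (abs_sub_le _ (img φ (a.ys (i / 2 ^ n))).x _).trans ?_
        set α := μ + ⌊(1 - ε) * n⌋
        have b1 : (2:ℝ) ^ ((img φ a).k + (A:ℤ)) ≤ 2 ^ (α + (2 * A + 1 : ℕ)) :=
          two_zpow_le (by push_cast; simp only [img_k]; linarith)
        have b2 : (2:ℝ) ^ (α + (A:ℤ)) ≤ 2 ^ (α + (2 * A + 1 : ℕ)) :=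
          two_zpow_le (by push_cast; linarith)
        rw [abs_sub_comm] at j2
        have b3 : (n:ℝ) * 2 ^ (α + (A:ℤ)) ≤ n * 2 ^ (α + (2 * A + 1 : ℕ)) := by gcongr
        have b4 : (1:ℝ) ≤ (2 * A + 1 : ℕ) := by push_cast; linarith [A.cast_nonneg (α := ℝ)]
        have b5 : ((n:ℝ) + 1) * 2 ^ (α + (2 * A + 1 : ℕ)) ≤ (2 * A + 1 : ℕ) * ((n + 1) * 2 ^ (α + (2 * A + 1 : ℕ))) :=
          le_mul_of_one_le_left (by positivity) b4
        change |(img φ _).x - _| + _ ≤ _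
        linarith
      · refine (abs_sub_le _ (img φ (a.ys (i / 2 ^ n))).y _).trans ?_
        have b1 : (2:ℝ) ^ (-(img φ a).k + (A:ℤ)) ≤ 2 ^ (-μ + (2 * A + 1 : ℕ)) :=
          two_zpow_le (by push_cast; simp only [img_k]; linarith)
        have b2 : (2:ℝ) ^ (-μ + (A:ℤ)) ≤ 2 ^ (-μ + (2 * A + 1 : ℕ)) :=
          two_zpow_le (by push_cast; linarith)
        rw [abs_sub_comm] at j3
        have b3 : (n:ℝ) * 2 ^ (-μ + (A:ℤ)) ≤ n * 2 ^ (-μ + (2 * A + 1 : ℕ)) := by gcongr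
        have b4 : (1:ℝ) ≤ (2 * A + 1 : ℕ) := by push_cast; linarith [A.cast_nonneg (α := ℝ)]
        have b5 : ((n:ℝ) + 1) * 2 ^ (-μ + (2 * A + 1 : ℕ)) ≤ (2 * A + 1 : ℕ) * ((n + 1) * 2 ^ (-μ + (2 * A + 1 : ℕ))) :=
          le_mul_of_one_le_left (by positivity) b4
        change |(img φ _).y - _| + _ ≤ _
        linarith
  have hsum : (B.card : ℝ) = ∑ μ ∈ Finset.Icc (ht φ a - A - n * A) (ht φ a + A),
      ((B.filter (fun i => F i (m i) = μ)).card : ℝ) := by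
    exact_mod_cast Finset.card_eq_sum_card_fiberwise hmap
  have hc : ((Finset.Icc (ht φ a - A - n * A) (ht φ a + A)).card : ℝ) ≤ (2 * A + 1) * (n + 1) := by
    have : (Finset.Icc (ht φ a - A - n * A) (ht φ a + A)).card = 2 * A + n * A + 1 := by
      rw [Int.card_Icc]; zify; rw [Int.toNat_of_nonneg] <;> nlinarith [A.cast_nonneg (α := ℤ), n.cast_nonneg (α := ℤ)]
    rw [this]; push_cast
    nlinarith [A.cast_nonneg (α := ℝ), n.cast_nonneg (α := ℝ), mul_nonneg (A.cast_nonneg (α := ℝ)) (n.cast_nonneg (α := ℝ))]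
  have h5 := Finset.sum_le_sum key
  rw [← Finset.mul_sum, ← hsum, Finset.sum_const, nsmul_eq_mul] at h5
  have h6 : (n + 1) * (B.card : ℝ) ≤ (n + 1) * (ε * 2 ^ n) := by
    refine h5.trans ((mul_le_mul_of_nonneg_right hc (by positivity)).trans (le_of_eq ?_))
    field_simp
  exact le_of_mul_le_mul_left h6 (by positivity)

/-! ### Tiles -/

lemma two_pow_toNat (m : ℕ) : ((2:ℤ) ^ m).toNat = 2 ^ m := by
  rw [show ((2:ℤ) ^ m) = ((2 ^ m : ℕ) : ℤ) by push_cast; rfl, Int.toNat_natCast]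

/-- A dyadic tile with `n` levels starting at level `k₀`. -/
structure Tile where
  a : ℤ
  b : ℤ
  k₀ : ℤ
  n : ℕ

namespace Tile

/-- The points of the tile. -/
def Mem (T : Tile) (p : Pt) : Prop :=
  ((T.a * 2 ^ T.n : ℤ) * 2 ^ T.k₀ ≤ p.x ∧ p.x < (((T.a + 1) * 2 ^ T.n : ℤ) : ℝ) * 2 ^ T.k₀) ∧
  ((T.b * 2 ^ T.n : ℤ) * 2 ^ (-(T.k₀ + T.n)) ≤ p.y ∧
    p.y < (((T.b + 1) * 2 ^ T.n : ℤ) : ℝ) * 2 ^ (-(T.k₀ + T.n))) ∧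
  T.k₀ ≤ p.k ∧ p.k < T.k₀ + T.n

/-- The points of the natural grid. -/
def gpt (T : Tile) (u v : ℤ) (h : ℤ) : Pt := ⟨u * 2 ^ T.k₀, v * 2 ^ (-(T.k₀ + T.n)), T.k₀ + h⟩

/-- The first coordinates of the grid of a tile. -/
def us (T : Tile) : Finset ℤ := Finset.Ico (T.a * 2 ^ T.n) ((T.a + 1) * 2 ^ T.n)

/-- The second coordinates of the grid of a tile. -/
def vs (T : Tile) : Finset ℤ := Finset.Ico (T.b * 2 ^ T.n) ((T.b + 1) * 2 ^ T.n)

/-- The indices of the grid of a tile. -/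
def idx (T : Tile) : Finset (ℤ × ℤ × ℕ) := T.us ×ˢ T.vs ×ˢ Finset.range T.n

/-- The grid point with given index. -/
def ipt (T : Tile) (q : ℤ × ℤ × ℕ) : Pt := T.gpt q.1 q.2.1 q.2.2

open Classical in
/-- The grid of a tile. -/
def pts (T : Tile) : Finset Pt := T.idx.image T.ipt

@[simp] lemma gpt_x (T : Tile) (u v h : ℤ) : (T.gpt u v h).x = u * 2 ^ T.k₀ := rfl
@[simp] lemma gpt_y (T : Tile) (u v h : ℤ) : (T.gpt u v h).y = v * 2 ^ (-(T.k₀ + T.n)) := rfl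
@[simp] lemma gpt_k (T : Tile) (u v h : ℤ) : (T.gpt u v h).k = T.k₀ + h := rfl

lemma card_us (T : Tile) : T.us.card = 2 ^ T.n := by
  rw [us, Int.card_Ico, ← sub_mul]; simp [two_pow_toNat]

lemma card_vs (T : Tile) : T.vs.card = 2 ^ T.n := by
  rw [vs, Int.card_Ico, ← sub_mul]; simp [two_pow_toNat]

lemma gpt_inj (T : Tile) {u v h u' v' h' : ℤ} (e : T.gpt u v h = T.gpt u' v' h') :
    u = u' ∧ v = v' ∧ h = h' := by
  have h1 := congrArg Pt.x e
  have h2 := congrArg Pt.y e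
  have h3 := congrArg Pt.k e
  simp only [gpt_x, gpt_y, gpt_k] at h1 h2 h3
  have h4 := mul_right_cancel₀ (two_zpow_pos _).ne' h1
  have h5 := mul_right_cancel₀ (two_zpow_pos _).ne' h2
  exact ⟨by exact_mod_cast h4, by exact_mod_cast h5, by linarith⟩

lemma ipt_injective (T : Tile) : Function.Injective T.ipt := by
  rintro ⟨u, v, h⟩ ⟨u', v', h'⟩ e
  obtain ⟨h1, h2, h3⟩ := T.gpt_inj e
  simp only [Prod.mk.injEq]
  exact ⟨h1, h2, by exact_mod_cast h3⟩

lemma card_idx (T : Tile) : T.idx.card = 4 ^ T.n * T.n := by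
  rw [idx, Finset.card_product, Finset.card_product, card_us, card_vs, Finset.card_range,
    show 4 = 2 * 2 from rfl, mul_pow]; ring

lemma card_pts (T : Tile) : T.pts.card = 4 ^ T.n * T.n := by
  classical
  rw [pts, Finset.card_image_of_injective _ T.ipt_injective, card_idx]

lemma mem_gpt_iff (T : Tile) (u v h : ℤ) :
    T.Mem (T.gpt u v h) ↔ u ∈ T.us ∧ v ∈ T.vs ∧ 0 ≤ h ∧ h < T.n := by
  simp only [Mem, gpt_x, gpt_y, gpt_k, us, vs, Finset.mem_Ico,
    mul_le_mul_iff_left₀ (two_zpow_pos _), mul_lt_mul_iff_left₀ (two_zpow_pos _), Int.cast_le,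
    Int.cast_lt]
  constructor
  · rintro ⟨h1, h2, h3, h4⟩; exact ⟨h1, h2, by linarith, by linarith⟩
  · rintro ⟨h1, h2, h3, h4⟩; exact ⟨h1, h2, by linarith, by linarith⟩

lemma mem_pts_iff (T : Tile) (p : Pt) :
    p ∈ T.pts ↔ T.Mem p ∧ ∃ u v : ℤ, p.x = u * 2 ^ T.k₀ ∧ p.y = v * 2 ^ (-(T.k₀ + T.n)) := by
  classical
  simp only [pts, Finset.mem_image, idx, Finset.mem_product, Finset.mem_range]
  constructor
  · rintro ⟨⟨u, v, h⟩, ⟨h1, h2, h3⟩, rfl⟩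
    refine ⟨(T.mem_gpt_iff _ _ _).2 ⟨h1, h2, by positivity, by exact_mod_cast h3⟩, u, v, rfl, rfl⟩
  · rintro ⟨h1, u, v, hx, hy⟩
    have e : p = T.gpt u v (p.k - T.k₀) := by ext <;> simp [hx, hy]
    rw [e, mem_gpt_iff] at h1
    obtain ⟨h1, h2, h3, h4⟩ := h1
    refine ⟨(u, v, (p.k - T.k₀).toNat), ⟨h1, h2, by simp only; omega⟩, ?_⟩
    simp only [ipt, Int.toNat_of_nonneg h3]
    exact e.symm

/-- The indices of grid points close to the boundary. -/
def edge (T : Tile) (r : ℕ) (q : ℤ × ℤ × ℕ) : Prop :=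
  q.2.2 < r ∨ T.n ≤ q.2.2 + r ∨
  q.1 < T.a * 2 ^ T.n + 2 ^ (q.2.2 + r) ∨ (T.a + 1) * 2 ^ T.n - 2 ^ (q.2.2 + r) ≤ q.1 ∨
  q.2.1 < T.b * 2 ^ T.n + 2 ^ (T.n - q.2.2 + r) ∨
    (T.b + 1) * 2 ^ T.n - 2 ^ (T.n - q.2.2 + r) ≤ q.2.1

lemma sum_two_pow_le (n : ℕ) : ∑ h ∈ Finset.range n, 2 ^ h ≤ 2 ^ n := by
  rw [Nat.geomSum_eq le_rfl]; simp

lemma sum_two_pow_sub_le (n : ℕ) : ∑ h ∈ Finset.range n, 2 ^ (n - h) ≤ 2 * 2 ^ n := by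
  have := Finset.sum_range_reflect (fun h => 2 ^ (h + 1)) n
  calc ∑ h ∈ Finset.range n, 2 ^ (n - h) = ∑ h ∈ Finset.range n, 2 ^ (n - 1 - h + 1) := by
        refine Finset.sum_congr rfl fun h hh => ?_
        rw [Finset.mem_range] at hh
        congr 1; omega
    _ = ∑ h ∈ Finset.range n, 2 * 2 ^ h := by rw [this]; simp [pow_succ, mul_comm]
    _ ≤ _ := by rw [← Finset.mul_sum]; exact Nat.mul_le_mul_left _ (sum_two_pow_le n)

open Classical in
lemma card_edge_le (T : Tile) (r : ℕ) :
    (T.idx.filter (T.edge r)).card ≤ (2 * r + 6 * 2 ^ r) * 4 ^ T.n := by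
  set n := T.n
  have h4 : 4 ^ n = 2 ^ n * 2 ^ n := by rw [← mul_pow]; rfl
  have key : ∀ (I J : ℕ → Finset ℤ) (c : ℕ → ℕ), (∀ h, (I h).card * (J h).card ≤ c h * 2 ^ n) →
      (((Finset.range n).biUnion fun h => I h ×ˢ J h ×ˢ ({h} : Finset ℕ)).card
        ≤ (∑ h ∈ Finset.range n, c h) * 2 ^ n) := by
    intro I J c hc
    refine Finset.card_biUnion_le.trans ?_
    rw [Finset.sum_mul]
    refine Finset.sum_le_sum fun h _ => ?_
    simpa [Finset.card_product] using hc h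
  have k1 : (T.us ×ˢ T.vs ×ˢ Finset.range r).card = r * 4 ^ n := by
    simp only [Finset.card_product, card_us, card_vs, Finset.card_range, h4]
    change 2 ^ n * (2 ^ n * r) = _
    ring
  have k2 : (T.us ×ˢ T.vs ×ˢ Finset.Ico (n - r) n).card ≤ r * 4 ^ n := by
    simp only [Finset.card_product, card_us, card_vs, Nat.card_Ico, h4]
    have : n - (n - r) ≤ r := by omega
    change 2 ^ n * (2 ^ n * (n - (n - r))) ≤ _
    calc 2 ^ n * (2 ^ n * (n - (n - r))) ≤ 2 ^ n * (2 ^ n * r) := by gcongr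
      _ = _ := by ring
  have k3 := key (fun h => Finset.Ico (T.a * 2 ^ n) (T.a * 2 ^ n + 2 ^ (h + r))) (fun _ => T.vs)
    (fun h => 2 ^ r * 2 ^ h) (fun h => by
      rw [card_vs, Int.card_Ico]
      ring_nf
      rw [← pow_add, two_pow_toNat]
      exact le_of_eq (by ring))
  have k4 := key (fun h => Finset.Ico ((T.a + 1) * 2 ^ n - 2 ^ (h + r)) ((T.a + 1) * 2 ^ n)) (fun _ => T.vs)
    (fun h => 2 ^ r * 2 ^ h) (fun h => by
      rw [card_vs, Int.card_Ico]
      ring_nf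
      rw [← pow_add, two_pow_toNat]
      exact le_of_eq (by ring))
  have k5 := key (fun _ => T.us) (fun h => Finset.Ico (T.b * 2 ^ n) (T.b * 2 ^ n + 2 ^ (n - h + r)))
    (fun h => 2 ^ r * 2 ^ (n - h)) (fun h => by
      rw [card_us, Int.card_Ico]
      ring_nf
      rw [← pow_add, two_pow_toNat]
      exact le_of_eq (by ring))
  have k6 := key (fun _ => T.us) (fun h => Finset.Ico ((T.b + 1) * 2 ^ n - 2 ^ (n - h + r)) ((T.b + 1) * 2 ^ n))
    (fun h => 2 ^ r * 2 ^ (n - h)) (fun h => by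
      rw [card_us, Int.card_Ico]
      ring_nf
      rw [← pow_add, two_pow_toNat]
      exact le_of_eq (by ring))
  rw [← Finset.mul_sum] at k3 k4 k5 k6
  have s1 := Nat.mul_le_mul_left (2 ^ r) (sum_two_pow_le n)
  have s2 := Nat.mul_le_mul_left (2 ^ r) (sum_two_pow_sub_le n)
  have hsub : T.idx.filter (T.edge r) ⊆
      (T.us ×ˢ T.vs ×ˢ Finset.range r) ∪ ((T.us ×ˢ T.vs ×ˢ Finset.Ico (n - r) n) ∪
      (((Finset.range n).biUnion fun h => Finset.Ico (T.a * 2 ^ n) (T.a * 2 ^ n + 2 ^ (h + r)) ×ˢ T.vs ×ˢ ({h} : Finset ℕ)) ∪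
      (((Finset.range n).biUnion fun h => Finset.Ico ((T.a + 1) * 2 ^ n - 2 ^ (h + r)) ((T.a + 1) * 2 ^ n) ×ˢ T.vs ×ˢ ({h} : Finset ℕ)) ∪
      (((Finset.range n).biUnion fun h => T.us ×ˢ Finset.Ico (T.b * 2 ^ n) (T.b * 2 ^ n + 2 ^ (n - h + r)) ×ˢ ({h} : Finset ℕ)) ∪
      ((Finset.range n).biUnion fun h => T.us ×ˢ Finset.Ico ((T.b + 1) * 2 ^ n - 2 ^ (n - h + r)) ((T.b + 1) * 2 ^ n) ×ˢ ({h} : Finset ℕ)))))) := by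
    rintro ⟨u, v, h⟩ hq
    simp only [Finset.mem_filter, idx, Finset.mem_product, Finset.mem_range, edge] at hq
    obtain ⟨⟨hu, hv, hh⟩, he⟩ := hq
    have hu' := Finset.mem_Ico.1 hu
    have hv' := Finset.mem_Ico.1 hv
    simp only [Finset.mem_union, Finset.mem_product, Finset.mem_biUnion, Finset.mem_range,
      Finset.mem_Ico, Finset.mem_singleton]
    rcases he with he | he | he | he | he | he
    · exact Or.inl ⟨hu, hv, he⟩
    · exact Or.inr (Or.inl ⟨hu, hv, by omega, hh⟩)
    · exact Or.inr (Or.inr (Or.inl ⟨h, hh, ⟨hu'.1, he⟩, hv, rfl⟩))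
    · exact Or.inr (Or.inr (Or.inr (Or.inl ⟨h, hh, ⟨he, hu'.2⟩, hv, rfl⟩)))
    · exact Or.inr (Or.inr (Or.inr (Or.inr (Or.inl ⟨h, hh, hu, ⟨hv'.1, he⟩, rfl⟩))))
    · exact Or.inr (Or.inr (Or.inr (Or.inr (Or.inr ⟨h, hh, hu, ⟨he, hv'.2⟩, rfl⟩))))
  refine (Finset.card_le_card hsub).trans ?_
  have q3 := k3.trans (Nat.mul_le_mul_right (2 ^ n) s1)
  have q4 := k4.trans (Nat.mul_le_mul_right (2 ^ n) s1)
  have q5 := k5.trans (Nat.mul_le_mul_right (2 ^ n) s2)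
  have q6 := k6.trans (Nat.mul_le_mul_right (2 ^ n) s2)
  refine (Finset.card_union_le _ _).trans ?_
  rw [k1]
  refine (Nat.add_le_add_left ((Finset.card_union_le _ _).trans (add_le_add k2
    ((Finset.card_union_le _ _).trans (add_le_add q3 ((Finset.card_union_le _ _).trans
    (add_le_add q4 ((Finset.card_union_le _ _).trans (add_le_add q5 q6)))))))) _).trans (le_of_eq ?_)
  rw [h4]; ring

lemma mem_of_near (T : Tile) {r : ℕ} {q : ℤ × ℤ × ℕ} (hq : ¬ T.edge r q) {e : Pt}
    (h : Near r (T.ipt q) e) : T.Mem e := by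
  obtain ⟨u, v, l⟩ := q
  simp only [edge, not_or, not_lt, not_le] at hq
  obtain ⟨e1, e2, e3, e4, e5, e6⟩ := hq
  obtain ⟨h1, h2, h3⟩ := h
  simp only [ipt, gpt_x, gpt_y, gpt_k] at h1 h2 h3
  rw [abs_le] at h1 h2 h3
  have f1 : (2:ℝ) ^ (T.k₀ + (l:ℤ) + (r:ℤ)) = ((2 ^ (l + r) : ℤ) : ℝ) * 2 ^ T.k₀ := by
    rw [add_assoc, two_zpow_add, mul_comm]
    push_cast
    rw [← zpow_natCast]; push_cast; rfl
  have f2 : (2:ℝ) ^ (-(T.k₀ + (l:ℤ)) + (r:ℤ)) = ((2 ^ (T.n - l + r) : ℤ) : ℝ) * 2 ^ (-(T.k₀ + T.n)) := by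
    push_cast
    rw [← zpow_natCast, ← two_zpow_add]
    congr 1
    push_cast [show l ≤ T.n by omega]; ring
  rw [f1] at h2
  rw [f2] at h3
  have e3' : ((T.a * 2 ^ T.n : ℤ) : ℝ) + ((2 ^ (l + r) : ℤ) : ℝ) ≤ u := by exact_mod_cast e3
  have e4' : (u : ℝ) < ((((T.a + 1) * 2 ^ T.n : ℤ) : ℝ) - ((2 ^ (l + r) : ℤ) : ℝ)) := by exact_mod_cast e4
  have e5' : ((T.b * 2 ^ T.n : ℤ) : ℝ) + ((2 ^ (T.n - l + r) : ℤ) : ℝ) ≤ v := by exact_mod_cast e5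
  have e6' : (v : ℝ) < ((((T.b + 1) * 2 ^ T.n : ℤ) : ℝ) - ((2 ^ (T.n - l + r) : ℤ) : ℝ)) := by exact_mod_cast e6
  have g3 := mul_le_mul_of_nonneg_right e3' (two_zpow_pos T.k₀).le
  have g4 := mul_lt_mul_of_pos_right e4' (two_zpow_pos T.k₀)
  have g5 := mul_le_mul_of_nonneg_right e5' (two_zpow_pos (-(T.k₀ + T.n))).le
  have g6 := mul_lt_mul_of_pos_right e6' (two_zpow_pos (-(T.k₀ + T.n)))
  rw [add_mul] at g3 g5
  rw [sub_mul] at g4 g6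
  refine ⟨⟨by linarith, by linarith⟩, ⟨by linarith, by linarith⟩, ?_, ?_⟩
  · linarith [show (r:ℤ) ≤ l by exact_mod_cast e1]
  · linarith [show (l:ℤ) + r < T.n by exact_mod_cast e2]

lemma mem_cell_corner (T : Tile) {e : Cell} :
    T.Mem e.corner ↔ ∃ h : ℕ, h < T.n ∧ e.k = T.k₀ + h ∧
      T.a * 2 ^ (T.n - h) ≤ e.i ∧ e.i < (T.a + 1) * 2 ^ (T.n - h) ∧
      T.b * 2 ^ h ≤ e.j ∧ e.j < (T.b + 1) * 2 ^ h := by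
  have main : ∀ h : ℕ, h < T.n → e.k = T.k₀ + h → (T.Mem e.corner ↔
      T.a * 2 ^ (T.n - h) ≤ e.i ∧ e.i < (T.a + 1) * 2 ^ (T.n - h) ∧
      T.b * 2 ^ h ≤ e.j ∧ e.j < (T.b + 1) * 2 ^ h) := by
    intro h hh hk
    have f1 : ∀ a : ℤ, ((a * 2 ^ T.n : ℤ) : ℝ) * 2 ^ T.k₀ = ((a * 2 ^ (T.n - h) : ℤ) : ℝ) * 2 ^ e.k := by
      intro a
      rw [hk, two_zpow_add]
      have : (2:ℝ) ^ T.n = 2 ^ (T.n - h) * 2 ^ h := by rw [← pow_add]; congr 1; omega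
      push_cast
      rw [this, zpow_natCast]; ring
    have f2 : ∀ a : ℤ, ((a * 2 ^ T.n : ℤ) : ℝ) * 2 ^ (-(T.k₀ + T.n)) = ((a * 2 ^ h : ℤ) : ℝ) * 2 ^ (-e.k) := by
      intro a
      push_cast
      rw [mul_assoc, mul_assoc, ← zpow_natCast, ← zpow_natCast, ← two_zpow_add, ← two_zpow_add, hk]
      congr 2; ring
    simp only [Mem, f1, f2, Cell.corner_x, Cell.corner_y, Cell.corner_k,
      mul_le_mul_iff_left₀ (two_zpow_pos _), mul_lt_mul_iff_left₀ (two_zpow_pos _), Int.cast_le,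
      Int.cast_lt]
    constructor
    · rintro ⟨⟨h1, h2⟩, ⟨h3, h4⟩, -⟩; exact ⟨h1, h2, h3, h4⟩
    · rintro ⟨h1, h2, h3, h4⟩
      exact ⟨⟨h1, h2⟩, ⟨h3, h4⟩, by omega, by omega⟩
  constructor
  · intro h
    have h3 := h.2.2
    simp only [Cell.corner_k] at h3
    refine ⟨(e.k - T.k₀).toNat, by omega, by omega, ?_⟩
    exact (main _ (by omega) (by omega)).1 h
  · rintro ⟨h, hh, hk, hr⟩
    exact (main h hh hk).2 hr

lemma gpt_cell (T : Tile) (u v : ℤ) {h : ℕ} (hh : h ≤ T.n) :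
    (T.gpt u v h).cell = ⟨u / 2 ^ h, v / 2 ^ (T.n - h), T.k₀ + h⟩ := by
  have key : ∀ (w : ℤ) (m : ℕ) (z : ℝ), z = (w:ℝ) / (2 ^ m : ℕ) → ⌊z⌋ = w / 2 ^ m := by
    rintro w m z rfl
    rw [Int.floor_div_natCast, Int.floor_intCast]; push_cast; rfl
  ext
  · refine key _ _ _ ?_
    simp only [gpt_x, gpt_k]
    rw [mul_assoc, ← two_zpow_add, show T.k₀ + -(T.k₀ + (h:ℤ)) = -h by ring, zpow_neg, zpow_natCast]
    push_cast; rfl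
  · refine key _ _ _ ?_
    simp only [gpt_y, gpt_k]
    rw [mul_assoc, ← two_zpow_add, show -(T.k₀ + (T.n:ℤ)) + (T.k₀ + (h:ℤ)) = -((T.n - h : ℕ) : ℤ) by push_cast [hh]; ring, zpow_neg, zpow_natCast]
    push_cast; rfl
  · rfl

open Classical in
/-- Each cell of a tile contains the same number of points of the grid. -/
lemma card_pts_cell (T : Tile) {e : Cell} (he : T.Mem e.corner) :
    (T.pts.filter (fun w => w.cell = e)).card = 2 ^ T.n := by
  obtain ⟨h, hh, hk, h1, h2, h3, h4⟩ := T.mem_cell_corner.1 he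
  have hp1 : (0:ℤ) < 2 ^ h := by positivity
  have hp2 : (0:ℤ) < 2 ^ (T.n - h) := by positivity
  have hn : (2:ℤ) ^ T.n = 2 ^ (T.n - h) * 2 ^ h := by rw [← pow_add]; congr 1; omega
  have eq : T.pts.filter (fun w => w.cell = e) =
      ((Finset.Ico (e.i * 2 ^ h) ((e.i + 1) * 2 ^ h)) ×ˢ
        (Finset.Ico (e.j * 2 ^ (T.n - h)) ((e.j + 1) * 2 ^ (T.n - h)))).image
        (fun q => T.gpt q.1 q.2 h) := by
    have hdiv : ∀ (w : ℤ) (m : ℕ) (z : ℤ), w / 2 ^ m = z ↔ z * 2 ^ m ≤ w ∧ w < (z + 1) * 2 ^ m := by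
      intro w m z
      rw [Int.ediv_eq_iff_of_pos (by positivity)]
      constructor
      · rintro ⟨a1, a2⟩; constructor <;> linarith
      · rintro ⟨a1, a2⟩; constructor <;> linarith
    ext w
    simp only [Finset.mem_filter, Finset.mem_image, Finset.mem_product, Finset.mem_Ico, Prod.exists]
    constructor
    · rintro ⟨hw, rfl⟩
      obtain ⟨⟨u, v, l⟩, hq, rfl⟩ := Finset.mem_image.1 hw
      simp only [idx, Finset.mem_product, Finset.mem_range] at hq
      have hl : l = h := by
        simp only [ipt, Pt.cell_k, gpt_k] at hk
        omega
      subst hl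
      simp only [ipt, T.gpt_cell u v hh.le]
      exact ⟨u, v, ⟨(hdiv _ _ _).1 rfl, (hdiv _ _ _).1 rfl⟩, rfl⟩
    · rintro ⟨u, v, ⟨hu, hv⟩, rfl⟩
      have hu' := (hdiv _ _ _).2 hu
      have hv' := (hdiv _ _ _).2 hv
      refine ⟨?_, ?_⟩
      · refine (T.mem_pts_iff _).2 ⟨(T.mem_gpt_iff _ _ _).2 ⟨?_, ?_, by omega, by omega⟩, u, v, rfl, rfl⟩
        · rw [us, Finset.mem_Ico, hn]
          constructor
          · nlinarith [hu.1]
          · have : (e.i + 1) * 2 ^ h ≤ (T.a + 1) * 2 ^ (T.n - h) * 2 ^ h := by gcongr; omega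
            linarith [hu.2]
        · rw [vs, Finset.mem_Ico, hn]
          constructor
          · nlinarith [hv.1]
          · have : (e.j + 1) * 2 ^ (T.n - h) ≤ (T.b + 1) * 2 ^ h * 2 ^ (T.n - h) := by gcongr; omega
            linarith [hv.2]
      · rw [T.gpt_cell u v hh.le, hu', hv', ← hk]
  have hz : ∀ z m : ℤ, ((z + 1) * m - z * m).toNat = m.toNat := by intro z m; congr 1; ring
  rw [eq, Finset.card_image_of_injective, Finset.card_product, Int.card_Ico, Int.card_Ico, hz, hz]
  · rw [two_pow_toNat, two_pow_toNat, ← pow_add]; congr 1; omega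
  · rintro ⟨u, v⟩ ⟨u', v'⟩ e
    have := T.gpt_inj e
    exact Prod.ext this.1 this.2.1

lemma mem_corner_of_mem (T : Tile) {p : Pt} (hp : p ∈ T.pts) : T.Mem p.cell.corner := by
  classical
  obtain ⟨⟨u, v, h⟩, hq, rfl⟩ := Finset.mem_image.1 hp
  simp only [idx, Finset.mem_product, Finset.mem_range, us, vs, Finset.mem_Ico] at hq
  obtain ⟨⟨h1, h2⟩, ⟨h3, h4⟩, hh⟩ := hq
  have hn : (2:ℤ) ^ T.n = 2 ^ (T.n - h) * 2 ^ h := by rw [← pow_add]; congr 1; omega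
  have hp1 : (0:ℤ) < 2 ^ h := by positivity
  have hp2 : (0:ℤ) < 2 ^ (T.n - h) := by positivity
  rw [mem_cell_corner]
  simp only [ipt, T.gpt_cell u v hh.le]
  refine ⟨h, hh, rfl, ?_, ?_, ?_, ?_⟩
  · rw [Int.le_ediv_iff_mul_le hp1]; rw [hn] at h1; linarith
  · rw [Int.ediv_lt_iff_lt_mul hp1]; rw [hn] at h2; linarith
  · rw [Int.le_ediv_iff_mul_le hp2]; rw [hn] at h3; linarith
  · rw [Int.ediv_lt_iff_lt_mul hp2]; rw [hn] at h4; linarith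

end Tile

section
open Filter Topology
/-! ### Averages and invariant means -/

namespace Tile

open Classical in
lemma card_pts_filter_le (T : Tile) (r : ℕ) (P : Pt → Prop)
    (h : ∀ q ∈ T.idx, P (T.ipt q) → T.edge r q) :
    ((T.pts.filter P).card : ℝ) ≤ (2 * r + 6 * 2 ^ r) * 4 ^ T.n := by
  have h1 : T.pts.filter P ⊆ (T.idx.filter (T.edge r)).image T.ipt := by
    intro w hw
    obtain ⟨hw, hP⟩ := Finset.mem_filter.1 hw
    obtain ⟨q, hq, rfl⟩ := Finset.mem_image.1 hw
    exact Finset.mem_image_of_mem _ (Finset.mem_filter.2 ⟨hq, h q hq hP⟩)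
  exact_mod_cast ((Finset.card_le_card h1).trans Finset.card_image_le).trans (T.card_edge_le r)

/-- The average of a function over the grid of a tile. -/
def avg (T : Tile) (f : Pt → ℝ) : ℝ := (∑ w ∈ T.pts, f w) / (4 ^ T.n * T.n)

lemma up_mem (T : Tile) {q : ℤ × ℤ × ℕ} (hq : ¬ T.edge 1 q) : (T.ipt q).up 1 ∈ T.pts := by
  refine (T.mem_pts_iff _).2 ⟨T.mem_of_near hq ?_, q.1, q.2.1, rfl, rfl⟩
  refine ⟨by simp, ?_, ?_⟩ <;> simp <;> positivity

lemma ys_mem (T : Tile) {m i : ℕ} (hi : i ≤ 2 ^ m) {q : ℤ × ℤ × ℕ} (hq : ¬ T.edge m q) :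
    (T.ipt q).ys (i / 2 ^ m) ∈ T.pts := by
  have hm : ¬ T.n ≤ q.2.2 + m := fun h => hq (Or.inr (Or.inl h))
  have hi' : (i:ℝ) / 2 ^ m ≤ 1 := by
    rw [div_le_one (by positivity)]; exact_mod_cast hi
  refine (T.mem_pts_iff _).2 ⟨T.mem_of_near hq ?_, q.1,
    q.2.1 + i * 2 ^ (T.n - q.2.2 - m), rfl, ?_⟩
  · refine ⟨by simp, by simp; positivity, ?_⟩
    have : (T.ipt q).y - ((T.ipt q).ys (i / 2 ^ m)).y = - ((i:ℝ) / 2 ^ m * 2 ^ (-(T.ipt q).k)) := by simp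
    rw [this, abs_neg, abs_of_nonneg (by positivity)]
    have h2 : (2:ℝ) ^ (-(T.ipt q).k) ≤ 2 ^ (-(T.ipt q).k + (m:ℤ)) := two_zpow_le (by linarith [m.cast_nonneg (α := ℤ)])
    have h3 := two_zpow_pos (-(T.ipt q).k)
    nlinarith
  · simp only [Pt.ys_y, ipt, gpt_y, gpt_k]
    have e : (2:ℝ) ^ (-(T.k₀ + (q.2.2:ℤ))) = 2 ^ m * (2 ^ (T.n - q.2.2 - m) * 2 ^ (-(T.k₀ + T.n))) := by
      rw [← zpow_natCast, ← zpow_natCast, ← two_zpow_add, ← two_zpow_add]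
      congr 1
      push_cast [show m ≤ T.n - q.2.2 by omega, show q.2.2 ≤ T.n by omega]; ring
    rw [e]
    push_cast
    field_simp

end Tile

/-- Boundedness of a function. -/
def Bdd (f : Pt → ℝ) : Prop := ∃ B, ∀ w, |f w| ≤ B

lemma Bdd.add {f g : Pt → ℝ} (hf : Bdd f) (hg : Bdd g) : Bdd (fun w => f w + g w) := by
  obtain ⟨B, hB⟩ := hf
  obtain ⟨C, hC⟩ := hg
  exact ⟨B + C, fun w => (abs_add_le _ _).trans (add_le_add (hB w) (hC w))⟩

lemma Bdd.sub {f g : Pt → ℝ} (hf : Bdd f) (hg : Bdd g) : Bdd (fun w => f w - g w) := by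
  obtain ⟨B, hB⟩ := hf
  obtain ⟨C, hC⟩ := hg
  exact ⟨B + C, fun w => (abs_sub _ _).trans (add_le_add (hB w) (hC w))⟩

lemma Bdd.mul {f g : Pt → ℝ} (hf : Bdd f) (hg : Bdd g) : Bdd (fun w => f w * g w) := by
  obtain ⟨B, hB⟩ := hf
  obtain ⟨C, hC⟩ := hg
  refine ⟨B * C, fun w => ?_⟩
  rw [abs_mul]
  exact mul_le_mul (hB w) (hC w) (abs_nonneg _) ((abs_nonneg _).trans (hB w))

lemma bdd_const (c : ℝ) : Bdd (fun _ => c) := ⟨|c|, fun _ => le_rfl⟩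

lemma Bdd.const_mul (c : ℝ) {f : Pt → ℝ} (hf : Bdd f) : Bdd (fun w => c * f w) := (bdd_const c).mul hf

lemma Bdd.pow {f : Pt → ℝ} (hf : Bdd f) : Bdd (fun w => f w ^ 2) := by
  simpa only [sq] using hf.mul hf

lemma Bdd.abs {f : Pt → ℝ} (hf : Bdd f) : Bdd (fun w => |f w|) := by
  obtain ⟨B, hB⟩ := hf
  exact ⟨B, fun w => by rw [abs_abs]; exact hB w⟩

lemma Bdd.comp {f : Pt → ℝ} (hf : Bdd f) (g : Pt → Pt) : Bdd (fun w => f (g w)) := by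
  obtain ⟨B, hB⟩ := hf
  exact ⟨B, fun w => hB _⟩

lemma Bdd.sum {ι : Type*} (s : Finset ι) {f : ι → Pt → ℝ} (hf : ∀ i ∈ s, Bdd (f i)) :
    Bdd (fun w => ∑ i ∈ s, f i w) := by
  classical
  induction s using Finset.induction_on with
  | empty => simpa using bdd_const 0
  | insert i s hi ih =>
    simp only [Finset.sum_insert hi]
    exact (hf i (by simp)).add (ih fun j hj => hf j (by simp [hj]))

/-- Invariant means on bounded functions. -/
structure IsMean (M : (Pt → ℝ) → ℝ) : Prop where
  add : ∀ f g, Bdd f → Bdd g → M (fun w => f w + g w) = M f + M g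
  smul : ∀ c f, Bdd f → M (fun w => c * f w) = c * M f
  mono : ∀ f g, Bdd f → Bdd g → (∀ w, f w ≤ g w) → M f ≤ M g
  const : ∀ c, M (fun _ => c) = c
  up : ∀ f, Bdd f → M (fun w => f (w.up 1)) = M f
  ys : ∀ f, Bdd f → ∀ m i : ℕ, i ≤ 2 ^ m → M (fun w => f (w.ys (i / 2 ^ m))) = M f

namespace Tile

lemma avg_add (T : Tile) (f g : Pt → ℝ) : T.avg (fun w => f w + g w) = T.avg f + T.avg g := by
  rw [avg, Finset.sum_add_distrib, add_div]; rfl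

lemma avg_smul (T : Tile) (c : ℝ) (f : Pt → ℝ) : T.avg (fun w => c * f w) = c * T.avg f := by
  rw [avg, ← Finset.mul_sum, mul_div_assoc]; rfl

lemma avg_mono (T : Tile) {f g : Pt → ℝ} (h : ∀ w, f w ≤ g w) : T.avg f ≤ T.avg g := by
  unfold avg
  gcongr with w
  exact h w

lemma avg_const (T : Tile) (hT : T.n ≠ 0) (c : ℝ) : T.avg (fun _ => c) = c := by
  rw [avg, Finset.sum_const, card_pts, nsmul_eq_mul]
  have : (T.n : ℝ) ≠ 0 := by exact_mod_cast hT
  push_cast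
  field_simp

lemma abs_avg_le (T : Tile) {f : Pt → ℝ} {B : ℝ} (h : ∀ w, |f w| ≤ B) : |T.avg f| ≤ B := by
  have hB : 0 ≤ B := (abs_nonneg _).trans (h ⟨0, 0, 0⟩)
  by_cases hT : T.n = 0
  · simp [avg, hT, hB]
  · rw [abs_le]
    constructor
    · rw [← T.avg_const hT (-B)]; exact T.avg_mono fun w => (abs_le.1 (h w)).1
    · conv_rhs => rw [← T.avg_const hT B]
      exact T.avg_mono fun w => (abs_le.1 (h w)).2

open Classical in
lemma avg_comp (T : Tile) {f : Pt → ℝ} {B : ℝ} (h : ∀ w, |f w| ≤ B) (g : Pt → Pt)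
    (hg : Function.Injective g) (r : ℕ) (hr : ∀ q ∈ T.idx, ¬ T.edge r q → g (T.ipt q) ∈ T.pts) :
    |T.avg (fun w => f (g w)) - T.avg f| ≤ 2 * B * (2 * r + 6 * 2 ^ r) / T.n := by
  have hB : 0 ≤ B := (abs_nonneg _).trans (h ⟨0, 0, 0⟩)
  have hcard : (T.pts.image g).card = T.pts.card := Finset.card_image_of_injective _ hg
  have e1 : ∑ w ∈ T.pts, f (g w) = ∑ w ∈ T.pts.image g, f w := by
    rw [Finset.sum_image fun x _ y _ e => hg e]
  have c1 : ((T.pts.image g \ T.pts).card : ℝ) ≤ (2 * r + 6 * 2 ^ r) * 4 ^ T.n := by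
    refine le_trans ?_ (T.card_pts_filter_le r (fun w => g w ∉ T.pts) fun q hq hP => by
      by_contra hc; exact hP (hr q hq hc))
    have : T.pts.image g \ T.pts ⊆ (T.pts.filter fun w => g w ∉ T.pts).image g := by
      intro w hw
      obtain ⟨h1, h2⟩ := Finset.mem_sdiff.1 hw
      obtain ⟨v, hv, rfl⟩ := Finset.mem_image.1 h1
      exact Finset.mem_image_of_mem _ (Finset.mem_filter.2 ⟨hv, h2⟩)
    have := (Finset.card_le_card this).trans Finset.card_image_le
    rw [Nat.cast_le]
    refine this.trans (le_of_eq ?_)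
    congr!
  have c2 : (T.pts \ T.pts.image g).card = (T.pts.image g \ T.pts).card := by
    exact (Finset.card_sdiff_comm hcard).symm
  have bnd : ∀ S : Finset Pt, |∑ w ∈ S, f w| ≤ S.card * B := by
    intro S
    refine (Finset.abs_sum_le_sum_abs _ _).trans ?_
    rw [← nsmul_eq_mul]
    exact Finset.sum_le_card_nsmul _ _ _ fun w _ => h w
  have e2 := Finset.sum_sdiff_sub_sum_sdiff (s₁ := T.pts) (s₂ := T.pts.image g) (f := f)
  rw [avg, avg, ← sub_div, e1, abs_div, ← e2, abs_of_nonneg (by positivity : (0:ℝ) ≤ 4 ^ T.n * T.n)]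
  have b1 := bnd (T.pts.image g \ T.pts)
  have b2 := bnd (T.pts \ T.pts.image g)
  rw [c2] at b2
  have b3 := mul_le_mul_of_nonneg_right c1 hB
  have b4 := abs_sub (∑ w ∈ T.pts.image g \ T.pts, f w) (∑ w ∈ T.pts \ T.pts.image g, f w)
  rcases Nat.eq_zero_or_pos T.n with hn | hn
  · simp [hn]
  · have hn' : (0:ℝ) < T.n := by exact_mod_cast hn
    rw [div_le_div_iff₀ (by positivity) hn']
    have : |∑ w ∈ T.pts.image g \ T.pts, f w - ∑ w ∈ T.pts \ T.pts.image g, f w| ≤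
      2 * B * (2 * r + 6 * 2 ^ r) * 4 ^ T.n := by
        rw [abs_sub_comm] at b4 ⊢; linarith
    calc _ ≤ 2 * B * (2 * r + 6 * 2 ^ r) * 4 ^ T.n * T.n := by gcongr
      _ = _ := by ring

end Tile

/-- The limit of the averages over a sequence of tiles along an ultrafilter. -/
def mean (T : ℕ → Tile) (f : Pt → ℝ) : ℝ := limUnder (hyperfilter ℕ : Filter ℕ) fun j => (T j).avg f

lemma tendsto_mean (T : ℕ → Tile) {f : Pt → ℝ} (hf : Bdd f) :
    Tendsto (fun j => (T j).avg f) (hyperfilter ℕ : Filter ℕ) (𝓝 (mean T f)) := by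
  obtain ⟨B, hB⟩ := hf
  refine tendsto_nhds_limUnder ?_
  have hmem : ((hyperfilter ℕ).map fun j => (T j).avg f : Filter ℝ) ≤ 𝓟 (Set.Icc (-B) B) := by
    rw [le_principal_iff]
    exact Filter.mem_map.2 (Filter.univ_mem' fun j : ℕ => abs_le.1 ((T j).abs_avg_le hB))
  obtain ⟨x, -, hx⟩ := isCompact_Icc.ultrafilter_le_nhds ((hyperfilter ℕ).map fun j => (T j).avg f) hmem
  exact ⟨x, hx⟩

lemma eventually_hyper {p : ℕ → Prop} (h : ∀ᶠ j in atTop, p j) : ∀ᶠ j in (hyperfilter ℕ : Filter ℕ), p j :=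
  (Nat.hyperfilter_le_atTop h)

lemma tendsto_div_n {T : ℕ → Tile} (hT : Tendsto (fun j => (T j).n) atTop atTop) (c : ℝ) :
    Tendsto (fun j => c / (T j).n) (hyperfilter ℕ : Filter ℕ) (𝓝 0) := by
  refine Tendsto.mono_left ?_ Nat.hyperfilter_le_atTop
  exact Tendsto.div_atTop tendsto_const_nhds (tendsto_natCast_atTop_atTop.comp hT)

lemma le_mean {T : ℕ → Tile} {f : Pt → ℝ} (hf : Bdd f) {c : ℝ} (h : ∀ᶠ j in atTop, c ≤ (T j).avg f) :
    c ≤ mean T f :=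
  ge_of_tendsto (tendsto_mean T hf) (eventually_hyper h)

lemma mean_le_mean {T : ℕ → Tile} (hT : Tendsto (fun j => (T j).n) atTop atTop) {f g : Pt → ℝ}
    (hf : Bdd f) (hg : Bdd g) {c d : ℝ}
    (h : ∀ᶠ j in atTop, (T j).avg f ≤ c * (T j).avg g + d / (T j).n) :
    mean T f ≤ c * mean T g := by
  have h1 := ((tendsto_mean T hg).const_mul c).add (tendsto_div_n hT d)
  rw [add_zero] at h1
  exact le_of_tendsto_of_tendsto (tendsto_mean T hf) h1 (eventually_hyper h)

lemma mean_comp {T : ℕ → Tile} (hT : Tendsto (fun j => (T j).n) atTop atTop) {f : Pt → ℝ}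
    (hf : Bdd f) (g : Pt → Pt) (hg : Function.Injective g) (r : ℕ)
    (hr : ∀ T : Tile, ∀ q ∈ T.idx, ¬ T.edge r q → g (T.ipt q) ∈ T.pts) :
    mean T (fun w => f (g w)) = mean T f := by
  obtain ⟨B, hB⟩ := id hf
  have h1 := (tendsto_mean T (hf.comp g)).sub (tendsto_mean T hf)
  have h2 := squeeze_zero_norm (fun j => le_of_eq_of_le (Real.norm_eq_abs _) ((T j).avg_comp hB g hg r (hr (T j)))) (tendsto_div_n hT _)
  linarith [tendsto_nhds_unique h1 h2]

lemma Pt.up_injective (h : ℤ) : Function.Injective (Pt.up h) := by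
  rintro ⟨x, y, k⟩ ⟨x', y', k'⟩ e
  simpa [Pt.up] using e

lemma Pt.ys_injective (c : ℝ) : Function.Injective (Pt.ys c) := by
  rintro ⟨x, y, k⟩ ⟨x', y', k'⟩ e
  simp only [Pt.ys, Pt.mk.injEq] at e
  obtain ⟨rfl, h2, rfl⟩ := e
  simpa using h2

lemma mean_isMean {T : ℕ → Tile} (hT : Tendsto (fun j => (T j).n) atTop atTop) : IsMean (mean T) where
  add f g hf hg := by
    refine tendsto_nhds_unique (tendsto_mean T (hf.add hg)) ?_
    simp only [Tile.avg_add]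
    exact (tendsto_mean T hf).add (tendsto_mean T hg)
  smul c f hf := by
    refine tendsto_nhds_unique (tendsto_mean T (hf.const_mul c)) ?_
    simp only [Tile.avg_smul]
    exact (tendsto_mean T hf).const_mul c
  mono f g hf hg h :=
    le_of_tendsto_of_tendsto (tendsto_mean T hf) (tendsto_mean T hg) (Filter.Eventually.of_forall fun j => (T j).avg_mono h)
  const c := by
    refine tendsto_nhds_unique (tendsto_mean T (bdd_const c)) ?_
    refine Tendsto.congr' ?_ tendsto_const_nhds
    refine eventually_hyper ((hT.eventually_ge_atTop 1).mono fun j hj => ?_)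
    exact ((T j).avg_const (by omega) c).symm
  up f hf := mean_comp hT hf _ (Pt.up_injective 1) 1 fun T q _ hq => T.up_mem hq
  ys f hf m i hi := mean_comp hT hf _ (Pt.ys_injective _) m fun T q _ hq => T.ys_mem hi hq

namespace IsMean
variable {M : (Pt → ℝ) → ℝ} (hM : IsMean M)
include hM

lemma up_int {f : Pt → ℝ} (hf : Bdd f) (h : ℤ) : M (fun w => f (w.up h)) = M f := by
  have hnat : ∀ (n : ℕ) (f : Pt → ℝ), Bdd f → M (fun w => f (w.up n)) = M f := by
    intro n
    induction n with
    | zero => intro f hf; simp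
    | succ n ih =>
      intro f hf
      have := hM.up (fun w => f (w.up n)) (hf.comp _)
      simp only [Pt.up_up] at this
      rw [ih f hf] at this
      rw [← this]
      congr 1; funext w; push_cast; rw [add_comm]
  obtain ⟨n, rfl | rfl⟩ := h.eq_nat_or_neg
  · exact hnat n f hf
  · rw [← hnat n _ (hf.comp (Pt.up (-n)))]
    simp [Pt.up_up]

lemma nonneg {f : Pt → ℝ} (hf : Bdd f) (h : ∀ w, 0 ≤ f w) : 0 ≤ M f := by
  rw [← hM.const 0]; exact hM.mono _ _ (bdd_const 0) hf h

lemma sum {ι : Type*} (s : Finset ι) {f : ι → Pt → ℝ} (hf : ∀ i ∈ s, Bdd (f i)) :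
    M (fun w => ∑ i ∈ s, f i w) = ∑ i ∈ s, M (f i) := by
  classical
  induction s using Finset.induction_on with
  | empty => simpa using hM.const 0
  | insert i s hi ih =>
    simp only [Finset.sum_insert hi]
    rw [hM.add _ _ (hf i (by simp)) (Bdd.sum s fun j hj => hf j (by simp [hj])),
      ih fun j hj => hf j (by simp [hj])]

lemma abs_le_of_sq {f : Pt → ℝ} (hf : Bdd f) {e : ℝ} (he : 0 < e) (h : M (fun w => f w ^ 2) ≤ e ^ 2) :
    M (fun w => |f w|) ≤ e := by
  have h1 := hM.mono (fun w => |f w|) (fun w => (1 / (2 * e)) * f w ^ 2 + e / 2) hf.abs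
    ((hf.pow.const_mul _).add (bdd_const _)) (fun w => by
      rw [← sq_abs]
      have : 0 ≤ (|f w| - e) ^ 2 / (2 * e) := by positivity
      have e2 : (1 / (2 * e)) * |f w| ^ 2 + e / 2 - |f w| = (|f w| - e) ^ 2 / (2 * e) := by
        field_simp; ring
      linarith)
  rw [hM.add _ _ (hf.pow.const_mul _) (bdd_const _), hM.smul _ _ hf.pow, hM.const] at h1
  have h2 : 1 / (2 * e) * M (fun w => f w ^ 2) ≤ 1 / (2 * e) * e ^ 2 := by gcongr
  have h3 : 1 / (2 * e) * e ^ 2 = e / 2 := by field_simp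
  linarith

end IsMean

end

/-! ### Slopes of vertical lines -/

/-- The slope of the image of a vertical segment. -/
def slp (φ : Cell → Cell) (t : ℕ) (w : Pt) : ℝ := ((ht φ (w.up t) : ℝ) - ht φ w) / t

section
variable {A : ℕ} {φ ψ : Cell → Cell} (H : CQI A φ ψ)
include H

lemma CQI.ht_up_real (a : Pt) (n : ℕ) : |(ht φ (a.up n) : ℝ) - ht φ a| ≤ n * A := by
  exact_mod_cast H.ht_up a n

lemma CQI.ht_jump {a b : Pt} (hk : a.k = b.k) (hx : |a.x - b.x| ≤ 2 ^ a.k)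
    (hy : |a.y - b.y| ≤ 2 ^ (-a.k)) : |(ht φ a : ℝ) - ht φ b| ≤ A := by
  exact_mod_cast (H.img_jump hk hx hy).1

lemma CQI.ht_ys (a : Pt) {c : ℝ} (h0 : 0 ≤ c) (h1 : c ≤ 1) : |(ht φ (a.ys c) : ℝ) - ht φ a| ≤ A := by
  refine H.ht_jump rfl (by simp; positivity) ?_
  have := two_zpow_pos (-a.k)
  simp only [Pt.ys_y, add_sub_cancel_left, Pt.ys_k]
  rw [abs_of_nonneg (by positivity)]
  nlinarith

lemma CQI.abs_slp_le (t : ℕ) (w : Pt) : |slp φ t w| ≤ A := by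
  rcases Nat.eq_zero_or_pos t with rfl | ht
  · simp [slp]
  · have ht' : (0:ℝ) < t := by exact_mod_cast ht
    rw [slp, abs_div, abs_of_pos ht', div_le_iff₀ ht', mul_comm]
    exact H.ht_up_real w t

lemma CQI.bdd_slp (t : ℕ) : Bdd (slp φ t) := ⟨A, H.abs_slp_le t⟩

end

lemma mul_slp (φ : Cell → Cell) {t : ℕ} (ht' : 0 < t) (w : Pt) :
    t * slp φ t w = (ht φ (w.up t) : ℝ) - ht φ w := by
  have : (t:ℝ) ≠ 0 := by positivity
  rw [slp]; field_simp

lemma slp_two_mul (φ : Cell → Cell) {t : ℕ} (ht' : 0 < t) (w : Pt) :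
    slp φ (t * 2) w = (slp φ t w + slp φ t (w.up t)) / 2 := by
  have : (t:ℝ) ≠ 0 := by positivity
  simp only [slp, Pt.up_up]
  push_cast
  rw [show (t:ℤ) * 2 = t + t by ring]
  field_simp
  ring

/-- The error in the linear approximation of the height along a vertical segment. -/
def lin (φ : Cell → Cell) (t : ℕ) (h : ℤ) (w : Pt) : ℝ :=
  (ht φ (w.up h) : ℝ) - ht φ w - h * slp φ t w

/-- The error in the linear approximation of the height along a path which goes down, jumps, and
goes up. -/
def err (φ : Cell → Cell) (t D h i : ℕ) (w : Pt) : ℝ :=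
  |(ht φ (((w.up ((h:ℤ) - D)).ys ((i:ℝ) / 2 ^ (2 * D))).up ((2 * D : ℕ) : ℤ)) : ℝ) - ht φ w
    - slp φ t w * (h + D)|

section
variable {A : ℕ} {φ ψ : Cell → Cell} (H : CQI A φ ψ) {M : (Pt → ℝ) → ℝ} (hM : IsMean M)
include H

lemma CQI.bdd_lin (t h : ℕ) : Bdd (lin φ t h) :=
  Bdd.sub ⟨h * A, fun w => H.ht_up_real w h⟩ ((H.bdd_slp t).const_mul h)

include hM

lemma CQI.mean_sq_sub {t : ℕ} (ht' : 0 < t) :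
    M (fun w => (slp φ t w - slp φ t (w.up t)) ^ 2) =
      4 * M (fun w => slp φ t w ^ 2) - 4 * M (fun w => slp φ (t * 2) w ^ 2) := by
  have b := (H.bdd_slp t).pow
  have b' := (H.bdd_slp (t * 2)).pow
  have e : (fun w => (slp φ t w - slp φ t (w.up t)) ^ 2) =
      fun w => (2 * slp φ t w ^ 2 + 2 * slp φ t (w.up t) ^ 2) + (-4) * slp φ (t * 2) w ^ 2 := by
    funext w
    rw [slp_two_mul φ ht']; ring
  rw [e, hM.add _ _ ((b.const_mul 2).add ((b.comp _).const_mul 2)) (b'.const_mul _),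
    hM.add _ _ (b.const_mul 2) ((b.comp _).const_mul 2), hM.smul _ _ b, hM.smul _ _ (b.comp _),
    hM.smul _ _ b', hM.up_int b]
  ring

lemma CQI.exists_scale_sq (j₀ : ℕ) {η : ℝ} (hη : 0 < η) : ∃ j, j₀ ≤ j ∧
    M (fun w => |slp φ (2 ^ j) (w.up (2 ^ j : ℕ)) - slp φ (2 ^ j) w|) ≤ η := by
  by_contra! hc
  have step : ∀ j, j₀ ≤ j → M (fun w => slp φ (2 ^ (j + 1)) w ^ 2) ≤
      M (fun w => slp φ (2 ^ j) w ^ 2) - η ^ 2 / 4 := by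
    intro j hj
    have b := H.bdd_slp (2 ^ j)
    by_contra! h1
    have h2 := H.mean_sq_sub hM (t := 2 ^ j) (by positivity)
    rw [← pow_succ] at h2
    have h3 := hM.abs_le_of_sq (b.sub (b.comp (Pt.up (2 ^ j : ℕ)))) hη (by rw [h2]; linarith)
    simp only [abs_sub_comm (slp φ (2 ^ j) _) (slp φ (2 ^ j) (Pt.up _ _))] at h3
    exact absurd h3 (not_le.2 (hc j hj))
  have iter : ∀ i : ℕ, M (fun w => slp φ (2 ^ (j₀ + i)) w ^ 2) ≤
      M (fun w => slp φ (2 ^ j₀) w ^ 2) - i * (η ^ 2 / 4) := by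
    intro i
    induction i with
    | zero => simp
    | succ i ih =>
      have := step (j₀ + i) (by omega)
      rw [add_assoc] at this
      push_cast
      linarith
  obtain ⟨i, hi⟩ := exists_nat_gt (M (fun w => slp φ (2 ^ j₀) w ^ 2) / (η ^ 2 / 4))
  rw [div_lt_iff₀ (by positivity)] at hi
  linarith [iter i, hM.nonneg (H.bdd_slp (2 ^ (j₀ + i))).pow fun w => sq_nonneg _]

lemma CQI.mean_slp_mul {t : ℕ} {η : ℝ} (h1 : M (fun w => |slp φ t (w.up t) - slp φ t w|) ≤ η) (i : ℕ) :
    M (fun w => |slp φ t (w.up (i * t : ℕ)) - slp φ t w|) ≤ i * η := by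
  have b := H.bdd_slp t
  induction i with
  | zero => simp [hM.const 0]
  | succ i ih =>
    have b1 : Bdd (fun w => |slp φ t (w.up t) - slp φ t w|) := ((b.comp _).sub b).abs
    have b2 : Bdd (fun w => |slp φ t (w.up (i * t : ℕ)) - slp φ t w|) := ((b.comp _).sub b).abs
    have h2 := hM.mono (fun w => |slp φ t (w.up ((i + 1) * t : ℕ)) - slp φ t w|)
      (fun w => |slp φ t ((w.up (i * t : ℕ)).up t) - slp φ t (w.up (i * t : ℕ))| +
        |slp φ t (w.up (i * t : ℕ)) - slp φ t w|) ((b.comp _).sub b).abs ((b1.comp _).add b2)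
      (fun w => by
        rw [Pt.up_up]
        have e : ((i * t : ℕ) : ℤ) + t = ((i + 1) * t : ℕ) := by push_cast; ring
        rw [e]
        exact abs_sub_le _ _ _)
    rw [hM.add _ _ (b1.comp _) b2, hM.up_int b1] at h2
    push_cast
    push_cast at h2 ih
    linarith

lemma CQI.mean_lin {t N : ℕ} (ht' : 0 < t) {η : ℝ}
    (h1 : M (fun w => |slp φ t (w.up t) - slp φ t w|) ≤ η) {h : ℕ} (hh : h ≤ N * t) :
    M (fun w => |lin φ t h w|) ≤ t * (N * (N * η)) + 2 * A * t := by
  have b := H.bdd_slp t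
  have hη : 0 ≤ η := (hM.nonneg ((b.comp (Pt.up t)).sub b).abs fun w => abs_nonneg _).trans h1
  set q := h / t
  set r := h % t
  have hqr : (h:ℝ) = q * t + r := by exact_mod_cast (Nat.div_add_mod' h t).symm
  have hq : q ≤ N := by
    rw [← Nat.mul_div_cancel N ht']; exact Nat.div_le_div_right hh
  have hr : (r:ℝ) ≤ t := by exact_mod_cast (Nat.mod_lt h ht').le
  have bi : ∀ i ∈ Finset.range q, Bdd (fun w => |slp φ t (w.up (i * t : ℕ)) - slp φ t w|) :=
    fun i _ => ((b.comp _).sub b).abs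
  have h2 := hM.mono (fun w => |lin φ t h w|)
    (fun w => t * ∑ i ∈ Finset.range q, |slp φ t (w.up (i * t : ℕ)) - slp φ t w| + 2 * A * t)
    (H.bdd_lin t h).abs (((Bdd.sum _ bi).const_mul _).add (bdd_const _)) (fun w => by
      have key : ∀ q : ℕ, |lin φ t (q * t : ℕ) w| ≤
          t * ∑ i ∈ Finset.range q, |slp φ t (w.up (i * t : ℕ)) - slp φ t w| := by
        intro q
        induction q with
        | zero => simp [lin]
        | succ q ih =>
          rw [Finset.sum_range_succ, mul_add]
          have e : lin φ t ((q + 1) * t : ℕ) w = lin φ t (q * t : ℕ) w +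
              t * (slp φ t (w.up (q * t : ℕ)) - slp φ t w) := by
            rw [mul_sub, mul_slp φ ht', Pt.up_up, lin, lin]
            push_cast
            rw [show ((q:ℤ) + 1) * t = q * t + t by ring]
            ring
          rw [e]
          refine (abs_add_le _ _).trans ?_
          rw [abs_mul, abs_of_nonneg (by positivity : (0:ℝ) ≤ t)]
          linarith
      have e : lin φ t h w = lin φ t (q * t : ℕ) w +
          (((ht φ ((w.up (q * t : ℕ)).up r) : ℝ) - ht φ (w.up (q * t : ℕ))) - r * slp φ t w) := by
        rw [Pt.up_up, lin, lin]
        have : ((q * t : ℕ) : ℤ) + r = h := by exact_mod_cast (Nat.div_add_mod' h t)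
        rw [this]
        push_cast
        rw [hqr]; ring
      rw [e]
      have a1 := H.ht_up_real (w.up (q * t : ℕ)) r
      have a2 : |(r:ℝ) * slp φ t w| ≤ r * A := by
        rw [abs_mul, abs_of_nonneg (by positivity : (0:ℝ) ≤ r)]
        exact mul_le_mul_of_nonneg_left (H.abs_slp_le t w) (by positivity)
      have a3 : (r:ℝ) * A ≤ t * A := by gcongr
      have := abs_add_le (lin φ t (q * t : ℕ) w) (((ht φ ((w.up (q * t : ℕ)).up r) : ℝ) - ht φ (w.up (q * t : ℕ))) - r * slp φ t w)
      have := abs_sub ((ht φ ((w.up (q * t : ℕ)).up r) : ℝ) - ht φ (w.up (q * t : ℕ))) (r * slp φ t w)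
      linarith [key q])
  rw [hM.add _ _ ((Bdd.sum _ bi).const_mul _) (bdd_const _), hM.const, hM.smul _ _ (Bdd.sum _ bi),
    hM.sum _ bi] at h2
  have h3 : ∑ i ∈ Finset.range q, M (fun w => |slp φ t (w.up (i * t : ℕ)) - slp φ t w|) ≤ N * (N * η) := by
    refine (Finset.sum_le_card_nsmul _ _ (N * η) fun i hi => ?_).trans ?_
    · refine (H.mean_slp_mul hM h1 i).trans ?_
      have : i ≤ N := by have := Finset.mem_range.1 hi; omega
      gcongr
    · rw [Finset.card_range, nsmul_eq_mul]
      gcongr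
  have h4 : (t:ℝ) * ∑ i ∈ Finset.range q, M (fun w => |slp φ t (w.up (i * t : ℕ)) - slp φ t w|) ≤
    t * (N * (N * η)) := by gcongr
  linarith

end

section
variable {A : ℕ} {φ ψ : Cell → Cell} (H : CQI A φ ψ) {M : (Pt → ℝ) → ℝ} (hM : IsMean M)
include H hM

lemma CQI.mean_slp_comp {t D : ℕ} (hD : 0 < D) {l B : ℝ} (hl : M (fun w => |lin φ t D w|) ≤ l * D)
    (g : Pt → Pt) (hg : ∀ f, Bdd f → M (fun w => f (g w)) = M f)
    (h0 : ∀ w, |(ht φ (g w) : ℝ) - ht φ w| ≤ B)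
    (h1 : ∀ w, |(ht φ ((g w).up D) : ℝ) - ht φ (w.up D)| ≤ B) :
    M (fun w => |slp φ t (g w) - slp φ t w|) ≤ 2 * l + 2 * B / D := by
  have b := H.bdd_slp t
  have bl := (H.bdd_lin t D).abs
  have hD' : (0:ℝ) < D := by exact_mod_cast hD
  have h2 := hM.mono (fun w => D * |slp φ t (g w) - slp φ t w|)
    (fun w => |lin φ t D (g w)| + |lin φ t D w| + 2 * B)
    (((b.comp g).sub b).abs.const_mul _) (((bl.comp g).add bl).add (bdd_const _)) (fun w => by
      have e : D * (slp φ t (g w) - slp φ t w) = ((ht φ ((g w).up D) : ℝ) - ht φ (w.up D)) -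
          ((ht φ (g w) : ℝ) - ht φ w) - lin φ t D (g w) + lin φ t D w := by
        simp only [lin, Int.cast_natCast]; ring
      have e' : D * |slp φ t (g w) - slp φ t w| = |D * (slp φ t (g w) - slp φ t w)| := by
        rw [abs_mul, abs_of_pos hD']
      rw [e', e]
      have := abs_add_le (((ht φ ((g w).up D) : ℝ) - ht φ (w.up D)) -
          ((ht φ (g w) : ℝ) - ht φ w) - lin φ t D (g w)) (lin φ t D w)
      have := abs_sub (((ht φ ((g w).up D) : ℝ) - ht φ (w.up D)) -
          ((ht φ (g w) : ℝ) - ht φ w)) (lin φ t D (g w))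
      have := abs_sub ((ht φ ((g w).up D) : ℝ) - ht φ (w.up D)) ((ht φ (g w) : ℝ) - ht φ w)
      linarith [h0 w, h1 w])
  rw [hM.smul _ _ ((b.comp g).sub b).abs, hM.add _ _ ((bl.comp g).add bl) (bdd_const _), hM.const,
    hM.add _ _ (bl.comp g) bl, hg _ bl] at h2
  have h3 : 2 * l + 2 * B / D = (2 * (l * D) + 2 * B) / D := by field_simp
  rw [h3, le_div_iff₀ hD', mul_comm]
  linarith

lemma CQI.mean_slp_up {t N : ℕ} (ht' : 0 < t) (hN : 0 < N) {l η : ℝ}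
    (hη : M (fun w => |slp φ t (w.up t) - slp φ t w|) ≤ η)
    (hl : M (fun w => |lin φ t (N * t : ℕ) w|) ≤ l * (N * t : ℕ)) {h : ℕ} (hh : h ≤ N * t) :
    M (fun w => |slp φ t (w.up h) - slp φ t w|) ≤ N * η + 2 * l + 2 * A / N := by
  have b := H.bdd_slp t
  set q := h / t
  set r := h % t
  have hqr : ((q * t : ℕ) : ℤ) + r = h := by exact_mod_cast (Nat.div_add_mod' h t)
  have hq : q ≤ N := by
    rw [← Nat.mul_div_cancel N ht']; exact Nat.div_le_div_right hh
  have hr : (r:ℝ) ≤ t := by exact_mod_cast (Nat.mod_lt h ht').le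
  have hη' : 0 ≤ η := (hM.nonneg ((b.comp (Pt.up t)).sub b).abs fun w => abs_nonneg _).trans hη
  have h1 := H.mean_slp_mul hM hη q
  have h2 := H.mean_slp_comp hM (B := r * A) (by positivity) hl (Pt.up r) (fun f hf => hM.up_int hf _)
    (fun w => H.ht_up_real w r) (fun w => by
      have := H.ht_up_real (w.up (N * t : ℕ)) r
      simp only [Pt.up_up] at this ⊢
      rwa [add_comm (r:ℤ)])
  have b1 : Bdd (fun w => |slp φ t (w.up r) - slp φ t w|) := ((b.comp _).sub b).abs
  have b2 : Bdd (fun w => |slp φ t (w.up (q * t : ℕ)) - slp φ t w|) := ((b.comp _).sub b).abs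
  have h3 := hM.mono (fun w => |slp φ t (w.up h) - slp φ t w|)
    (fun w => |slp φ t ((w.up (q * t : ℕ)).up r) - slp φ t (w.up (q * t : ℕ))| +
      |slp φ t (w.up (q * t : ℕ)) - slp φ t w|) ((b.comp _).sub b).abs ((b1.comp _).add b2)
    (fun w => by
      rw [Pt.up_up, hqr]
      exact abs_sub_le _ _ _)
  rw [hM.add _ _ (b1.comp _) b2, hM.up_int b1] at h3
  have h4 : q * η ≤ N * η := by gcongr
  have h5 : 2 * (r * A) / (N * t : ℕ) ≤ 2 * A / (N:ℝ) := by
    have : (0:ℝ) < N := by exact_mod_cast hN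
    have : (0:ℝ) < t := by exact_mod_cast ht'
    rw [div_le_div_iff₀ (by positivity) (by positivity)]
    push_cast
    have : 2 * (r * A) * (N:ℝ) ≤ 2 * (t * A) * N := by gcongr
    linarith
  linarith

lemma CQI.mean_slp_ys {t D : ℕ} (hD : 0 < D) {l s : ℝ} (hl : M (fun w => |lin φ t D w|) ≤ l * D)
    (hs : M (fun w => |slp φ t (w.up D) - slp φ t w|) ≤ s) {m i : ℕ} (hi : i ≤ 2 ^ m) :
    M (fun w => |slp φ t (w.ys ((i:ℝ) / 2 ^ m)) - slp φ t w|) ≤ 2 * s + 2 * l + 2 * A / D := by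
  have b := H.bdd_slp t
  set c : ℝ := (i:ℝ) / 2 ^ m
  have hc0 : 0 ≤ c := by positivity
  have hc1 : c ≤ 1 := by
    rw [div_le_one (by positivity)]; exact_mod_cast hi
  have hys : ∀ f, Bdd f → M (fun w => f (w.ys c)) = M f := fun f hf => hM.ys f hf m i hi
  set g : Pt → Pt := fun w => ((w.up D).ys c).up (-D)
  have hg : ∀ f, Bdd f → M (fun w => f (g w)) = M f := by
    intro f hf
    have e1 := hM.up_int (f := fun w => f ((w.ys c).up (-D))) (hf.comp _) D
    have e2 := hys (fun w => f (w.up (-D))) (hf.comp _)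
    have e3 := hM.up_int hf (-D)
    rw [← e3, ← e2, ← e1]
  have hgD : ∀ w, (g w).up D = (w.up D).ys c := fun w => by simp [g, Pt.up_up]
  have h1 := H.mean_slp_comp hM (B := A) hD hl g hg
    (fun w => by
      refine H.ht_jump (by simp [g]) (by simp [g]; positivity) ?_
      simp only [g, Pt.up_y, Pt.ys_y, Pt.up_k, Pt.ys_k, add_sub_cancel_left, add_neg_cancel_right]
      have h2 : (2:ℝ) ^ (-(w.k + D)) ≤ 2 ^ (-w.k) := two_zpow_le (by linarith [D.cast_nonneg (α := ℤ)])
      have h3 := two_zpow_pos (-(w.k + D))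
      rw [abs_of_nonneg (by positivity)]
      nlinarith)
    (fun w => by rw [hgD]; exact H.ht_ys _ hc0 hc1)
  have bD : Bdd (fun w => |slp φ t (w.up D) - slp φ t w|) := ((b.comp _).sub b).abs
  have bg : Bdd (fun w => |slp φ t (g w) - slp φ t w|) := ((b.comp _).sub b).abs
  have b1 : Bdd (fun w => |slp φ t (w.ys c) - slp φ t w|) := ((b.comp _).sub b).abs
  have h3 := hM.mono (fun w => |slp φ t ((w.up D).ys c) - slp φ t (w.up D)|)
    (fun w => |slp φ t ((g w).up D) - slp φ t (g w)| + |slp φ t (g w) - slp φ t w| +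
      |slp φ t (w.up D) - slp φ t w|) (b1.comp _) (((bD.comp g).add bg).add bD)
    (fun w => by
      rw [hgD]
      have := abs_sub_le (slp φ t ((w.up D).ys c)) (slp φ t (g w)) (slp φ t (w.up D))
      have := abs_sub_le (slp φ t (g w)) (slp φ t w) (slp φ t (w.up D))
      rw [abs_sub_comm (slp φ t w)] at this
      linarith)
  rw [hM.up_int b1, hM.add _ _ ((bD.comp g).add bg) bD, hM.add _ _ (bD.comp g) bg, hg _ bD] at h3
  linarith

lemma CQI.mean_err {t N : ℕ} (ht' : 0 < t) (hN : 0 < N) {η : ℝ}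
    (hη : M (fun w => |slp φ t (w.up t) - slp φ t w|) ≤ η) {h i : ℕ} (hh : h < N * t)
    (hi : i ≤ 2 ^ (2 * (N * t))) :
    M (err φ t (N * t) h i) ≤ (46 * (N * η) + 29 * A / N) * (N * t : ℕ) := by
  set D := N * t with hDdef
  have hD : 0 < D := by positivity
  have hN' : (0:ℝ) < N := by exact_mod_cast hN
  have ht1 : (1:ℝ) ≤ t := by exact_mod_cast ht'
  have hDr : (D:ℝ) = N * t := by rw [hDdef]; push_cast; rfl
  have hD' : (0:ℝ) < D := by exact_mod_cast hD
  set c : ℝ := (i:ℝ) / 2 ^ (2 * D)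
  have hc0 : 0 ≤ c := by positivity
  have hc1 : c ≤ 1 := by
    rw [div_le_one (by positivity)]; exact_mod_cast hi
  have hη' : 0 ≤ η :=
    (hM.nonneg (((H.bdd_slp t).comp (Pt.up t)).sub (H.bdd_slp t)).abs fun w => abs_nonneg _).trans hη
  set l : ℝ := 4 * (N * η) + 2 * A / N
  have hlin : ∀ h ≤ 2 * D, M (fun w => |lin φ t h w|) ≤ l * D := by
    intro h hh
    refine (H.mean_lin hM ht' (N := 2 * N) hη (by rw [mul_assoc]; exact hh)).trans (le_of_eq ?_)
    rw [hDr]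
    simp only [l]
    push_cast
    field_simp
    ring
  have hlD := hlin D (by omega)
  have hup : ∀ h ≤ D, M (fun w => |slp φ t (w.up h) - slp φ t w|) ≤ N * η + 2 * l + 2 * A / N :=
    fun h hh => H.mean_slp_up hM ht' hN hη hlD hh
  have hys := H.mean_slp_ys hM hD hlD (s := N * η) (by
    simpa only [← hDdef] using H.mean_slp_mul hM hη N) hi
  obtain ⟨p, hp⟩ : ∃ p, D = h + p := ⟨D - h, by omega⟩
  have b := H.bdd_slp t
  have bp : Bdd (fun w => |slp φ t (w.up p) - slp φ t w|) := ((b.comp _).sub b).abs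
  have by' : Bdd (fun w => |slp φ t (w.ys c) - slp φ t w|) := ((b.comp _).sub b).abs
  have bl := (H.bdd_lin t p).abs
  have bL : Bdd (fun w => |lin φ t (2 * D : ℕ) w|) := (H.bdd_lin t (2 * D)).abs
  have bsum := ((((bdd_const (A:ℝ)).add (bL.comp (Pt.ys c))).add bl).add (by'.const_mul (2 * D))).add
    (bp.const_mul (2 * D))
  have main : ∀ w, err φ t D h i (w.up p) ≤ A + |lin φ t (2 * D : ℕ) (w.ys c)| + |lin φ t p w| +
      2 * D * |slp φ t (w.ys c) - slp φ t w| + 2 * D * |slp φ t (w.up p) - slp φ t w| := by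
    intro w
    have e1 : (w.up p).up ((h:ℤ) - D) = w := by
      rw [Pt.up_up, hp]; push_cast
      rw [show (p:ℤ) + (h - (h + p)) = 0 by ring, Pt.up_zero]
    have e2 : (ht φ ((((w.up p).up ((h:ℤ) - D)).ys c).up ((2 * D : ℕ) : ℤ)) : ℝ) - ht φ (w.up p)
        - slp φ t (w.up p) * (h + D) = ((ht φ (w.ys c) : ℝ) - ht φ w) + lin φ t (2 * D : ℕ) (w.ys c)
        - lin φ t p w + 2 * D * (slp φ t (w.ys c) - slp φ t w) +
        (h + D) * (slp φ t w - slp φ t (w.up p)) := by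
      have : (D:ℝ) = h + p := by exact_mod_cast hp
      rw [e1]
      simp only [lin]
      push_cast
      rw [this]
      ring
    rw [err, e2]
    have a1 := H.ht_ys w hc0 hc1
    have a2 := abs_add_le (((ht φ (w.ys c) : ℝ) - ht φ w) + lin φ t (2 * D : ℕ) (w.ys c)
        - lin φ t p w + 2 * D * (slp φ t (w.ys c) - slp φ t w)) ((h + D) * (slp φ t w - slp φ t (w.up p)))
    have a3 := abs_add_le (((ht φ (w.ys c) : ℝ) - ht φ w) + lin φ t (2 * D : ℕ) (w.ys c)
        - lin φ t p w) (2 * D * (slp φ t (w.ys c) - slp φ t w))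
    have a4 := abs_sub (((ht φ (w.ys c) : ℝ) - ht φ w) + lin φ t (2 * D : ℕ) (w.ys c)) (lin φ t p w)
    have a5 := abs_add_le ((ht φ (w.ys c) : ℝ) - ht φ w) (lin φ t (2 * D : ℕ) (w.ys c))
    have a6 : |2 * (D:ℝ) * (slp φ t (w.ys c) - slp φ t w)| = 2 * D * |slp φ t (w.ys c) - slp φ t w| := by
      rw [abs_mul, abs_of_nonneg (by positivity)]
    have a7 : |((h:ℝ) + D) * (slp φ t w - slp φ t (w.up p))| ≤ 2 * D * |slp φ t (w.up p) - slp φ t w| := by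
      rw [abs_mul, abs_of_nonneg (by positivity), abs_sub_comm]
      have : (h:ℝ) ≤ D := by exact_mod_cast hh.le
      gcongr
      linarith
    linarith
  have berr : Bdd (fun w => err φ t D h i (w.up p)) := by
    obtain ⟨B, hB⟩ := bsum
    exact ⟨B, fun w => by
      rw [abs_of_nonneg (by exact abs_nonneg _)]
      exact (main w).trans ((le_abs_self _).trans (hB w))⟩
  have berr' : Bdd (err φ t D h i) := by
    convert berr.comp (Pt.up (-p)) using 1
    funext w
    simp [Pt.up_up]
  have h2 := hM.mono _ _ berr bsum main
  rw [hM.up_int berr', hM.add _ _ ((((bdd_const (A:ℝ)).add (bL.comp (Pt.ys c))).add bl).add (by'.const_mul (2 * D))) (bp.const_mul _),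
    hM.add _ _ (((bdd_const (A:ℝ)).add (bL.comp (Pt.ys c))).add bl) (by'.const_mul (2 * D)),
    hM.add _ _ ((bdd_const (A:ℝ)).add (bL.comp (Pt.ys c))) bl,
    hM.add _ _ (bdd_const (A:ℝ)) (bL.comp (Pt.ys c)), hM.const, hM.smul _ _ by', hM.smul _ _ bp,
    hM.ys _ bL _ _ hi] at h2
  have h3 := hlin (2 * D) le_rfl
  have h4 := hlin p (by omega)
  have h5 := mul_le_mul_of_nonneg_left hys (by positivity : (0:ℝ) ≤ 2 * D)
  have h6 := mul_le_mul_of_nonneg_left (hup p (by omega)) (by positivity : (0:ℝ) ≤ 2 * D)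
  have h7 : (A:ℝ) ≤ A / N * D := by
    rw [hDr]
    have : (A:ℝ) / N * (N * t) = A * t := by field_simp
    rw [this]
    nlinarith [A.cast_nonneg (α := ℝ)]
  have h8 : 2 * (D:ℝ) * (2 * (N * η) + 2 * l + 2 * A / D) = D * (4 * (N * η) + 4 * l) + 4 * A := by
    field_simp; ring
  have h9 : (46 * (N * η) + 29 * A / N) * (D:ℝ) = D * (46 * (N * η)) + 29 * (A / N * D) := by
    field_simp
  have h10 : l * D = D * (4 * (N * η)) + 2 * (A / N * D) := by
    simp only [l]; field_simp
  have h11 : 2 * (D:ℝ) * (N * η + 2 * l + 2 * A / N) = D * (2 * (N * η)) + 4 * (l * D) + 4 * (A / N * D) := by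
    field_simp
    ring
  rw [h9]
  rw [h8] at h5
  rw [h11] at h6
  nlinarith

/-- A scale at which the height is almost always almost linear along vertical lines. -/
lemma CQI.exists_scale {δ : ℝ} (hδ : 0 < δ) (L : ℕ) : ∃ j E : ℕ, L ≤ E ∧ 0 < E ∧
    ∀ h < 8 * E, ∀ i ≤ 2 ^ (2 * (8 * E)), M (err φ (2 ^ j) (8 * E) h i) ≤ δ * (8 * E : ℕ) := by
  obtain ⟨N', hN'⟩ := exists_nat_gt (58 * A / δ)
  set N := max (max N' L) 1
  have hN1 : 1 ≤ N := le_max_right _ _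
  have hN2 : L ≤ N := (le_max_right _ _).trans (le_max_left _ _)
  have hN3 : (N':ℝ) ≤ N := by exact_mod_cast (le_max_left _ _).trans (le_max_left _ _)
  have hNr : (0:ℝ) < N := by exact_mod_cast hN1
  obtain ⟨j, -, hj⟩ := H.exists_scale_sq hM 0 (η := δ / (92 * (8 * N))) (by positivity)
  have h2 : 1 ≤ 2 ^ j := Nat.one_le_two_pow
  refine ⟨j, N * 2 ^ j, hN2.trans (Nat.le_mul_of_pos_right _ (by positivity)), by positivity, fun h hh i hi => ?_⟩
  rw [← mul_assoc 8] at hh hi ⊢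
  refine (H.mean_err hM (by positivity) (by positivity) hj hh hi).trans ?_
  gcongr
  push_cast
  have e1 : 46 * (8 * (N:ℝ) * (δ / (92 * (8 * N)))) = δ / 2 := by field_simp; norm_num
  have e2 : 29 * (A:ℝ) / (8 * N) ≤ δ / 2 := by
    rw [div_lt_iff₀ hδ] at hN'
    rw [div_le_iff₀ (by positivity)]
    nlinarith
  linarith

end

/-- The total error at given height. -/
def errSum (φ : Cell → Cell) (t D h : ℕ) (w : Pt) : ℝ := ∑ i ∈ Finset.range (2 ^ (2 * D)), err φ t D h i w

/-- The points around which the height is almost always almost linear. -/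
def Good (φ : Cell → Cell) (t D : ℕ) (κ : ℝ) (w : Pt) : Prop :=
  ∑ h ∈ Finset.range D, errSum φ t D h w ≤ κ * D / 32 * (D * 2 ^ (2 * D))

lemma err_nonneg (φ : Cell → Cell) (t D h i : ℕ) (w : Pt) : 0 ≤ err φ t D h i w := abs_nonneg _

lemma errSum_nonneg (φ : Cell → Cell) (t D h : ℕ) (w : Pt) : 0 ≤ errSum φ t D h w :=
  Finset.sum_nonneg fun _ _ => err_nonneg _ _ _ _ _ _

lemma sum_range_shift_le {f : ℕ → ℝ} (hf : ∀ i, 0 ≤ f i) {n c N : ℕ} (h : n + c ≤ N) :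
    ∑ i ∈ Finset.range n, f (i + c) ≤ ∑ i ∈ Finset.range N, f i := by
  rw [Finset.range_eq_Ico, Finset.sum_Ico_add' f 0 n c]
  refine Finset.sum_le_sum_of_subset_of_nonneg (fun i hi => ?_) fun i _ _ => hf i
  simp only [Finset.mem_Ico, Finset.mem_range] at hi ⊢
  omega

section
variable {A : ℕ} {φ ψ : Cell → Cell} (H : CQI A φ ψ)
include H

lemma CQI.pair_top {t E : ℕ} (hE : 0 < E) {κ : ℝ} {p r : Pt} (hn : Near E p r) {h h' : ℕ}
    (hh : h < 5 * E) (hh' : (h' : ℤ) = h - (r.k - p.k))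
    (hs : errSum φ t (8 * E) h p + errSum φ t (8 * E) h' r ≤ 2 ^ (2 * (8 * E) - 1) * (κ * (8 * E : ℕ))) :
    |(ht φ r : ℝ) - ht φ p + slp φ t r * (h' + (8 * E : ℕ)) - slp φ t p * (h + (8 * E : ℕ))| ≤
      κ * (8 * E : ℕ) + A := by
  obtain ⟨h1, h2, h3⟩ := hn
  set D := 8 * E with hD
  set z : ℝ := (p.y - r.y) * 2 ^ (p.k + h + D)
  set e : ℤ := round z
  have hz : |z| ≤ 2 ^ (2 * D - 2) := by
    rw [abs_mul, abs_of_pos (two_zpow_pos _)]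
    calc |p.y - r.y| * (2:ℝ) ^ (p.k + h + D) ≤ 2 ^ (-p.k + E) * 2 ^ (p.k + h + D) := by gcongr
      _ = 2 ^ ((E + h + D : ℕ) : ℤ) := by rw [← two_zpow_add]; congr 1; push_cast; ring
      _ ≤ 2 ^ (2 * D - 2) := by rw [zpow_natCast]; exact pow_le_pow_right₀ one_le_two (by omega)
  have he : |e| ≤ 2 ^ (2 * D - 1) := by
    have a1 := abs_sub_round z
    have a2 : |(e:ℝ)| ≤ |z| + |z - e| := by
      have := abs_sub z (z - e); rwa [sub_sub_cancel] at this
    have a3 : (1:ℝ) ≤ 2 ^ (2 * D - 2) := one_le_pow₀ one_le_two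
    have a4 : (2:ℝ) ^ (2 * D - 1) = 2 * 2 ^ (2 * D - 2) := by
      rw [← pow_succ']; congr 1; omega
    have a5 : |(e:ℝ)| ≤ 2 ^ (2 * D - 1) := by linarith
    exact_mod_cast a5
  have e2 : 2 ^ (2 * D) = 2 * 2 ^ (2 * D - 1) := by rw [← pow_succ']; congr 1; omega
  have hpow : ((2 ^ (2 * D - 1) : ℕ) : ℤ) = 2 ^ (2 * D - 1) := by push_cast; rfl
  rw [abs_le] at he
  have s1 := sum_range_shift_le (f := fun i => err φ t D h i p) (fun i => err_nonneg _ _ _ _ _ _)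
    (n := 2 ^ (2 * D - 1)) (c := (-e).toNat) (N := 2 ^ (2 * D)) (by omega)
  have s2 := sum_range_shift_le (f := fun i => err φ t D h' i r) (fun i => err_nonneg _ _ _ _ _ _)
    (n := 2 ^ (2 * D - 1)) (c := e.toNat) (N := 2 ^ (2 * D)) (by omega)
  obtain ⟨i, hi, hle⟩ := Finset.exists_le_of_sum_le (s := Finset.range (2 ^ (2 * D - 1)))
    (f := fun i => err φ t D h (i + (-e).toNat) p + err φ t D h' (i + e.toNat) r)
    (g := fun _ => κ * (D : ℕ)) ⟨0, by simp⟩ (by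
      rw [Finset.sum_add_distrib, Finset.sum_const, Finset.card_range, nsmul_eq_mul]
      push_cast
      simp only [errSum] at hs
      linarith)
  set P := ((p.up ((h:ℤ) - D)).ys (((i + (-e).toNat : ℕ):ℝ) / 2 ^ (2 * D))).up ((2 * D : ℕ) : ℤ)
  set Q := ((r.up ((h':ℤ) - D)).ys (((i + e.toNat : ℕ):ℝ) / 2 ^ (2 * D))).up ((2 * D : ℕ) : ℤ)
  have hPk : P.k = p.k + h + D := by simp [P]; ring
  have hQk : Q.k = p.k + h + D := by simp [Q, hh']; ring
  have hj : |(ht φ P : ℝ) - ht φ Q| ≤ A := by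
    refine H.ht_jump (by rw [hPk, hQk]) ?_ ?_
    · rw [hPk]
      refine h2.trans (two_zpow_le ?_)
      push_cast [hD]
      linarith [h.cast_nonneg (α := ℤ), E.cast_nonneg (α := ℤ)]
    · rw [hPk]
      have g1 : ((i + (-e).toNat : ℕ):ℝ) - ((i + e.toNat : ℕ):ℝ) = -e := by
        have : ((i + (-e).toNat : ℕ):ℤ) - ((i + e.toNat : ℕ):ℤ) = -e := by omega
        exact_mod_cast this
      have g2 : (2:ℝ) ^ (-(p.k + h - D)) = 2 ^ (2 * D) * 2 ^ (-(p.k + h + D)) := by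
        rw [← zpow_natCast (2:ℝ), ← two_zpow_add]; congr 1; push_cast; ring
      have g3 : P.y - Q.y = (z - e) * 2 ^ (-(p.k + h + D)) := by
        have hk1 : (p.up ((h:ℤ) - D)).k = p.k + h - D := by simp; ring
        have hk2 : (r.up ((h':ℤ) - D)).k = p.k + h - D := by simp [hh']; ring
        simp only [P, Q, Pt.up_y, Pt.ys_y, hk1, hk2, g2]
        have g4 : z * 2 ^ (-(p.k + h + D)) = p.y - r.y := by
          simp only [z]; rw [mul_assoc, two_zpow_mul_neg, mul_one]
        rw [sub_mul, g4]
        have g5 : (-(e:ℝ)) * 2 ^ (-(p.k + h + D)) = (((i + (-e).toNat : ℕ):ℝ) - ((i + e.toNat : ℕ):ℝ)) * 2 ^ (-(p.k + h + D)) := by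
          rw [g1]
        have g6 : ∀ n q : ℝ, n / 2 ^ (2 * D) * (2 ^ (2 * D) * q) = n * q := fun n q => by field_simp
        rw [g6, g6]
        linarith
      rw [g3, abs_mul, abs_of_pos (two_zpow_pos _)]
      have := abs_sub_round z
      have := two_zpow_pos (-(p.k + h + D))
      nlinarith
  have k1 : err φ t D h (i + (-e).toNat) p = |(ht φ P : ℝ) - ht φ p - slp φ t p * (h + D)| := rfl
  have k2 : err φ t D h' (i + e.toNat) r = |(ht φ Q : ℝ) - ht φ r - slp φ t r * (h' + D)| := rfl
  rw [k1, k2] at hle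
  have t1 := abs_sub ((ht φ P : ℝ) - ht φ p - slp φ t p * (h + D)) ((ht φ Q : ℝ) - ht φ r - slp φ t r * (h' + D))
  have t2 := abs_sub ((ht φ P : ℝ) - ht φ p - slp φ t p * (h + D) - ((ht φ Q : ℝ) - ht φ r - slp φ t r * (h' + D)))
    ((ht φ P : ℝ) - ht φ Q)
  have t3 : (ht φ P : ℝ) - ht φ p - slp φ t p * (h + D) - ((ht φ Q : ℝ) - ht φ r - slp φ t r * (h' + D)) -
    ((ht φ P : ℝ) - ht φ Q) = (ht φ r : ℝ) - ht φ p + slp φ t r * (h' + D) - slp φ t p * (h + D) := by ring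
  rw [t3] at t2
  linarith

lemma CQI.pair_window {t E : ℕ} (hE : 0 < E) {κ : ℝ} {p r : Pt} (hp : Good φ t (8 * E) κ p)
    (hr : Good φ t (8 * E) κ r) (hn : Near E p r) {a : ℕ} (h1 : E ≤ a) (h2 : a ≤ 4 * E) :
    ∃ h : ℕ, a ≤ h ∧ h < a + E ∧ |(ht φ r : ℝ) - ht φ p + slp φ t r * (h - (r.k - p.k) + (8 * E : ℕ))
      - slp φ t p * (h + (8 * E : ℕ))| ≤ κ * (8 * E : ℕ) + A := by
  have hk := abs_le.1 hn.1
  set c := ((a:ℤ) - (r.k - p.k)).toNat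
  have hc : (c:ℤ) = a - (r.k - p.k) := Int.toNat_of_nonneg (by omega)
  have s1 := sum_range_shift_le (f := fun h => errSum φ t (8 * E) h p) (fun i => errSum_nonneg _ _ _ _ _)
    (n := E) (c := a) (N := 8 * E) (by omega)
  have s2 := sum_range_shift_le (f := fun h => errSum φ t (8 * E) h r) (fun i => errSum_nonneg _ _ _ _ _)
    (n := E) (c := c) (N := 8 * E) (by omega)
  obtain ⟨h, hh, hle⟩ := Finset.exists_le_of_sum_le (s := Finset.range E)
    (f := fun h => errSum φ t (8 * E) (h + a) p + errSum φ t (8 * E) (h + c) r)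
    (g := fun _ => 2 ^ (2 * (8 * E) - 1) * (κ * (8 * E : ℕ))) ⟨0, by simpa using hE⟩ (by
      rw [Finset.sum_add_distrib, Finset.sum_const, Finset.card_range, nsmul_eq_mul]
      unfold Good at hp hr
      have e2 : (2:ℝ) ^ (2 * (8 * E)) = 2 * 2 ^ (2 * (8 * E) - 1) := by rw [← pow_succ']; congr 1; omega
      rw [e2] at hp hr
      push_cast at *
      have : κ * (8 * E) / 32 * (8 * E * (2 * 2 ^ (2 * (8 * E) - 1))) * 2 = E * (2 ^ (2 * (8 * E) - 1) * (κ * (8 * (E:ℝ)))) := by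
        ring
      linarith)
  have hh1 := Finset.mem_range.1 hh
  refine ⟨h + a, by omega, by omega, ?_⟩
  have := H.pair_top hE hn (h := h + a) (h' := h + c) (by omega) (by push_cast; rw [hc]; ring) hle
  have hc' : (c:ℝ) = a - (r.k - p.k) := by exact_mod_cast hc
  push_cast at *
  rw [hc'] at this
  refine le_of_eq_of_le (congrArg _ ?_) this
  ring

/-- Close good points have close slopes and heights. -/
lemma CQI.pair {t E : ℕ} (hE : 0 < E) {κ : ℝ} (hA : A ≤ κ * (8 * E : ℕ)) {p r : Pt}
    (hp : Good φ t (8 * E) κ p) (hr : Good φ t (8 * E) κ r) (hn : Near E p r) :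
    |slp φ t r - slp φ t p| ≤ 16 * κ ∧
    |(ht φ r : ℝ) - ht φ p - slp φ t r * (r.k - p.k)| ≤ 22 * κ * (8 * E : ℕ) := by
  obtain ⟨h, h1, h2, h3⟩ := H.pair_window hE hp hr hn (a := E) le_rfl (by omega)
  obtain ⟨h', h1', h2', h3'⟩ := H.pair_window hE hp hr hn (a := 4 * E) (by omega) le_rfl
  have hE' : (0:ℝ) < E := by exact_mod_cast hE
  have g1 : (h:ℝ) ≤ 2 * E := by exact_mod_cast (by omega : h ≤ 2 * E)
  have g2 : (4:ℝ) * E ≤ h' := by exact_mod_cast h1'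
  have key : |slp φ t r - slp φ t p| ≤ 16 * κ := by
    have e : (slp φ t r - slp φ t p) * ((h':ℝ) - h) =
      ((ht φ r : ℝ) - ht φ p + slp φ t r * (h' - (r.k - p.k) + (8 * E : ℕ)) - slp φ t p * (h' + (8 * E : ℕ))) -
      ((ht φ r : ℝ) - ht φ p + slp φ t r * (h - (r.k - p.k) + (8 * E : ℕ)) - slp φ t p * (h + (8 * E : ℕ))) := by ring
    have e1 := abs_sub ((ht φ r : ℝ) - ht φ p + slp φ t r * (h' - (r.k - p.k) + (8 * E : ℕ)) - slp φ t p * (h' + (8 * E : ℕ)))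
      ((ht φ r : ℝ) - ht φ p + slp φ t r * (h - (r.k - p.k) + (8 * E : ℕ)) - slp φ t p * (h + (8 * E : ℕ)))
    rw [← e, abs_mul, abs_of_nonneg (by linarith : (0:ℝ) ≤ (h':ℝ) - h)] at e1
    have e3 : |slp φ t r - slp φ t p| * (2 * E) ≤ |slp φ t r - slp φ t p| * ((h':ℝ) - h) := by
      gcongr; linarith
    push_cast at *
    have : |slp φ t r - slp φ t p| * (2 * E) ≤ 16 * κ * (2 * E) := by linarith
    exact le_of_mul_le_mul_right this (by positivity)
  refine ⟨key, ?_⟩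
  have e : (ht φ r : ℝ) - ht φ p - slp φ t r * (r.k - p.k) =
    ((ht φ r : ℝ) - ht φ p + slp φ t r * (h - (r.k - p.k) + (8 * E : ℕ)) - slp φ t p * (h + (8 * E : ℕ))) -
      (slp φ t r - slp φ t p) * (h + (8 * E : ℕ)) := by ring
  rw [e]
  refine (abs_sub _ _).trans ?_
  rw [abs_mul, abs_of_nonneg (by positivity : (0:ℝ) ≤ (h:ℝ) + (8 * E : ℕ))]
  have : |slp φ t r - slp φ t p| * ((h:ℝ) + (8 * E : ℕ)) ≤ 16 * κ * (10 * E) := by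
    gcongr
    · exact (abs_nonneg _).trans key
    · push_cast; linarith
  push_cast at *
  linarith

end

/-! ### The slopes are essentially bounded by one -/

/-- The cells met by a family of vertical lines through a cell. -/
def fan (R h : ℕ) (u : Cell) (i : ℕ) : Cell := ((u.corner.ys (i / 2 ^ R)).up h).cell

lemma fan_eq {R h : ℕ} (hh : h ≤ R) (u : Cell) (i : ℕ) :
    fan R h u i = ⟨u.i / 2 ^ h, (u.j * 2 ^ R + i) / 2 ^ (R - h), u.k + h⟩ := by
  have key : ∀ (w : ℤ) (m : ℕ) (z : ℝ), z = (w:ℝ) / (2 ^ m : ℕ) → ⌊z⌋ = w / 2 ^ m := by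
    rintro w m z rfl
    rw [Int.floor_div_natCast, Int.floor_intCast]; push_cast; rfl
  have e1 : (2:ℝ) ^ u.k ≠ 0 := (two_zpow_pos _).ne'
  have e2 : (2:ℝ) ^ R = 2 ^ (R - h) * 2 ^ h := by rw [← pow_add]; congr 1; omega
  ext
  · refine key _ _ _ ?_
    simp only [Cell.corner, Pt.up_x, Pt.ys_x, Pt.up_k, Pt.ys_k, neg_add, two_zpow_add, zpow_neg, zpow_natCast]
    push_cast
    field_simp
  · refine key _ _ _ ?_
    simp only [Cell.corner, Pt.up_y, Pt.ys_y, Pt.up_k, Pt.ys_k, two_zpow_add, zpow_neg, zpow_natCast]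
    push_cast
    rw [e2]
    field_simp
  · rfl

lemma card_fan_le {R h : ℕ} (hh : h ≤ R) (S : Finset (Cell × ℕ)) (hS : ∀ p ∈ S, p.2 < 2 ^ R) (v : Cell) :
    (S.filter (fun p => fan R h p.1 p.2 = v)).card ≤ 2 ^ R := by
  classical
  have hp1 : (0:ℤ) < 2 ^ h := by positivity
  have hp2 : (0:ℤ) < 2 ^ (R - h) := by positivity
  have hz : ∀ z m : ℤ, ((z + 1) * m - z * m).toNat = m.toNat := by intro z m; congr 1; ring
  have hdiv : ∀ z v m : ℤ, 0 < m → z / m = v → v * m ≤ z ∧ z < (v + 1) * m := by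
    rintro z v m hm rfl
    have h1 := Int.emod_nonneg z hm.ne'
    have h2 := Int.emod_lt_of_pos z hm
    have h3 := Int.mul_ediv_add_emod z m
    constructor <;> nlinarith
  have hcard : ((Finset.Ico (v.i * 2 ^ h) ((v.i + 1) * 2 ^ h)) ×ˢ
      (Finset.Ico (v.j * 2 ^ (R - h)) ((v.j + 1) * 2 ^ (R - h)))).card = 2 ^ R := by
    rw [Finset.card_product, Int.card_Ico, Int.card_Ico, hz, hz, two_pow_toNat, two_pow_toNat, ← pow_add]
    congr 1; omega
  rw [← hcard]
  refine Finset.card_le_card_of_injOn (fun p => (p.1.i, p.1.j * 2 ^ R + p.2)) ?_ ?_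
  · rintro ⟨u, i⟩ hp
    have := (Finset.mem_filter.1 hp).2
    rw [fan_eq hh, Cell.ext_iff] at this
    obtain ⟨h1, h2, -⟩ := this
    have := hdiv _ _ _ hp1 h1
    have := hdiv _ _ _ hp2 h2
    simp only [Finset.coe_product, Set.mem_prod, Finset.coe_Ico, Set.mem_Ico]
    exact ⟨‹_›, ‹_›⟩
  · rintro ⟨u, i⟩ hp ⟨u', i'⟩ hp' e
    obtain ⟨m1, q1⟩ := Finset.mem_filter.1 hp
    obtain ⟨m2, q2⟩ := Finset.mem_filter.1 hp'
    have l1 := hS _ m1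
    have l2 := hS _ m2
    rw [fan_eq hh, Cell.ext_iff] at q1 q2
    simp only [Prod.mk.injEq] at e q1 q2 l1 l2 ⊢
    obtain ⟨e1, e2⟩ := e
    have l1' : (i:ℤ) < 2 ^ R := by exact_mod_cast l1
    have l2' : (i':ℤ) < 2 ^ R := by exact_mod_cast l2
    have hj : u.j = u'.j := by
      have a1 := Int.add_mul_ediv_right (i:ℤ) u.j (by positivity : (2:ℤ)^R ≠ 0)
      have a2 := Int.add_mul_ediv_right (i':ℤ) u'.j (by positivity : (2:ℤ)^R ≠ 0)
      rw [Int.ediv_eq_zero_of_lt (by positivity) l1'] at a1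
      rw [Int.ediv_eq_zero_of_lt (by positivity) l2'] at a2
      rw [add_comm] at a1 a2
      linarith [congrArg (· / (2:ℤ)^R) e2]
    refine ⟨?_, ?_⟩
    · ext
      · exact e1
      · exact hj
      · linarith [q1.2.2, q2.2.2]
    · rw [hj] at e2
      exact_mod_cast (add_left_cancel e2)

section
variable {A : ℕ} {φ ψ : Cell → Cell} (H : CQI A φ ψ)
include H

lemma CQI.card_fan_mem_le {R h : ℕ} (hh : h ≤ R) (S V : Finset Cell) [DecidableEq Cell] :
    ((S ×ˢ Finset.range (2 ^ R)).filter (fun p => ψ (fan R h (φ p.1) p.2) ∈ V)).card ≤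
      mult A * (2 ^ R * (mult A * V.card)) := by
  set P := (S ×ˢ Finset.range (2 ^ R)).filter (fun p => ψ (fan R h (φ p.1) p.2) ∈ V) with hP
  set Z := P.image fun p => (φ p.1, p.2) with hZ
  set W := Z.image fun p => fan R h p.1 p.2 with hW
  have h1 : P.card ≤ mult A * Z.card := by
    refine Finset.card_le_mul_card_image P _ fun b _ => ?_
    refine le_trans ?_ (H.card_fiber S b.1)
    refine Finset.card_le_card_of_injOn Prod.fst ?_ ?_
    · rintro ⟨c, i⟩ hc
      simp only [hP, Finset.coe_filter, Finset.mem_filter, Finset.mem_product, Set.mem_ofPred_eq] at hc ⊢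
      exact ⟨hc.1.1.1, by rw [← hc.2]⟩
    · rintro ⟨c, i⟩ hc ⟨c', i'⟩ hc' e
      simp only [Finset.coe_filter, Set.mem_ofPred_eq] at hc hc' e
      rw [e, show i = i' by rw [← hc'.2] at hc; exact congrArg Prod.snd hc.2]
  have h2 : Z.card ≤ 2 ^ R * W.card := by
    refine Finset.card_le_mul_card_image Z _ fun b _ => ?_
    convert card_fan_le hh Z ?_ b
    intro p hp
    obtain ⟨q, hq, rfl⟩ := Finset.mem_image.1 hp
    simp only [hP, Finset.mem_filter, Finset.mem_product, Finset.mem_range] at hq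
    exact hq.1.2
  have h3 : W.card ≤ mult A * V.card := by
    refine Finset.card_le_mul_card_image_of_maps_to (f := ψ) (fun w hw => ?_) _ fun b _ => by
      convert H.symm.card_fiber W b
    obtain ⟨q, hq, rfl⟩ := Finset.mem_image.1 hw
    obtain ⟨p, hp, rfl⟩ := Finset.mem_image.1 hq
    exact (Finset.mem_filter.1 hp).2
  exact h1.trans (Nat.mul_le_mul_left _ (h2.trans (Nat.mul_le_mul_left _ h3)))

lemma CQI.near_fan {R h i : ℕ} (hh : h ≤ R) (hi : i < 2 ^ R) {w : Pt} :
    Near (5 * (A + 1) * R + 6 * A + 6) w (ψ (fan R h (φ w.cell) i)).corner := by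
  have n1 : Near R (φ w.cell).corner (((φ w.cell).corner.ys (i / 2 ^ R)).up h) := by
    have hi' : ((i:ℝ) / 2 ^ R) ≤ 1 := by
      rw [div_le_one (by positivity)]; exact_mod_cast hi.le
    have e := two_zpow_pos (-(φ w.cell).corner.k)
    refine ⟨?_, ?_, ?_⟩
    · simp; exact hh
    · simp; positivity
    · simp only [Pt.up_y, Pt.ys_y, sub_add_cancel_left, abs_neg]
      rw [abs_of_nonneg (by positivity)]
      calc _ ≤ 1 * (2:ℝ) ^ (-(φ w.cell).corner.k) := by gcongr
        _ ≤ _ := by rw [one_mul]; exact two_zpow_le (by linarith [Nat.cast_nonneg (α := ℤ) R])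
  have n2 := H.symm.img_near n1
  simp only [img, Cell.cell_corner] at n2
  refine Near.mono ?_ ((w.near_corner.symm.trans (H.left_inv w.cell).symm).trans n2)
  linarith

lemma CQI.slope_le {t E R : ℕ} {κ : ℝ} (hE : 0 < E) (hA : A ≤ κ * (8 * E : ℕ))
    (hER : 15 * (A + 1) * R + 18 * A + 22 ≤ E) {w p r : Pt}
    (hw : Good φ t (8 * E) κ w) (hp : Good φ t (8 * E) κ p) (hr : Good φ t (8 * E) κ r)
    {h h' i : ℕ} (hh : h ≤ R) (hh' : h' ≤ R) (hi : i < 2 ^ R)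
    (ep : p.cell = ψ (fan R h (φ w.cell) i)) (er : r.cell = ψ (fan R h' (φ w.cell) i))
    {Δ : ℝ} (hΔ : 0 ≤ Δ) (hΔ' : Δ ≤ (r.k : ℝ) - p.k) :
    (|slp φ t w| - 16 * κ) * Δ ≤ R + 2 * A + 22 * κ * (8 * E : ℕ) := by
  have n1 := H.near_fan hh hi (w := w)
  have n2 := H.near_fan hh' hi (w := w)
  rw [← ep] at n1
  rw [← er] at n2
  have n1' := n1.trans p.near_corner
  have n2' := n2.trans r.near_corner
  have q1 := H.pair hE hA hw hr (n2'.mono (by nlinarith))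
  have q2 := H.pair hE hA hp hr ((n1'.symm.trans n2').mono (by nlinarith))
  have f : ∀ (z : Pt) (g : ℕ), z.cell = ψ (fan R g (φ w.cell) i) →
      |(ht φ z : ℝ) - ((φ w.cell).k + g)| ≤ A := by
    intro z g ez
    have := (H.right_inv (fan R g (φ w.cell) i)).1
    rw [← ez] at this
    have e : (fan R g (φ w.cell) i).corner.k = (φ w.cell).k + g := rfl
    rw [e] at this
    exact_mod_cast this
  have f1 := abs_le.1 (f p h ep)
  have f2 := abs_le.1 (f r h' er)
  have c1 : (h:ℝ) ≤ R := by exact_mod_cast hh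
  have c2 : (h':ℝ) ≤ R := by exact_mod_cast hh'
  have c3 : (0:ℝ) ≤ h := by positivity
  have c4 : (0:ℝ) ≤ h' := by positivity
  have q3 := abs_le.1 q2.2
  have q4 : |slp φ t r * ((r.k : ℝ) - p.k)| ≤ R + 2 * A + 22 * κ * (8 * E : ℕ) := by
    rw [abs_le]; constructor <;> linarith
  rw [abs_mul, abs_of_nonneg (hΔ.trans hΔ')] at q4
  have q5 : |slp φ t w| - 16 * κ ≤ |slp φ t r| := by
    have := abs_sub_abs_le_abs_sub (slp φ t w) (slp φ t r)
    rw [abs_sub_comm] at this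
    linarith [q1.1]
  calc _ ≤ |slp φ t r| * Δ := by gcongr
    _ ≤ |slp φ t r| * ((r.k : ℝ) - p.k) := by gcongr
    _ ≤ _ := q4

end

open Classical in
lemma Tile.card_void_le (T : Tile) (P : Pt → Prop) (V : Finset Cell) (hV : ∀ e ∈ V, T.Mem e.corner ∧
    ∀ w ∈ T.pts, w.cell = e → P w) : V.card * 2 ^ T.n ≤ (T.pts.filter P).card := by
  calc V.card * 2 ^ T.n = ∑ e ∈ V, ((T.pts.filter P).filter fun w => w.cell = e).card := by
        rw [← smul_eq_mul, ← Finset.sum_const]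
        refine Finset.sum_congr rfl fun e he => ?_
        rw [← T.card_pts_cell (hV e he).1, Finset.filter_filter]
        congr 1
        refine Finset.filter_congr fun w hw => ?_
        exact ⟨fun h => ⟨(hV e he).2 w hw h, h⟩, fun h => h.2⟩
    _ = (V.biUnion fun e => (T.pts.filter P).filter fun w => w.cell = e).card := by
        rw [Finset.card_biUnion]
        intro e _ e' _ hne
        rw [Function.onFun, Finset.disjoint_filter]
        rintro w - rfl h
        exact hne h
    _ ≤ _ := Finset.card_le_card (Finset.biUnion_subset.2 fun e _ => Finset.filter_subset _ _)

section
variable {A : ℕ} {φ ψ : Cell → Cell} (H : CQI A φ ψ)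
include H

lemma CQI.exists_fan_range {R m G : ℕ} (hR : R = m * G) (hG : 0 < G) {u : Cell} {i : ℕ} {ε : ℝ}
    {h h' : ℕ} (hh : h ≤ R) (hh' : h' ≤ R)
    (hlt : (1 - ε) * R < ((ψ (fan R h u i)).k : ℝ) - (ψ (fan R h' u i)).k) :
    ∃ g ≤ m, ∃ g' ≤ m,
      (1 - ε) * R - 2 * G * A ≤ ((ψ (fan R (g * G) u i)).k : ℝ) - (ψ (fan R (g' * G) u i)).k := by
  have key : ∀ l ≤ R, l / G ≤ m ∧ |((ψ (fan R l u i)).k : ℝ) - (ψ (fan R (l / G * G) u i)).k| ≤ G * A := by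
    intro l hl
    refine ⟨Nat.div_le_of_le_mul (by rw [mul_comm, ← hR]; exact hl), ?_⟩
    have := H.symm.ht_up_real ((u.corner.ys (i / 2 ^ R)).up (l / G * G : ℕ)) (l % G)
    rw [Pt.up_up] at this
    have e : ((l / G * G : ℕ) : ℤ) + (l % G : ℕ) = l := by exact_mod_cast Nat.div_add_mod' l G
    rw [e] at this
    refine this.trans ?_
    gcongr
    exact (Nat.mod_lt _ hG).le
  obtain ⟨a1, a2⟩ := key h hh
  obtain ⟨b1, b2⟩ := key h' hh'
  rw [abs_le] at a2 b2
  exact ⟨_, a1, _, b1, by linarith⟩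

open Classical in
lemma CQI.card_steep_le {t E R m G : ℕ} {κ ε thr : ℝ} (hE : 0 < E) (hA : A ≤ κ * (8 * E : ℕ))
    (hER : 15 * (A + 1) * R + 18 * A + 22 ≤ E) (hR : R = m * G) (hG : 0 < G) (hε : ε ≤ 1 / 2)
    (hRB : ∀ (a : Pt) (B : Finset ℕ), B ⊆ Finset.range (2 ^ R) →
      (∀ i ∈ B, ∀ h ≤ R, ∀ h' ≤ R, ((ht ψ ((a.ys (i / 2 ^ R)).up (h:ℕ)) : ℝ) -
        ht ψ ((a.ys (i / 2 ^ R)).up (h':ℕ))) ≤ (1 - ε) * R) → (B.card : ℝ) ≤ ε * 2 ^ R)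
    (h0 : 0 ≤ (1 - ε) * R - 2 * G * A)
    (hthr : R + 2 * A + 22 * κ * (8 * E : ℕ) ≤ (thr - 16 * κ) * ((1 - ε) * R - 2 * G * A)) (T : Tile) :
    ((T.pts.filter fun w => Good φ t (8 * E) κ w ∧ thr < |slp φ t w|).card : ℝ) ≤
      (2 * (m + 1) * mult A ^ 2 : ℕ) * (T.pts.filter fun w => ¬ Good φ t (8 * E) κ w).card +
      (2 * (5 * (A + 1) * R + 6 * A + 6 : ℕ) + 6 * 2 ^ (5 * (A + 1) * R + 6 * A + 6)) * 4 ^ T.n := by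
  set K := 5 * (A + 1) * R + 6 * A + 6
  set S := T.pts.filter fun w => Good φ t (8 * E) κ w ∧ thr < |slp φ t w|
  set V := (T.pts.image Pt.cell).filter fun e => ∀ w ∈ T.pts, w.cell = e → ¬ Good φ t (8 * E) κ w with hV
  set S0 := S.filter fun w => ∀ e : Pt, Near K w e → T.Mem e
  set P := S0.image Pt.cell
  have hvoid := T.card_void_le (fun w => ¬ Good φ t (8 * E) κ w) V (fun e he => by
    obtain ⟨h1, h2⟩ := Finset.mem_filter.1 he
    obtain ⟨w, hw, rfl⟩ := Finset.mem_image.1 h1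
    exact ⟨T.mem_corner_of_mem hw, h2⟩)
  have hmem : ∀ e : Cell, T.Mem e.corner → e ∉ V → ∃ w ∈ T.pts, w.cell = e ∧ Good φ t (8 * E) κ w := by
    intro e he heV
    by_contra! hc
    refine heV (Finset.mem_filter.2 ⟨?_, hc⟩)
    have := T.card_pts_cell he
    obtain ⟨w, hw⟩ := Finset.card_pos.1 (by rw [this]; positivity)
    obtain ⟨h1, h2⟩ := Finset.mem_filter.1 hw
    exact Finset.mem_image.2 ⟨w, h1, h2⟩
  set Q : ℕ → Finset (Cell × ℕ) := fun g => (P ×ˢ Finset.range (2 ^ R)).filter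
    (fun p => ψ (fan R (g * G) (φ p.1) p.2) ∈ V) with hQ
  have hmany : ∀ c ∈ P, 2 ^ R ≤ 2 * ((Finset.range (2 ^ R)).filter
      (fun i => ∃ g ∈ Finset.range (m + 1), ψ (fan R (g * G) (φ c) i) ∈ V)).card := by
    intro c hc
    obtain ⟨w, hw, rfl⟩ := Finset.mem_image.1 hc
    obtain ⟨hw, hnear⟩ := Finset.mem_filter.1 hw
    obtain ⟨-, hgood, hs⟩ := Finset.mem_filter.1 hw
    set B := (Finset.range (2 ^ R)).filter
      (fun i => ∃ g ∈ Finset.range (m + 1), ψ (fan R (g * G) (φ w.cell) i) ∈ V)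
    have hB := hRB (φ w.cell).corner (Finset.range (2 ^ R) \ B) Finset.sdiff_subset ?_
    · have hc : (Finset.range (2 ^ R) \ B).card = 2 ^ R - B.card := by
        rw [Finset.card_sdiff_of_subset (Finset.filter_subset _ _), Finset.card_range]
      have hle : B.card ≤ 2 ^ R := by
        exact (Finset.card_le_card (Finset.filter_subset _ _)).trans_eq (Finset.card_range _)
      rw [hc, Nat.cast_sub hle] at hB
      push_cast at hB
      have : (2:ℝ) ^ R ≤ 2 * B.card := by nlinarith [pow_pos (two_pos (α := ℝ)) R]
      exact_mod_cast this
    · intro i hi h hh h' hh'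
      obtain ⟨hi, hiB⟩ := Finset.mem_sdiff.1 hi
      by_contra! hlt
      obtain ⟨g, hg, g', hg', hd⟩ := H.exists_fan_range hR hG hh hh' hlt
      have hnot : ∀ l ≤ m, ψ (fan R (l * G) (φ w.cell) i) ∉ V := by
        intro l hl hc
        exact hiB (Finset.mem_filter.2 ⟨hi, l, Finset.mem_range.2 (by omega), hc⟩)
      have hin : ∀ l ≤ m, l * G ≤ R := fun l hl => by rw [hR]; exact Nat.mul_le_mul_right _ hl
      have hiR := Finset.mem_range.1 hi
      obtain ⟨r, -, er, hr⟩ := hmem _ (hnear _ (H.near_fan (hin g hg) hiR)) (hnot g hg)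
      obtain ⟨p, -, ep, hp⟩ := hmem _ (hnear _ (H.near_fan (hin g' hg') hiR)) (hnot g' hg')
      have e1 : r.k = (ψ (fan R (g * G) (φ w.cell) i)).k := by rw [← er]; rfl
      have e2 : p.k = (ψ (fan R (g' * G) (φ w.cell) i)).k := by rw [← ep]; rfl
      have := H.slope_le hE hA hER hgood hp hr (hin g' hg') (hin g hg) hiR ep er h0 (by rw [e1, e2]; exact hd)
      have h0' : 0 < (1 - ε) * R - 2 * G * A := by
        refine lt_of_le_of_ne h0 fun hz => ?_
        rw [← hz, mul_zero] at hthr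
        have hA0 : (0:ℝ) ≤ A := by positivity
        have hR0 : (0:ℝ) < R := by
          have : 0 < R := by
            rcases Nat.eq_zero_or_pos R with h0R | h0R
            · exfalso
              subst h0R
              have e3 : h = h' := by omega
              rw [e3] at hlt; simp at hlt
            · exact h0R
          exact_mod_cast this
        nlinarith [hA0.trans hA]
      nlinarith [this.trans hthr]
  have hcount : P.card * 2 ^ R ≤ 2 * ((m + 1) * (mult A * (2 ^ R * (mult A * V.card)))) := by
    calc P.card * 2 ^ R ≤ ∑ c ∈ P, 2 * ((Finset.range (2 ^ R)).filter
          (fun i => ∃ g ∈ Finset.range (m + 1), ψ (fan R (g * G) (φ c) i) ∈ V)).card := by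
          rw [← smul_eq_mul, ← Finset.sum_const]; exact Finset.sum_le_sum hmany
      _ = 2 * ((P ×ˢ Finset.range (2 ^ R)).filter
          (fun p => ∃ g ∈ Finset.range (m + 1), ψ (fan R (g * G) (φ p.1) p.2) ∈ V)).card := by
          rw [← Finset.mul_sum, Finset.card_filter, Finset.sum_product]
          simp only [Finset.card_filter]
      _ ≤ 2 * ((Finset.range (m + 1)).biUnion Q).card := by
          gcongr
          intro p hp
          obtain ⟨h1, g, hg, h2⟩ := Finset.mem_filter.1 hp
          exact Finset.mem_biUnion.2 ⟨g, hg, Finset.mem_filter.2 ⟨h1, h2⟩⟩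
      _ ≤ 2 * ((m + 1) * (mult A * (2 ^ R * (mult A * V.card)))) := by
          gcongr
          refine (Finset.card_biUnion_le_card_mul _ _ _ fun g hg => ?_).trans_eq (by rw [Finset.card_range])
          refine H.card_fan_mem_le ?_ P V
          rw [hR]; exact Nat.mul_le_mul_right _ (by have := Finset.mem_range.1 hg; omega)
  have hcount' : P.card ≤ 2 * (m + 1) * mult A ^ 2 * V.card := by
    refine Nat.le_of_mul_le_mul_right (hcount.trans_eq ?_) (by positivity : 0 < 2 ^ R)
    ring
  have hS0 : S0.card ≤ 2 ^ T.n * P.card := by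
    refine Finset.card_le_mul_card_image _ _ fun b hb => ?_
    obtain ⟨w, hw, rfl⟩ := Finset.mem_image.1 hb
    have hwT := (Finset.mem_filter.1 (Finset.mem_filter.1 hw).1).1
    rw [← T.card_pts_cell (T.mem_corner_of_mem hwT)]
    refine Finset.card_le_card fun v hv => ?_
    obtain ⟨h1, h2⟩ := Finset.mem_filter.1 hv
    exact Finset.mem_filter.2 ⟨(Finset.mem_filter.1 (Finset.mem_filter.1 h1).1).1, h2⟩
  have hS1 := T.card_pts_filter_le K (fun w => ¬ ∀ e : Pt, Near K w e → T.Mem e) (fun q _ hq => by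
    by_contra hc; exact hq fun e he => T.mem_of_near hc he)
  have hS : S.card ≤ S0.card + (T.pts.filter fun w => ¬ ∀ e : Pt, Near K w e → T.Mem e).card := by
    rw [← Finset.card_filter_add_card_filter_not (s := S) (fun w => ∀ e : Pt, Near K w e → T.Mem e)]
    gcongr
    exact Finset.filter_subset _ _
  have hfin : S0.card ≤ (2 * (m + 1) * mult A ^ 2) * (T.pts.filter fun w => ¬ Good φ t (8 * E) κ w).card :=
    calc S0.card ≤ 2 ^ T.n * P.card := hS0
      _ ≤ 2 ^ T.n * (2 * (m + 1) * mult A ^ 2 * V.card) := by gcongr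
      _ = (2 * (m + 1) * mult A ^ 2) * (V.card * 2 ^ T.n) := by ring
      _ ≤ _ := Nat.mul_le_mul_left _ (hvoid.trans (le_of_eq (by congr!)))
  have a1 : (S.card : ℝ) ≤ S0.card + (T.pts.filter fun w => ¬ ∀ e : Pt, Near K w e → T.Mem e).card := by
    exact_mod_cast hS
  have a2 : (S0.card : ℝ) ≤ (2 * (m + 1) * mult A ^ 2 : ℕ) *
      (T.pts.filter fun w => ¬ Good φ t (8 * E) κ w).card := by exact_mod_cast hfin
  have a3 : ((T.pts.filter fun w => ¬ ∀ e : Pt, Near K w e → T.Mem e).card : ℝ) ≤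
      (2 * K + 6 * 2 ^ K) * 4 ^ T.n := by convert hS1
  linarith

end

section
open Filter Topology

section
variable {A : ℕ} {φ ψ : Cell → Cell} (H : CQI A φ ψ)
include H

lemma CQI.bdd_err {t D h i : ℕ} (hh : h ≤ D) (hi : i ≤ 2 ^ (2 * D)) : Bdd (err φ t D h i) := by
  refine Bdd.abs (Bdd.sub ?_ (Bdd.mul (H.bdd_slp t) (bdd_const _)))
  refine ⟨(D - h : ℕ) * A + A + (2 * D : ℕ) * A, fun w => ?_⟩
  set v := w.up ((h:ℤ) - D)
  have h1 := H.ht_up_real v (D - h)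
  have e : v.up (D - h : ℕ) = w := by
    simp only [v, Pt.up_up]
    rw [show (h:ℤ) - D + (D - h : ℕ) = 0 by push_cast [hh]; ring, Pt.up_zero]
  rw [e] at h1
  have h2 := H.ht_ys v (c := (i:ℝ) / 2 ^ (2 * D)) (by positivity) (by
    rw [div_le_one (by positivity)]; exact_mod_cast hi)
  have h3 := H.ht_up_real (v.ys ((i:ℝ) / 2 ^ (2 * D))) (2 * D)
  rw [abs_le] at *
  constructor <;> linarith

open Classical in
lemma CQI.mean_not_good {M : (Pt → ℝ) → ℝ} (hM : IsMean M) {t D : ℕ} (hD : 0 < D) {κ δ : ℝ} (hκ : 0 < κ)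
    (herr : ∀ h < D, ∀ i ≤ 2 ^ (2 * D), M (err φ t D h i) ≤ δ * D) :
    M (fun w => if ¬ Good φ t D κ w then 1 else 0) ≤ 32 * δ / κ := by
  have hD' : (0:ℝ) < D := by exact_mod_cast hD
  have b : ∀ h ∈ Finset.range D, Bdd (errSum φ t D h) := fun h hh =>
    Bdd.sum _ fun i hi => H.bdd_err (Finset.mem_range.1 hh).le (Finset.mem_range.1 hi).le
  have b' : Bdd (fun w => ∑ h ∈ Finset.range D, errSum φ t D h w) := Bdd.sum _ b
  set c : ℝ := (κ * D / 32 * (D * 2 ^ (2 * D)))⁻¹ with hc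
  have hcpos : 0 < κ * D / 32 * (D * 2 ^ (2 * D)) := by positivity
  have h1 : M (fun w => if ¬ Good φ t D κ w then 1 else 0) ≤
      M (fun w => c * ∑ h ∈ Finset.range D, errSum φ t D h w) := by
    refine hM.mono _ _ ⟨1, fun w => ?_⟩ (b'.const_mul c) fun w => ?_
    · dsimp only; split_ifs <;> simp
    · split_ifs with hg
      rotate_left
      · rw [Good, not_le] at hg
        rw [hc, inv_mul_eq_div, le_div_iff₀ hcpos, one_mul]
        exact hg.le
      · have : 0 ≤ ∑ h ∈ Finset.range D, errSum φ t D h w :=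
          Finset.sum_nonneg fun _ _ => errSum_nonneg _ _ _ _ _
        positivity
  rw [hM.smul _ _ b', hM.sum _ b] at h1
  have h2 : ∑ h ∈ Finset.range D, M (errSum φ t D h) ≤ D * (2 ^ (2 * D) * (δ * D)) := by
    refine (Finset.sum_le_card_nsmul _ _ (2 ^ (2 * D) * (δ * D)) fun h hh => ?_).trans_eq (by simp)
    unfold errSum
    rw [hM.sum _ fun i hi => H.bdd_err (Finset.mem_range.1 hh).le (Finset.mem_range.1 hi).le]
    exact (Finset.sum_le_card_nsmul _ _ (δ * D) fun i hi =>
      herr h (Finset.mem_range.1 hh) i (Finset.mem_range.1 hi).le).trans_eq (by simp)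
  refine h1.trans ?_
  calc c * ∑ h ∈ Finset.range D, M (errSum φ t D h) ≤ c * (D * (2 ^ (2 * D) * (δ * D))) := by
        gcongr
    _ = _ := by rw [hc]; field_simp

omit H in
lemma Tile.avg_ite (T : Tile) (P : Pt → Prop) [DecidablePred P] :
    T.avg (fun w => if P w then 1 else 0) = (T.pts.filter P).card / (4 ^ T.n * T.n) := by
  rw [Tile.avg, Finset.sum_boole]

omit H in
lemma slope_bound_aux {ε κ A R G F : ℝ} (hε : 0 < ε) (hε1 : ε ≤ 1) (hRr : 0 < R) (f1 : 200 * A ≤ ε * R)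
    (f2 : 32 * (2 * G * A) ≤ ε * R) (f3 : F ≤ 0.0142 * (ε * R)) (f4 : 16 * κ ≤ 0.0001 * ε) :
    0 ≤ (1 - ε / 32) * R - 2 * G * A ∧
    R + 2 * A + F ≤ ((1 + ε / 4) - 16 * κ) * ((1 - ε / 32) * R - 2 * G * A) := by
  have f5 : ε * R ≤ R := by nlinarith
  have f6 : ε * (ε * R) ≤ ε * R := by nlinarith [mul_pos hε hRr]
  have hstep : (1 - 0.07 * ε) * R ≤ (1 - ε / 32) * R - 2 * G * A := by nlinarith
  have h0 : 0 ≤ (1 - ε / 32) * R - 2 * G * A := by nlinarith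
  refine ⟨h0, ?_⟩
  calc R + 2 * A + F ≤ (1 + 0.2499 * ε) * ((1 - 0.07 * ε) * R) := by nlinarith
    _ ≤ ((1 + ε / 4) - 16 * κ) * ((1 - 0.07 * ε) * R) := by
          gcongr
          · nlinarith
          · linarith
    _ ≤ _ := by
          gcongr
          linarith

open Classical in
lemma CQI.mean_sq_le_of_card {ε κ δ : ℝ} (hε : 0 < ε) (hε1 : ε ≤ 1) (hκ : 0 < κ) {C₁ t D K : ℕ}
    (hδ : δ = κ * ε / (100 * ((A:ℝ) ^ 2 + 1) * (C₁ + 1))) {T : ℕ → Tile}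
    (hT : Tendsto (fun j => (T j).n) atTop atTop) (hD : 0 < D)
    (herr : ∀ h < D, ∀ i ≤ 2 ^ (2 * D), mean T (err φ t D h i) ≤ δ * D)
    (hcard : ∀ T : Tile, ((T.pts.filter fun w => Good φ t D κ w ∧ 1 + ε / 4 < |slp φ t w|).card : ℝ) ≤
      C₁ * (T.pts.filter fun w => ¬ Good φ t D κ w).card + (2 * K + 6 * 2 ^ K) * 4 ^ T.n) :
    mean T (fun w => slp φ t w ^ 2) ≤ 1 + ε := by
  have hM := mean_isMean hT
  set bad : Pt → ℝ := fun w => if ¬ Good φ t D κ w then 1 else 0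
  set steep : Pt → ℝ := fun w => if Good φ t D κ w ∧ 1 + ε / 4 < |slp φ t w| then 1 else 0
  have bbad : Bdd bad := ⟨1, fun w => by simp only [bad]; split_ifs <;> simp⟩
  have bsteep : Bdd steep := ⟨1, fun w => by simp only [steep]; split_ifs <;> simp⟩
  have g1 : mean T bad ≤ 32 * δ / κ := H.mean_not_good hM hD hκ herr
  have g2 : mean T steep ≤ C₁ * mean T bad := by
    refine mean_le_mean hT bsteep bbad (d := 2 * K + 6 * 2 ^ K) (Eventually.of_forall fun i => ?_)
    simp only [steep, bad, Tile.avg_ite]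
    have := hcard (T i)
    rcases Nat.eq_zero_or_pos (T i).n with hn | hn
    · simp [hn]
    · have hn' : (0:ℝ) < (T i).n := by exact_mod_cast hn
      calc _ ≤ ((C₁:ℝ) * ((T i).pts.filter fun w => ¬ Good φ t D κ w).card +
              (2 * K + 6 * 2 ^ K) * 4 ^ (T i).n) / (4 ^ (T i).n * (T i).n) := by
            gcongr
        _ = _ := by field_simp
  have hsq : ∀ w, slp φ t w ^ 2 ≤ (1 + ε / 4) ^ 2 + (A:ℝ) ^ 2 * (steep w + bad w) := by
    intro w
    have hb : slp φ t w ^ 2 ≤ (A:ℝ) ^ 2 := sq_le_sq' (abs_le.1 (H.abs_slp_le t w)).1 (abs_le.1 (H.abs_slp_le t w)).2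
    simp only [steep, bad]
    by_cases hg : Good φ t D κ w
    · by_cases hs : 1 + ε / 4 < |slp φ t w|
      · simp only [hg, hs, and_self, if_true, not_true, if_false]; nlinarith
      · simp only [hg, hs, and_false, if_false, not_true]
        rw [← sq_abs]
        have := abs_nonneg (slp φ t w)
        nlinarith
    · simp only [hg, false_and, if_false, not_false_iff, if_true]; nlinarith
  have hfin := hM.mono _ _ (H.bdd_slp t).pow ((bdd_const _).add ((bsteep.add bbad).const_mul _)) hsq
  rw [hM.add _ _ (bdd_const _) ((bsteep.add bbad).const_mul _), hM.const, hM.smul _ _ (bsteep.add bbad),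
    hM.add _ _ bsteep bbad] at hfin
  have g3 : (A:ℝ) ^ 2 * (mean T steep + mean T bad) ≤ 0.32 * ε := by
    calc (A:ℝ) ^ 2 * (mean T steep + mean T bad) ≤ (A:ℝ) ^ 2 * ((C₁ + 1) * mean T bad) := by
          gcongr; linarith
      _ ≤ (A:ℝ) ^ 2 * ((C₁ + 1) * (32 * δ / κ)) := by gcongr
      _ ≤ ((A:ℝ) ^ 2 + 1) * ((C₁ + 1) * (32 * δ / κ)) :=
          mul_le_mul_of_nonneg_right (by linarith) (by rw [hδ]; positivity)
      _ = 0.32 * ε := by rw [hδ]; field_simp; norm_num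
  nlinarith

lemma CQI.mean_sq_le {ε : ℝ} (hε : 0 < ε) (hε1 : ε ≤ 1) {T : ℕ → Tile}
    (hT : Tendsto (fun j => (T j).n) atTop atTop) :
    ∃ j : ℕ, mean T (fun w => slp φ (2 ^ j) w ^ 2) ≤ 1 + ε := by
  classical
  have hM := mean_isMean hT
  obtain ⟨n₀, hn₀⟩ := H.symm.range_bound (ε := ε / 32) (by positivity)
  obtain ⟨m, hm⟩ := exists_nat_ge (64 * (A + 1) / ε)
  obtain ⟨R₁, hR₁⟩ := exists_nat_ge (200 * A / ε)
  set κ : ℝ := ε / (400000 * (A + 1)) with hκd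
  have hκ : 0 < κ := by positivity
  obtain ⟨L₁, hL₁⟩ := exists_nat_ge (A / (8 * κ))
  set C₁ : ℕ := 2 * (m + 1) * mult A ^ 2
  set δ : ℝ := κ * ε / (100 * ((A:ℝ) ^ 2 + 1) * (C₁ + 1)) with hδd
  have hδ : 0 < δ := by positivity
  have hA1 : (0:ℝ) < A + 1 := by positivity
  have hm0 : 0 < m := by
    have : (0:ℝ) < m := lt_of_lt_of_le (by positivity) hm
    exact_mod_cast this
  set R₂ := n₀ + R₁ + 22
  obtain ⟨j, E, hL, hE, herr⟩ := H.exists_scale hM hδ (L₁ + 16 * (A + 1) * m * R₂)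
  set G := E / (16 * (A + 1) * m)
  have hc : 0 < 16 * (A + 1) * m := by positivity
  have hG : R₂ ≤ G := (Nat.le_div_iff_mul_le hc).2 (by linarith)
  have hG0 : 0 < G := by omega
  set R := m * G with hR
  have hRG : G ≤ R := Nat.le_mul_of_pos_left _ hm0
  have hE1 : 16 * (A + 1) * R ≤ E := by
    calc 16 * (A + 1) * R = G * (16 * (A + 1) * m) := by rw [hR]; ring
      _ ≤ E := Nat.div_mul_le_self _ _
  have hE2 : E ≤ 32 * (A + 1) * R := by
    have : E < G * (16 * (A + 1) * m) + 16 * (A + 1) * m := Nat.lt_div_mul_add hc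
    have h2 : 16 * (A + 1) * m ≤ G * (16 * (A + 1) * m) := Nat.le_mul_of_pos_left _ hG0
    calc E ≤ G * (16 * (A + 1) * m) + G * (16 * (A + 1) * m) := by linarith
      _ = _ := by rw [hR]; ring
  have hER : 15 * (A + 1) * R + 18 * A + 22 ≤ E := by
    have : (A + 1) * 22 ≤ (A + 1) * R := Nat.mul_le_mul_left _ (by omega)
    nlinarith
  have hA : (A:ℝ) ≤ κ * (8 * E : ℕ) := by
    have h1 : (L₁:ℝ) ≤ E := by exact_mod_cast (by omega : L₁ ≤ E)
    have h2 := hL₁.trans h1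
    rw [div_le_iff₀ (by positivity)] at h2
    push_cast; linarith
  have hRr : (0:ℝ) < R := by exact_mod_cast (by omega : 0 < R)
  have hRm : (R:ℝ) = m * G := by exact_mod_cast hR
  have f1 : 200 * (A:ℝ) ≤ ε * R := by
    have h1 : (R₁:ℝ) ≤ R := by exact_mod_cast (by omega : R₁ ≤ R)
    have h2 := hR₁.trans h1
    rw [div_le_iff₀ hε] at h2; linarith
  have f2 : 32 * (2 * G * A) ≤ ε * R := by
    rw [div_le_iff₀ hε] at hm
    have : (0:ℝ) ≤ G := by positivity
    rw [hRm]; nlinarith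
  have f3 : 22 * κ * (8 * E : ℕ) ≤ 0.0142 * (ε * R) := by
    have h1 : (E:ℝ) ≤ 32 * (A + 1) * R := by exact_mod_cast hE2
    calc 22 * κ * (8 * E : ℕ) = 176 * κ * E := by push_cast; ring
      _ ≤ 176 * κ * (32 * (A + 1) * R) := by gcongr
      _ = 5632 / 400000 * (ε * R) := by rw [hκd]; field_simp; norm_num
      _ ≤ _ := by gcongr; norm_num
  have f4 : 16 * κ ≤ 0.0001 * ε := by
    have : κ ≤ ε / 400000 := by
      rw [hκd]; gcongr; linarith [Nat.cast_nonneg (α := ℝ) A]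
    linarith
  obtain ⟨h0, hthr⟩ := slope_bound_aux hε hε1 hRr f1 f2 f3 f4
  exact ⟨j, H.mean_sq_le_of_card hε hε1 hκ hδd hT (by omega) herr fun T =>
    H.card_steep_le hE hA hER hR hG0 (by linarith) (hn₀ R (by omega)) h0 hthr T⟩

end

end

section
open Filter Topology

lemma Pt.near_up (a : Pt) (t : ℕ) : Near t a (a.up t) := by
  refine ⟨by simp, ?_, ?_⟩ <;> simp <;> positivity

lemma Tile.up_nat_mem (T : Tile) (t : ℕ) {q : ℤ × ℤ × ℕ} (hq : ¬ T.edge t q) :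
    (T.ipt q).up t ∈ T.pts :=
  (T.mem_pts_iff _).2 ⟨T.mem_of_near hq (Pt.near_up _ t), q.1, q.2.1, rfl, rfl⟩

section
variable {A : ℕ} {φ ψ : Cell → Cell} (H : CQI A φ ψ)
include H

lemma CQI.avg_sq_two_mul_le (T : Tile) {t : ℕ} (ht : 0 < t) :
    T.avg (fun w => slp φ (t * 2) w ^ 2) ≤
      T.avg (fun w => slp φ t w ^ 2) + (A:ℝ) ^ 2 * (2 * t + 6 * 2 ^ t) / T.n := by
  have hb : ∀ w, |slp φ t w ^ 2| ≤ (A:ℝ) ^ 2 := fun w => by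
    rw [abs_pow]; exact pow_le_pow_left₀ (abs_nonneg _) (H.abs_slp_le t w) 2
  have h1 := (abs_le.1 (T.avg_comp hb (Pt.up t) (Pt.up_injective _) t
    fun q _ hq => T.up_nat_mem t hq)).2
  have h2 : T.avg (fun w => slp φ (t * 2) w ^ 2) ≤
      T.avg (fun w => 1 / 2 * (slp φ t w ^ 2 + slp φ t (w.up t) ^ 2)) := by
    refine T.avg_mono fun w => ?_
    rw [slp_two_mul φ ht]
    nlinarith [sq_nonneg (slp φ t w - slp φ t (w.up t))]
  rw [T.avg_smul, T.avg_add] at h2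
  have e : 2 * (A:ℝ) ^ 2 * (2 * t + 6 * 2 ^ t) / T.n = 2 * ((A:ℝ) ^ 2 * (2 * t + 6 * 2 ^ t) / T.n) := by ring
  rw [e] at h1
  linarith

lemma CQI.avg_sq_le {ε : ℝ} (hε : 0 < ε) : ∃ j n₀ : ℕ, ∀ T : Tile, n₀ ≤ T.n →
    T.avg (fun w => slp φ (2 ^ j) w ^ 2) ≤ 1 + ε := by
  by_contra! hc
  set e : ℕ → ℝ := fun l => (A:ℝ) ^ 2 * (2 * (2 ^ l : ℕ) + 6 * 2 ^ (2 ^ l)) with he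
  have he0 : ∀ l, 0 ≤ e l := fun l => by positivity
  have hN : ∀ j, ∃ N : ℕ, 2 * (∑ l ∈ Finset.range j, e l) / ε ≤ N := fun j => exists_nat_ge _
  choose N hN using hN
  choose T hT1 hT2 using fun j => hc j (N j + j + 1)
  have hT : Tendsto (fun j => (T j).n) atTop atTop :=
    tendsto_atTop_mono (fun j => by have := hT1 j; simp only [id]; omega) tendsto_id
  have step : ∀ (T : Tile) (i d : ℕ), T.avg (fun w => slp φ (2 ^ (i + d)) w ^ 2) ≤
      T.avg (fun w => slp φ (2 ^ i) w ^ 2) + (∑ l ∈ Finset.range (i + d), e l) / T.n := by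
    intro T i d
    induction d with
    | zero =>
      have : 0 ≤ (∑ l ∈ Finset.range (i + 0), e l) / T.n :=
        div_nonneg (Finset.sum_nonneg fun l _ => he0 l) (by positivity)
      simpa using this
    | succ d ih =>
      have := H.avg_sq_two_mul_le T (t := 2 ^ (i + d)) (by positivity)
      rw [← add_assoc, Finset.sum_range_succ, add_div]
      rw [← pow_succ] at this
      simp only [he] at ih ⊢
      linarith
  obtain ⟨i, hi⟩ := H.mean_sq_le (ε := min ε 1 / 4) (by positivity)
    (by linarith [min_le_right ε 1]) hT
  have := le_mean (T := T) (H.bdd_slp (2 ^ i)).pow (c := 1 + ε / 2) ?_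
  · linarith [min_le_left ε 1]
  · filter_upwards [eventually_ge_atTop i] with j hj
    obtain ⟨d, rfl⟩ := Nat.exists_eq_add_of_le hj
    have h1 := step (T (i + d)) i d
    have h2 := hT2 (i + d)
    have h3 : (∑ l ∈ Finset.range (i + d), e l) / (T (i + d)).n ≤ ε / 2 := by
      have h4 : ((N (i + d) : ℕ) : ℝ) ≤ (T (i + d)).n := by
        exact_mod_cast (by have := hT1 (i + d); omega)
      have h5 : (0:ℝ) < (T (i + d)).n := by
        exact_mod_cast (by have := hT1 (i + d); omega)
      have h6 := (hN (i + d)).trans h4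
      rw [div_le_iff₀ hε] at h6
      rw [div_le_iff₀ h5]
      linarith
    linarith

end

end

/-! ### Straight lines -/

lemma sum_sq_sub_indicator (g : ℕ → ℝ) {n h₁ h₂ : ℕ} (h12 : h₁ ≤ h₂) (h2n : h₂ ≤ n) :
    ∑ h ∈ Finset.range n, (g (h + 1) - g h - if h ∈ Finset.Ico h₁ h₂ then 1 else 0) ^ 2 =
      ∑ h ∈ Finset.range n, (g (h + 1) - g h) ^ 2 - 2 * (g h₂ - g h₁) + (h₂ - h₁) := by
  have hsub : Finset.Ico h₁ h₂ ⊆ Finset.range n := fun h hh => by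
    simp only [Finset.mem_Ico, Finset.mem_range] at *; omega
  have e1 : ∑ h ∈ Finset.range n, (if h ∈ Finset.Ico h₁ h₂ then g (h + 1) - g h else 0) =
      g h₂ - g h₁ := by
    rw [Finset.sum_ite_mem, Finset.inter_eq_right.2 hsub, Finset.sum_Ico_eq_sub _ h12,
      Finset.sum_range_sub, Finset.sum_range_sub]
    ring
  have e2 : ∑ h ∈ Finset.range n, (if h ∈ Finset.Ico h₁ h₂ then (1:ℝ) else 0) = h₂ - h₁ := by
    rw [Finset.sum_ite_mem, Finset.inter_eq_right.2 hsub]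
    simp [Nat.cast_sub h12]
  rw [← e1, ← e2, Finset.mul_sum, ← Finset.sum_sub_distrib, ← Finset.sum_add_distrib]
  refine Finset.sum_congr rfl fun h _ => ?_
  split_ifs <;> ring

lemma two_mul_sub_le_sum_sq (g : ℕ → ℝ) {n h₁ h₂ : ℕ} (h12 : h₁ ≤ h₂) (h2n : h₂ ≤ n) :
    2 * (g h₂ - g h₁) - n ≤ ∑ h ∈ Finset.range n, (g (h + 1) - g h) ^ 2 := by
  have h := sum_sq_sub_indicator g h12 h2n
  have h0 : 0 ≤ ∑ h ∈ Finset.range n,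
      (g (h + 1) - g h - if h ∈ Finset.Ico h₁ h₂ then (1:ℝ) else 0) ^ 2 :=
    Finset.sum_nonneg fun _ _ => sq_nonneg _
  have h1 : (h₂:ℝ) ≤ n := by exact_mod_cast h2n
  have h2 : (0:ℝ) ≤ h₁ := by positivity
  linarith

lemma straight_of_sum_sq (g : ℕ → ℝ) {n h₁ h₂ : ℕ} {κ : ℝ} (hκ : 0 ≤ κ)
    (h12 : h₁ ≤ h₂) (h2n : h₂ ≤ n)
    (hs : ∑ h ∈ Finset.range n, (g (h + 1) - g h) ^ 2 + n - 2 * (g h₂ - g h₁) ≤ κ ^ 2 * n)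
    {h : ℕ} (hh : h ≤ n) : |g h - g 0 - h| ≤ 2 * κ * n := by
  have h1 : (h₂:ℝ) ≤ n := by exact_mod_cast h2n
  have h2 : (0:ℝ) ≤ h₁ := by positivity
  have hle : (h₁:ℝ) ≤ h₂ := by exact_mod_cast h12
  have hn : (0:ℝ) ≤ n := by positivity
  have e := sum_sq_sub_indicator g h12 h2n
  set c : ℕ → ℝ := fun h => if h ∈ Finset.Ico h₁ h₂ then 1 else 0 with hc
  have h0 : 0 ≤ ∑ h ∈ Finset.range n, (g (h + 1) - g h - c h) ^ 2 :=
    Finset.sum_nonneg fun _ _ => sq_nonneg _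
  have hsub : Finset.range h ⊆ Finset.range n := Finset.range_subset_range.2 hh
  have hD : |∑ i ∈ Finset.range h, (g (i + 1) - g i - c i)| ≤ κ * n := by
    refine abs_le_of_sq_le_sq ?_ (by positivity)
    have cs := sq_sum_le_card_mul_sum_sq (s := Finset.range h)
      (f := fun i => g (i + 1) - g i - c i)
    rw [Finset.card_range] at cs
    have m : ∑ i ∈ Finset.range h, (g (i + 1) - g i - c i) ^ 2 ≤ κ ^ 2 * n := by
      refine (Finset.sum_le_sum_of_subset_of_nonneg hsub fun _ _ _ => sq_nonneg _).trans ?_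
      linarith
    refine cs.trans ?_
    have hh' : (h:ℝ) ≤ n := by exact_mod_cast hh
    calc (h:ℝ) * _ ≤ n * (κ ^ 2 * n) := mul_le_mul hh' m
          (Finset.sum_nonneg fun _ _ => sq_nonneg _) hn
      _ = _ := by ring
  have hc1 : ∀ i, 0 ≤ 1 - c i := fun i => by simp only [hc]; split_ifs <;> norm_num
  have hE : |∑ i ∈ Finset.range h, (1 - c i)| ≤ κ * n := by
    rw [abs_of_nonneg (Finset.sum_nonneg fun i _ => hc1 i)]
    refine (Finset.sum_le_sum_of_subset_of_nonneg hsub fun i _ _ => hc1 i).trans ?_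
    have e2 : ∑ h ∈ Finset.range n, c h = h₂ - h₁ := by
      rw [hc, Finset.sum_ite_mem, Finset.inter_eq_right.2]
      · simp [Nat.cast_sub h12]
      · intro h hh; simp only [Finset.mem_Ico, Finset.mem_range] at *; omega
    rw [Finset.sum_sub_distrib, e2]
    simp only [Finset.sum_const, Finset.card_range, nsmul_eq_mul, mul_one]
    nlinarith
  have key : g h - g 0 - h = ∑ i ∈ Finset.range h, (g (i + 1) - g i - c i) -
      ∑ i ∈ Finset.range h, (1 - c i) := by
    rw [← Finset.sum_range_sub g h, ← Finset.sum_sub_distrib]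
    have : (h:ℝ) = ∑ i ∈ Finset.range h, (1:ℝ) := by simp
    rw [this, ← Finset.sum_sub_distrib]
    exact Finset.sum_congr rfl fun i _ => by ring
  rw [key]
  have := abs_sub (∑ i ∈ Finset.range h, (g (i + 1) - g i - c i)) (∑ i ∈ Finset.range h, (1 - c i))
  linarith

/-- The average of a sequence over a window of length `t`. -/
def smooth (t : ℕ) (f : ℕ → ℝ) (h : ℕ) : ℝ := (∑ o ∈ Finset.range t, f (h + o)) / t

lemma smooth_succ_sub (t : ℕ) (f : ℕ → ℝ) (h : ℕ) :
    smooth t f (h + 1) - smooth t f h = (f (h + t) - f h) / t := by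
  rw [smooth, smooth, ← sub_div, ← Finset.sum_sub_distrib]
  congr 1
  have := Finset.sum_range_sub (fun o => f (h + o)) t
  simp only [add_zero] at this
  rw [← this]
  exact Finset.sum_congr rfl fun o _ => by ring_nf

lemma abs_smooth_sub_le {t : ℕ} (ht : 0 < t) {f : ℕ → ℝ} {A : ℝ}
    (hf : ∀ h m : ℕ, |f (h + m) - f h| ≤ m * A) (hA : 0 ≤ A) (h : ℕ) :
    |smooth t f h - f h| ≤ t * A := by
  have ht' : (0:ℝ) < t := by exact_mod_cast ht
  have e : smooth t f h - f h = (∑ o ∈ Finset.range t, (f (h + o) - f h)) / t := by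
    rw [smooth, Finset.sum_sub_distrib]; simp; field_simp
  rw [e, abs_div, abs_of_pos ht', div_le_iff₀ ht']
  refine (Finset.abs_sum_le_sum_abs _ _).trans ?_
  have : ∀ o ∈ Finset.range t, |f (h + o) - f h| ≤ t * A := fun o ho =>
    (hf h o).trans (mul_le_mul_of_nonneg_right
      (by exact_mod_cast (Finset.mem_range.1 ho).le) hA)
  refine (Finset.sum_le_sum this).trans ?_
  simp only [Finset.sum_const, Finset.card_range, nsmul_eq_mul]
  nlinarith

/-! ### Most lines of a tile are straight -/

namespace Tile

/-- The height along a vertical line of a tile. -/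
def line (T : Tile) (φ : Cell → Cell) (p : ℤ × ℤ) (h : ℕ) : ℝ := ht φ (T.gpt p.1 p.2 h)

/-- The vertical lines of a tile. -/
def lines (T : Tile) : Finset (ℤ × ℤ) := T.us ×ˢ T.vs

lemma card_lines (T : Tile) : (T.lines.card : ℝ) = 4 ^ T.n := by
  rw [lines, Finset.card_product, card_us, card_vs, ← mul_pow]; norm_num

lemma gpt_up (T : Tile) (u v h : ℤ) (m : ℤ) : (T.gpt u v h).up m = T.gpt u v (h + m) := by
  ext <;> simp [add_assoc]

lemma line_add (T : Tile) (φ : Cell → Cell) (p : ℤ × ℤ) (h m : ℕ) :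
    T.line φ p (h + m) = ht φ ((T.gpt p.1 p.2 h).up m) := by
  rw [line, gpt_up]; push_cast; rfl

lemma sum_lines_slp (T : Tile) (hn : 0 < T.n) (φ : Cell → Cell) (t : ℕ) :
    ∑ p ∈ T.lines, ∑ h ∈ Finset.range T.n,
      (smooth t (T.line φ p) (h + 1) - smooth t (T.line φ p) h) ^ 2 =
      4 ^ T.n * T.n * T.avg (fun w => slp φ t w ^ 2) := by
  classical
  have hn' : (T.n:ℝ) ≠ 0 := by exact_mod_cast hn.ne'
  rw [avg, mul_div_cancel₀ _ (by positivity), pts, Finset.sum_image (T.ipt_injective.injOn), idx,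
    lines, Finset.sum_product, Finset.sum_product]
  refine Finset.sum_congr rfl fun u _ => ?_
  rw [Finset.sum_product]
  refine Finset.sum_congr rfl fun v _ => Finset.sum_congr rfl fun h _ => ?_
  rw [smooth_succ_sub, line_add]
  rfl

end Tile

section
variable {A : ℕ} {φ ψ : Cell → Cell} (H : CQI A φ ψ)
include H

lemma CQI.abs_line_sub_le (T : Tile) (p : ℤ × ℤ) (h m : ℕ) :
    |T.line φ p (h + m) - T.line φ p h| ≤ m * A := by
  rw [T.line_add]; exact H.ht_up_real _ m

/-- Most lines of a large tile have an image of large vertical extent. -/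
lemma CQI.lines_range {ε : ℝ} (hε : 0 < ε) : ∃ n₀ : ℕ, ∀ T : Tile, n₀ ≤ T.n →
    ∀ B ⊆ T.lines, (∀ p ∈ B, ∀ h ≤ T.n, ∀ h' ≤ T.n,
      T.line φ p h - T.line φ p h' ≤ (1 - ε) * T.n) → (B.card : ℝ) ≤ ε * 4 ^ T.n := by
  obtain ⟨n₀, hn₀⟩ := H.range_bound hε
  refine ⟨n₀, fun T hT B hB hbad => ?_⟩
  classical
  have hfib : ∀ u ∈ T.us, ((B.filter (fun p => p.1 = u)).card : ℝ) ≤ ε * 2 ^ T.n := by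
    intro u _
    have h2 : (2:ℝ) ^ T.n ≠ 0 := by positivity
    have hm : ∀ p ∈ B, T.b * 2 ^ T.n ≤ p.2 ∧ p.2 < (T.b + 1) * 2 ^ T.n := fun p hp => by
      have := (Finset.mem_product.1 (hB hp)).2
      rwa [Tile.vs, Finset.mem_Ico] at this
    set g : ℤ × ℤ → ℕ := fun p => (p.2 - T.b * 2 ^ T.n).toNat with hg
    have hgc : ∀ p ∈ B, ((g p : ℕ) : ℤ) = p.2 - T.b * 2 ^ T.n := fun p hp => by
      have := hm p hp; simp only [hg]; omega
    have := hn₀ T.n hT (T.gpt u (T.b * 2 ^ T.n) 0) ((B.filter (fun p => p.1 = u)).image g) ?_ ?_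
    · rwa [Finset.card_image_of_injOn] at this
      intro p hp q hq e
      simp only [Finset.coe_filter, Set.mem_ofPred_eq] at hp hq
      have e1 := hgc p hp.1
      have e2 := hgc q hq.1
      rw [show g p = g q from e] at e1
      exact Prod.ext (hp.2.trans hq.2.symm) (by linarith)
    · intro i hi
      obtain ⟨p, hp, rfl⟩ := Finset.mem_image.1 hi
      have e1 := hgc p (Finset.mem_filter.1 hp).1
      have e2 := hm p (Finset.mem_filter.1 hp).1
      rw [Finset.mem_range]
      have : ((g p : ℕ) : ℤ) < 2 ^ T.n := by rw [e1]; linarith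
      exact_mod_cast this
    · intro i hi h hh h' hh'
      obtain ⟨p, hp, rfl⟩ := Finset.mem_image.1 hi
      obtain ⟨hpB, rfl⟩ := Finset.mem_filter.1 hp
      have e1 : ((g p : ℕ) : ℝ) = p.2 - T.b * 2 ^ T.n := by exact_mod_cast hgc p hpB
      have key : ∀ h : ℕ, ((T.gpt p.1 (T.b * 2 ^ T.n) 0).ys (g p / 2 ^ T.n)).up (h:ℕ) =
          T.gpt p.1 p.2 h := by
        intro h
        ext
        · simp
        · simp only [Pt.up_y, Pt.ys_y, Tile.gpt_y, Tile.gpt_k, e1, neg_add, two_zpow_add, add_zero]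
          rw [zpow_neg 2 (T.n : ℤ), zpow_natCast]
          push_cast
          field_simp
          ring
        · simp
      rw [key, key]
      exact hbad p hpB h hh h' hh'
  have hc : B.card = ∑ u ∈ T.us, (B.filter (fun p => p.1 = u)).card :=
    Finset.card_eq_sum_card_fiberwise fun p hp => (Finset.mem_product.1 (hB hp)).1
  rw [hc]; push_cast
  refine (Finset.sum_le_sum hfib).trans ?_
  rw [Finset.sum_const, T.card_us, nsmul_eq_mul, show (4:ℝ) = 2 * 2 by norm_num, mul_pow]
  push_cast
  exact le_of_eq (by ring)

/-- Most lines of a large tile are straight. -/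
lemma CQI.lines_straight {κ θ : ℝ} (hκ : 0 < κ) (hκ1 : κ ≤ 1) (hθ : 0 < θ) : ∃ n₀ : ℕ, ∀ T : Tile, n₀ ≤ T.n →
    ∃ B ⊆ T.lines, (B.card : ℝ) ≤ θ * 4 ^ T.n ∧ ∀ p ∈ T.lines, p ∉ B →
      ∃ σ : ℤ, (σ = 1 ∨ σ = -1) ∧ ∀ h ≤ T.n,
        |T.line φ p h - T.line φ p 0 - σ * h| ≤ κ * T.n := by
  classical
  set c := κ / 4 with hc
  have hc0 : 0 < c := by positivity
  set ρ := θ * c ^ 2 / 7 with hρ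
  have hρ0 : 0 < ρ := by positivity
  obtain ⟨j, n₁, hn₁⟩ := H.avg_sq_le hρ0
  obtain ⟨n₂, hn₂⟩ := H.lines_range hρ0
  set t := 2 ^ j with ht
  have ht0 : 0 < t := by positivity
  obtain ⟨n₃, hn₃⟩ := exists_nat_ge (2 * t * A / (min ρ (κ / 2)))
  refine ⟨n₁ + n₂ + n₃ + 1, fun T hT => ?_⟩
  have hTn : (0:ℝ) < T.n := by exact_mod_cast (by omega : 0 < T.n)
  have h3 : 2 * t * A ≤ min ρ (κ / 2) * T.n := by
    rw [div_le_iff₀ (by positivity)] at hn₃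
    have : (n₃:ℝ) ≤ T.n := by exact_mod_cast (by omega : n₃ ≤ T.n)
    have := mul_le_mul_of_nonneg_left this (by positivity : 0 ≤ min ρ (κ / 2))
    linarith
  have h3a : 2 * t * A ≤ ρ * T.n := h3.trans (by gcongr; exact min_le_left _ _)
  have h3b : 2 * t * A ≤ κ / 2 * T.n := h3.trans (by gcongr; exact min_le_right _ _)
  have hsm : ∀ p h, |smooth t (T.line φ p) h - T.line φ p h| ≤ t * A := fun p h =>
    abs_smooth_sub_le ht0 (H.abs_line_sub_le T p) (by positivity) h
  set E : ℤ × ℤ → ℝ := fun p => ∑ h ∈ Finset.range T.n,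
      (smooth t (T.line φ p) (h + 1) - smooth t (T.line φ p) h) ^ 2 with hE
  have hE0 : ∀ p, 0 ≤ E p := fun p => Finset.sum_nonneg fun _ _ => sq_nonneg _
  have hEsum : ∑ p ∈ T.lines, E p ≤ 4 ^ T.n * T.n * (1 + ρ) := by
    rw [hE, T.sum_lines_slp (by omega)]
    exact mul_le_mul_of_nonneg_left (hn₁ T (by omega)) (by positivity)
  set B₁ := T.lines.filter (fun p => ∀ h ≤ T.n, ∀ h' ≤ T.n,
      T.line φ p h - T.line φ p h' ≤ (1 - ρ) * T.n) with hB₁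
  have hB₁c : (B₁.card:ℝ) ≤ ρ * 4 ^ T.n :=
    hn₂ T (by omega) B₁ (Finset.filter_subset _ _) fun p hp => (Finset.mem_filter.1 hp).2
  set R := T.lines \ B₁ with hR
  have hRc : (1 - ρ) * 4 ^ T.n ≤ (R.card:ℝ) := by
    have := Finset.card_sdiff_add_card_eq_card (Finset.filter_subset _ _ : B₁ ⊆ T.lines)
    have e : (R.card:ℝ) + B₁.card = 4 ^ T.n := by rw [← T.card_lines]; exact_mod_cast this
    linarith
  have hrange : ∀ p ∈ R, ∃ h ≤ T.n, ∃ h' ≤ T.n, (1 - 2 * ρ) * T.n <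
      smooth t (T.line φ p) h - smooth t (T.line φ p) h' := by
    intro p hp
    obtain ⟨hp1, hp2⟩ := Finset.mem_sdiff.1 hp
    simp only [hB₁, Finset.mem_filter, hp1, true_and, not_forall, not_le] at hp2
    obtain ⟨h, hh, h', hh', hlt⟩ := hp2
    refine ⟨h, hh, h', hh', ?_⟩
    have a1 := abs_le.1 (hsm p h)
    have a2 := abs_le.1 (hsm p h')
    linarith
  have neg_sq : ∀ p, ∑ h ∈ Finset.range T.n,
      (-smooth t (T.line φ p) (h + 1) - -smooth t (T.line φ p) h) ^ 2 = E p := fun p =>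
    Finset.sum_congr rfl fun h _ => by ring
  have hElow : ∀ p ∈ R, (1 - 4 * ρ) * T.n ≤ E p := by
    intro p hp
    obtain ⟨h, hh, h', hh', hlt⟩ := hrange p hp
    rcases le_total h' h with hle | hle
    · have := two_mul_sub_le_sum_sq (smooth t (T.line φ p)) hle hh
      linarith
    · have := two_mul_sub_le_sum_sq (fun h => -smooth t (T.line φ p) h) hle hh'
      rw [neg_sq] at this
      linarith
  set B₂ := R.filter (fun p => (1 - 4 * ρ + c ^ 2) * T.n < E p) with hB₂
  have hB₂c : (B₂.card:ℝ) * c ^ 2 ≤ 6 * ρ * 4 ^ T.n := by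
    have l1 : ∑ p ∈ R, (E p - (1 - 4 * ρ) * T.n) ≤
        4 ^ T.n * T.n * (1 + ρ) - (R.card:ℝ) * ((1 - 4 * ρ) * T.n) := by
      rw [Finset.sum_sub_distrib, Finset.sum_const, nsmul_eq_mul]
      have := Finset.sum_le_sum_of_subset_of_nonneg (Finset.sdiff_subset : R ⊆ T.lines)
        (f := E) fun p _ _ => hE0 p
      linarith
    have l2 : (B₂.card:ℝ) * (c ^ 2 * T.n) ≤ ∑ p ∈ R, (E p - (1 - 4 * ρ) * T.n) := by
      refine le_trans ?_ (Finset.sum_le_sum_of_subset_of_nonneg (Finset.filter_subset _ _ : B₂ ⊆ R)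
        fun p hp _ => by linarith [hElow p hp])
      rw [← nsmul_eq_mul]
      refine Finset.card_nsmul_le_sum _ _ _ fun p hp => ?_
      have := (Finset.mem_filter.1 hp).2
      linarith
    have hRle : (R.card:ℝ) ≤ 4 ^ T.n := by
      rw [← T.card_lines]; exact_mod_cast Finset.card_le_card Finset.sdiff_subset
    have h4 : (0:ℝ) < 4 ^ T.n := by positivity
    have l3 : (B₂.card:ℝ) * (c ^ 2 * T.n) ≤ 6 * ρ * 4 ^ T.n * T.n := by
      have : (1 - 5 * ρ) * 4 ^ T.n * T.n ≤ (R.card:ℝ) * ((1 - 4 * ρ) * T.n) := by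
        nlinarith [mul_le_mul_of_nonneg_right hRc hTn.le, mul_le_mul_of_nonneg_right hRle hTn.le, mul_pos (mul_pos h4 hTn) hρ0]
      linarith
    have := (mul_le_mul_iff_left₀ hTn).1 (by linarith : (B₂.card:ℝ) * c ^ 2 * T.n ≤ 6 * ρ * 4 ^ T.n * T.n)
    exact this
  refine ⟨B₁ ∪ B₂, Finset.union_subset (Finset.filter_subset _ _)
    ((Finset.filter_subset _ _).trans Finset.sdiff_subset), ?_, fun p hp hpB => ?_⟩
  · have h4 : (0:ℝ) < 4 ^ T.n := by positivity
    have : ((B₁ ∪ B₂).card:ℝ) ≤ B₁.card + B₂.card := by exact_mod_cast Finset.card_union_le _ _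
    have e1 : (B₂.card:ℝ) ≤ 6 / 7 * θ * 4 ^ T.n := by
      have e : 6 * ρ * 4 ^ T.n = 6 / 7 * θ * 4 ^ T.n * c ^ 2 := by rw [hρ]; ring
      rw [e] at hB₂c
      exact (mul_le_mul_iff_left₀ (by positivity : 0 < c ^ 2)).1 hB₂c
    have e2 : ρ ≤ θ / 7 := by
      rw [hρ]
      have : c ^ 2 ≤ 1 := pow_le_one₀ hc0.le (by linarith)
      nlinarith
    nlinarith [mul_le_mul_of_nonneg_right e2 h4.le]
  · simp only [Finset.mem_union, not_or] at hpB
    have hcn : 2 * c * T.n = κ / 2 * T.n := by rw [hc]; ring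
    have hpR : p ∈ R := Finset.mem_sdiff.2 ⟨hp, hpB.1⟩
    have hEup : E p ≤ (1 - 4 * ρ + c ^ 2) * T.n := by
      by_contra hcon
      exact hpB.2 (Finset.mem_filter.2 ⟨hpR, not_le.1 hcon⟩)
    obtain ⟨h₁, hh₁, h₂, hh₂, hlt⟩ := hrange p hpR
    rcases le_total h₂ h₁ with hle | hle
    · refine ⟨1, Or.inl rfl, fun h hh => ?_⟩
      have := abs_le.1 (straight_of_sum_sq (smooth t (T.line φ p)) hc0.le hle hh₁
        (by linarith) hh)
      have a1 := abs_le.1 (hsm p h)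
      have a2 := abs_le.1 (hsm p 0)
      rw [abs_le]; push_cast
      constructor <;> linarith
    · refine ⟨-1, Or.inr rfl, fun h hh => ?_⟩
      have := abs_le.1 (straight_of_sum_sq (fun h => -smooth t (T.line φ p) h) hc0.le hle hh₂
        (by rw [neg_sq]; linarith) hh)
      have a1 := abs_le.1 (hsm p h)
      have a2 := abs_le.1 (hsm p 0)
      rw [abs_le]; push_cast
      constructor <;> linarith

end

/-! ### Pinching: families of lines which cannot coexist -/

namespace Tile

/-- The tile with the two horizontal directions exchanged. -/
def flip (T : Tile) : Tile := ⟨T.b, T.a, -(T.k₀ + T.n), T.n⟩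

@[simp] lemma flip_n (T : Tile) : T.flip.n = T.n := rfl

lemma flip_gpt (T : Tile) (u v h : ℤ) : T.flip.gpt v u h = (T.gpt u v (T.n - h)).flip := by
  ext
  · rfl
  · simp [flip]
  · simp [flip]; ring

lemma flip_line (T : Tile) (φ : Cell → Cell) (u v : ℤ) {h : ℕ} (hh : h ≤ T.n) :
    T.flip.line (fun s => φ s.flip) (v, u) h = T.line φ (u, v) (T.n - h) := by
  simp only [line, flip_gpt, ht, Pt.flip_cell, Cell.flip_flip]
  push_cast [hh]; rfl

lemma mem_lines (T : Tile) {u v : ℤ} : (u, v) ∈ T.lines ↔ u ∈ T.us ∧ v ∈ T.vs :=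
  Finset.mem_product

lemma ediv_us (T : Tile) {u : ℤ} (hu : u ∈ T.us) : u / 2 ^ T.n = T.a := by
  rw [us, Finset.mem_Ico] at hu
  rw [Int.ediv_eq_iff_of_pos (by positivity)]
  constructor <;> linarith

lemma ediv_vs (T : Tile) {v : ℤ} (hv : v ∈ T.vs) : v / 2 ^ T.n = T.b := T.flip.ediv_us hv

lemma cell_bot (T : Tile) (u : ℤ) {v : ℤ} (hv : v ∈ T.vs) :
    (T.gpt u v 0).cell = ⟨u, T.b, T.k₀⟩ := by
  have := T.gpt_cell u v (Nat.zero_le _)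
  simpa [T.ediv_vs hv] using this

lemma cell_top (T : Tile) {u : ℤ} (v : ℤ) (hu : u ∈ T.us) :
    (T.gpt u v T.n).cell = ⟨T.a, v, T.k₀ + T.n⟩ := by
  have := T.gpt_cell u v le_rfl
  simpa [T.ediv_us hu] using this

lemma line_bot (T : Tile) (φ : Cell → Cell) (u : ℤ) {v v' : ℤ} (hv : v ∈ T.vs) (hv' : v' ∈ T.vs) :
    T.line φ (u, v) 0 = T.line φ (u, v') 0 := by
  have := T.cell_bot u hv
  have := T.cell_bot u hv'
  simp_all [line, ht]

lemma line_top (T : Tile) (φ : Cell → Cell) {u u' : ℤ} (v : ℤ) (hu : u ∈ T.us) (hu' : u' ∈ T.us) :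
    T.line φ (u, v) T.n = T.line φ (u', v) T.n := by
  have := T.cell_top v hu
  have := T.cell_top v hu'
  simp_all [line, ht]

end Tile

section
variable {A : ℕ} {φ ψ : Cell → Cell} (H : CQI A φ ψ)
include H

lemma CQI.line_img_x (T : Tile) (u v : ℤ) (m d : ℕ) {α : ℤ}
    (h : ∀ i, m ≤ i → i < m + d → T.line φ (u, v) i ≤ α) :
    |(img φ (T.gpt u v (m + d : ℕ))).x - (img φ (T.gpt u v m)).x| ≤ d * 2 ^ (α + A) := by
  have := H.vert_x (T.gpt u v m) d (α := α) fun i hi => by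
    have := h (m + i) (by omega) (by omega)
    rw [T.line_add] at this
    exact_mod_cast this
  rw [T.gpt_up] at this
  exact_mod_cast this

lemma CQI.line_img_y (T : Tile) (u v : ℤ) (m d : ℕ) {β : ℤ}
    (h : ∀ i, m ≤ i → i < m + d → (β:ℝ) ≤ T.line φ (u, v) i) :
    |(img φ (T.gpt u v (m + d : ℕ))).y - (img φ (T.gpt u v m)).y| ≤ d * 2 ^ (-β + A) := by
  have := H.vert_y (T.gpt u v m) d (β := β) fun i hi => by
    have := h (m + i) (by omega) (by omega)
    rw [T.line_add] at this
    exact_mod_cast this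
  rw [T.gpt_up] at this
  exact_mod_cast this

/-- Few bottom cells of a tile are joined to fixed top cells both by low and by high lines. -/
lemma CQI.pinch_bot {ε : ℝ} (hε : 0 < ε) : ∃ n₀ : ℕ, ∀ T : Tile, n₀ ≤ T.n → ∀ v ∈ T.vs, ∀ v' ∈ T.vs,
    ∀ U ⊆ T.us, ∀ α β : ℝ, α - β ≤ (1 - ε) * T.n → (∀ u ∈ U, ∀ h ≤ T.n,
      β ≤ T.line φ (u, v) h ∧ T.line φ (u, v') h ≤ α) → 2 * (U.card : ℝ) < 2 ^ T.n := by
  classical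
  obtain ⟨n₀, hn₀⟩ := H.count_small (A + 1) hε (ε' := 1 / 4) (by norm_num)
  refine ⟨n₀, fun T hT v hv v' hv' U hU α β hαβ hline => ?_⟩
  by_contra! hcon
  have hinj : Set.InjOn (fun u : ℤ => (⟨u, T.b, T.k₀⟩ : Cell)) U := fun u _ u' _ e =>
    (Cell.ext_iff.1 e).1
  have hUne : U.Nonempty := by
    rw [← Finset.card_pos]
    have : (0:ℝ) < 2 ^ T.n := by positivity
    exact_mod_cast (by linarith : (0:ℝ) < U.card)
  obtain ⟨u₀, hu₀⟩ := hUne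
  have htop : ∀ u ∈ U, ∀ w, img φ (T.gpt u w T.n) = img φ (T.gpt u₀ w T.n) := fun u hu w => by
    simp only [img, T.cell_top w (hU hu), T.cell_top w (hU hu₀)]
  have hpow : ∀ m : ℤ, (T.n:ℝ) * 2 ^ (m + (A:ℤ)) ≤ ((A + 1 : ℕ):ℝ) * (T.n + 1) * 2 ^ (m + (A + 1 : ℕ)) := by
    intro m
    have h2 : (2:ℝ) ^ (m + (A:ℤ)) ≤ 2 ^ (m + (A + 1 : ℕ)) := two_zpow_le (by push_cast; linarith)
    push_cast at *
    have : (T.n:ℝ) ≤ (A + 1) * (T.n + 1) := by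
      nlinarith [A.cast_nonneg (α := ℝ), T.n.cast_nonneg (α := ℝ)]
    exact mul_le_mul this h2 (by positivity) (by positivity)
  have := hn₀ T.n hT (U.image fun u => ⟨u, T.b, T.k₀⟩) (img φ (T.gpt u₀ v' T.n)).x
    (img φ (T.gpt u₀ v T.n)).y ⌊α⌋ ⌈β⌉ ?_ ?_
  · rw [Finset.card_image_of_injOn hinj] at this
    have hn : (0:ℝ) ≤ T.n := by positivity
    have h2 : (0:ℝ) < 2 ^ T.n := by positivity
    nlinarith
  · push_cast
    linarith [Int.floor_le α, Int.le_ceil β]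
  · intro s hs
    obtain ⟨u, hu, rfl⟩ := Finset.mem_image.1 hs
    have e1 : (φ ⟨u, T.b, T.k₀⟩).corner = img φ (T.gpt u v' 0) := by rw [img, T.cell_bot u hv']
    have e2 : (φ ⟨u, T.b, T.k₀⟩).corner = img φ (T.gpt u v 0) := by rw [img, T.cell_bot u hv]
    have k1 : (φ ⟨u, T.b, T.k₀⟩).k = ht φ (T.gpt u v' 0) := by rw [ht, T.cell_bot u hv']
    have k2 : (φ ⟨u, T.b, T.k₀⟩).k = ht φ (T.gpt u v 0) := by rw [ht, T.cell_bot u hv]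
    have x1 := H.line_img_x T u v' 0 T.n (α := ⌊α⌋) fun i _ hi => by
      have := (hline u hu i (by omega)).2
      rw [Tile.line] at this ⊢
      exact_mod_cast Int.le_floor.2 this
    have y1 := H.line_img_y T u v 0 T.n (β := ⌈β⌉) fun i _ hi => by
      have := (hline u hu i (by omega)).1
      rw [Tile.line] at this ⊢
      exact_mod_cast Int.ceil_le.2 this
    rw [zero_add, htop u hu, abs_sub_comm] at x1 y1
    refine ⟨?_, ?_, ?_, ?_⟩
    · rw [e1]; exact x1.trans (hpow _)
    · rw [e2]; exact y1.trans (hpow _)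
    · rw [k2]; exact Int.ceil_le.2 (hline u hu 0 (Nat.zero_le _)).1
    · rw [k1]; exact Int.le_floor.2 (hline u hu 0 (Nat.zero_le _)).2

/-- Few top cells of a tile are joined to fixed bottom cells both by low and by high lines. -/
lemma CQI.pinch_top {ε : ℝ} (hε : 0 < ε) : ∃ n₀ : ℕ, ∀ T : Tile, n₀ ≤ T.n → ∀ u ∈ T.us, ∀ u' ∈ T.us,
    ∀ V ⊆ T.vs, ∀ α β : ℝ, α - β ≤ (1 - ε) * T.n → (∀ v ∈ V, ∀ h ≤ T.n,
      β ≤ T.line φ (u, v) h ∧ T.line φ (u', v) h ≤ α) → 2 * (V.card : ℝ) < 2 ^ T.n := by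
  obtain ⟨n₀, hn₀⟩ := H.flip_source.pinch_bot hε
  refine ⟨n₀, fun T hT u hu u' hu' V hV α β hαβ hline =>
    hn₀ T.flip hT u hu u' hu' V hV α β hαβ fun v hv h hh => ?_⟩
  rw [T.flip_line φ u v hh, T.flip_line φ u' v hh]
  exact hline v hv (T.n - h) (Nat.sub_le _ _)

end

/-! ### Signs -/

/-- A line whose image is coarsely vertical, with slope `σ`. -/
def Tile.Straight (T : Tile) (φ : Cell → Cell) (κ : ℝ) (p : ℤ × ℤ) (σ : ℤ) : Prop :=
  (σ = 1 ∨ σ = -1) ∧ ∀ h ≤ T.n, |T.line φ p h - T.line φ p 0 - σ * h| ≤ κ * T.n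

lemma Tile.Straight.flip {T : Tile} {φ : Cell → Cell} {κ : ℝ} {u v σ : ℤ}
    (h : T.Straight φ κ (u, v) σ) :
    T.flip.Straight (fun s => φ s.flip) (2 * κ) (v, u) (-σ) := by
  refine ⟨by rcases h.1 with h | h <;> simp [h], fun i hi => ?_⟩
  rw [T.flip_line φ u v hi, T.flip_line φ u v (Nat.zero_le _)]
  have h1 := abs_le.1 (h.2 (T.n - i) (Nat.sub_le _ _))
  have h2 := abs_le.1 (h.2 T.n le_rfl)
  rw [Nat.cast_sub (show i ≤ T.n from hi)] at h1
  rw [abs_le, T.flip_n]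
  push_cast
  simp only [Nat.sub_zero]
  constructor <;> linarith

section
variable {A : ℕ} {φ ψ : Cell → Cell} (H : CQI A φ ψ)
include H

omit H in
lemma two_pow_le_two_mul_card {S : Finset ℤ} {n : ℕ} {P Q : ℤ → Prop} [DecidablePred P] [DecidablePred Q]
    (hS : S.card = 2 ^ n) (hP : 8 * ((S.filter P).card : ℝ) ≤ 2 ^ n)
    (hQ : 8 * ((S.filter Q).card : ℝ) ≤ 2 ^ n) :
    (2:ℝ) ^ n ≤ 2 * ((S.filter (fun u => ¬ P u ∧ ¬ Q u)).card : ℝ) := by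
  have h1 : S.filter (fun u => ¬ P u ∧ ¬ Q u) = S \ (S.filter P ∪ S.filter Q) := by
    ext u; simp; tauto
  have h2 := Finset.le_card_sdiff (S.filter P ∪ S.filter Q) S
  have h3 := Finset.card_union_le (S.filter P) (S.filter Q)
  rw [← h1] at h2
  have h4 : S.card ≤ (S.filter (fun u => ¬ P u ∧ ¬ Q u)).card + ((S.filter P).card + (S.filter Q).card) := by omega
  rw [hS] at h4
  have h5 : (2:ℝ) ^ n ≤ ((S.filter (fun u => ¬ P u ∧ ¬ Q u)).card : ℝ) + ((S.filter P).card + (S.filter Q).card) := by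
    exact_mod_cast h4
  linarith [pow_pos (two_pos : (0:ℝ) < 2) n]

open Classical in
/-- Two lines with the same bottom and typical tops have slopes of the same sign. -/
lemma CQI.sign_eq_bot : ∃ n₀ : ℕ, ∀ T : Tile, n₀ ≤ T.n → ∀ κ : ℝ, κ ≤ 1 / 32 →
    ∀ (P : ℤ × ℤ → Prop) (σ : ℤ × ℤ → ℤ), (∀ p ∈ T.lines, ¬ P p → T.Straight φ κ p (σ p)) →
    ∀ v ∈ T.vs, ∀ v' ∈ T.vs, 8 * ((T.us.filter (fun u => P (u, v))).card : ℝ) ≤ 2 ^ T.n →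
    8 * ((T.us.filter (fun u => P (u, v'))).card : ℝ) ≤ 2 ^ T.n →
    ∀ u ∈ T.us, ¬ P (u, v) → ¬ P (u, v') → σ (u, v) = σ (u, v') := by
  obtain ⟨n₀, hn₀⟩ := H.pinch_bot (ε := 1 / 2) (by norm_num)
  have main : ∀ T : Tile, n₀ + 1 ≤ T.n → ∀ κ : ℝ, κ ≤ 1 / 32 →
      ∀ (P : ℤ × ℤ → Prop) (σ : ℤ × ℤ → ℤ), (∀ p ∈ T.lines, ¬ P p → T.Straight φ κ p (σ p)) →
      ∀ v ∈ T.vs, ∀ v' ∈ T.vs, 8 * ((T.us.filter (fun u => P (u, v))).card : ℝ) ≤ 2 ^ T.n →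
      8 * ((T.us.filter (fun u => P (u, v'))).card : ℝ) ≤ 2 ^ T.n →
      ∀ u ∈ T.us, ¬ P (u, v) → ¬ P (u, v') → σ (u, v) = 1 → σ (u, v') = -1 → False := by
    intro T hT κ hκ P σ hP v hv v' hv' hcv hcv' u₀ hu₀ hu₀v hu₀v' hs hs'
    have hTn : (0:ℝ) < T.n := by exact_mod_cast (by omega : 0 < T.n)
    have hκn := mul_le_mul_of_nonneg_right hκ hTn.le
    have hc := two_pow_le_two_mul_card T.card_us hcv hcv'
    refine absurd (hn₀ T (by omega) v hv v' hv' _ (Finset.filter_subset _ _)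
      (T.line φ (u₀, v) 0 + T.n / 8) (T.line φ (u₀, v) 0 - T.n / 8) (by linarith) ?_) (not_lt.2 hc)
    intro u hu h hh
    obtain ⟨hu, huv, huv'⟩ := Finset.mem_filter.1 hu
    have g1 := hP _ (T.mem_lines.2 ⟨hu₀, hv⟩) hu₀v
    have g2 := hP _ (T.mem_lines.2 ⟨hu₀, hv'⟩) hu₀v'
    have g3 := hP _ (T.mem_lines.2 ⟨hu, hv⟩) huv
    have g4 := hP _ (T.mem_lines.2 ⟨hu, hv'⟩) huv'
    have t1 := abs_le.1 (g1.2 _ le_rfl)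
    have t2 := abs_le.1 (g2.2 _ le_rfl)
    have t3 := abs_le.1 (g3.2 _ le_rfl)
    have t4 := abs_le.1 (g4.2 _ le_rfl)
    rw [hs] at t1
    rw [hs'] at t2
    rw [T.line_top φ v hu hu₀] at t3
    rw [T.line_top φ v' hu hu₀, ← T.line_bot φ u hv hv'] at t4
    rw [← T.line_bot φ u₀ hv hv'] at t2
    have s3 := abs_le.1 (g3.2 h hh)
    have s4 := abs_le.1 (g4.2 h hh)
    rw [← T.line_bot φ u hv hv'] at s4
    have hh' : (h:ℝ) ≤ T.n := by exact_mod_cast hh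
    have hh0 : (0:ℝ) ≤ h := by positivity
    rcases g3.1 with e3 | e3 <;> rcases g4.1 with e4 | e4 <;> rw [e3] at t3 s3 <;>
      rw [e4] at t4 s4 <;> push_cast at * <;> constructor <;> linarith
  refine ⟨n₀ + 1, fun T hT κ hκ P σ hP v hv v' hv' hcv hcv' u hu huv huv' => ?_⟩
  have g1 := (hP _ (T.mem_lines.2 ⟨hu, hv⟩) huv).1
  have g2 := (hP _ (T.mem_lines.2 ⟨hu, hv'⟩) huv').1
  rcases g1 with e1 | e1 <;> rcases g2 with e2 | e2
  · rw [e1, e2]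
  · exact (main T hT κ hκ P σ hP v hv v' hv' hcv hcv' u hu huv huv' e1 e2).elim
  · exact (main T hT κ hκ P σ hP v' hv' v hv hcv' hcv u hu huv' huv e2 e1).elim
  · rw [e1, e2]

open Classical in
/-- Two lines with the same top and typical bottoms have slopes of the same sign. -/
lemma CQI.sign_eq_top : ∃ n₀ : ℕ, ∀ T : Tile, n₀ ≤ T.n → ∀ κ : ℝ, κ ≤ 1 / 64 →
    ∀ (P : ℤ × ℤ → Prop) (σ : ℤ × ℤ → ℤ), (∀ p ∈ T.lines, ¬ P p → T.Straight φ κ p (σ p)) →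
    ∀ u ∈ T.us, ∀ u' ∈ T.us, 8 * ((T.vs.filter (fun v => P (u, v))).card : ℝ) ≤ 2 ^ T.n →
    8 * ((T.vs.filter (fun v => P (u', v))).card : ℝ) ≤ 2 ^ T.n →
    ∀ v ∈ T.vs, ¬ P (u, v) → ¬ P (u', v) → σ (u, v) = σ (u', v) := by
  obtain ⟨n₀, hn₀⟩ := H.flip_source.sign_eq_bot
  refine ⟨n₀, fun T hT κ hκ P σ hP u hu u' hu' hcu hcu' v hv hv1 hv2 => ?_⟩
  have := hn₀ T.flip hT (2 * κ) (by linarith) (fun p => P p.swap) (fun p => -σ p.swap) ?_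
    u hu u' hu' hcu hcu' v hv hv1 hv2
  · simpa using this
  · rintro ⟨v, u⟩ hp hPp
    exact (hP (u, v) (T.mem_lines.2 (T.flip.mem_lines.1 hp).symm) hPp).flip

end

/-! ### Alignment of most lines of a tile -/

/-- Most lines of the tile have an image close to a common vertical line. -/
def Tile.Aligned (T : Tile) (φ : Cell → Cell) (κ : ℝ) (H σ : ℤ) : Prop :=
  (σ = 1 ∨ σ = -1) ∧ ∃ B ⊆ T.lines, 64 * (B.card : ℝ) ≤ 4 ^ T.n ∧
    ∀ p ∈ T.lines, p ∉ B → ∀ h ≤ T.n, |T.line φ p h - H - σ * h| ≤ κ * T.n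

open Classical in
lemma Tile.card_untypical_us (T : Tile) {B : Finset (ℤ × ℤ)} {θ : ℝ}
    (hc : B.card ≤ θ * 4 ^ T.n) :
    ((T.us.filter (fun u => 2 ^ T.n < 8 * ((T.vs.filter (fun v => (u, v) ∈ B)).card : ℝ))).card : ℝ) ≤
      8 * θ * 2 ^ T.n := by
  set W := T.us.filter (fun u => 2 ^ T.n < 8 * ((T.vs.filter (fun v => (u, v) ∈ B)).card : ℝ)) with hW
  have h1 : ∑ u ∈ W, (T.vs.filter (fun v => (u, v) ∈ B)).card ≤ B.card := by
    rw [← Finset.card_sigma]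
    refine Finset.card_le_card_of_injOn (fun x => (x.1, x.2)) ?_ ?_
    · rintro ⟨u, v⟩ hx
      simp at hx
      exact hx.2.2
    · rintro ⟨u, v⟩ _ ⟨u', v'⟩ _ e
      simp at e
      simp [e]
  have h2 : (W.card : ℝ) * 2 ^ T.n ≤ 8 * B.card := by
    have : (W.card : ℝ) * 2 ^ T.n ≤ ∑ u ∈ W, 8 * ((T.vs.filter (fun v => (u, v) ∈ B)).card : ℝ) := by
      rw [← nsmul_eq_mul]
      exact Finset.card_nsmul_le_sum _ _ _ fun u hu => (Finset.mem_filter.1 hu).2.le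
    rw [← Finset.mul_sum] at this
    have h1' : ∑ u ∈ W, ((T.vs.filter (fun v => (u, v) ∈ B)).card : ℝ) ≤ B.card := by exact_mod_cast h1
    linarith
  have h4 : (4:ℝ) ^ T.n = 2 ^ T.n * 2 ^ T.n := by rw [← mul_pow]; norm_num
  have h5 : (0:ℝ) < 2 ^ T.n := by positivity
  rw [h4] at hc
  have : (W.card : ℝ) * 2 ^ T.n ≤ 8 * θ * 2 ^ T.n * 2 ^ T.n := by linarith
  exact (mul_le_mul_iff_left₀ h5).1 this

lemma Tile.flip_lines (T : Tile) : T.flip.lines = T.lines.map (Equiv.prodComm ℤ ℤ).toEmbedding := by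
  ext ⟨v, u⟩
  simp only [mem_lines, Finset.mem_map_equiv]
  change _ ↔ (u, v) ∈ T.lines
  rw [mem_lines]
  exact and_comm

lemma Tile.Aligned.flip {T : Tile} {φ : Cell → Cell} {κ : ℝ} {H σ : ℤ} (h : T.Aligned φ κ H σ) :
    T.flip.Aligned (fun s => φ s.flip) κ (H + σ * T.n) (-σ) := by
  obtain ⟨hs, B, hB, hc, hl⟩ := h
  refine ⟨by rcases hs with h | h <;> simp [h], B.map (Equiv.prodComm ℤ ℤ).toEmbedding, ?_,
    by simpa using hc, ?_⟩
  · rw [T.flip_lines]; exact Finset.map_subset_map.2 hB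
  · rintro ⟨v, u⟩ hp hpB i hi
    have hp' : (u, v) ∈ T.lines := T.mem_lines.2 (T.flip.mem_lines.1 hp).symm
    have hpB' : (u, v) ∉ B := fun h => hpB (Finset.mem_map_equiv.2 h)
    rw [T.flip_line φ u v hi]
    have := hl _ hp' hpB' (T.n - i) (Nat.sub_le _ _)
    rw [Nat.cast_sub (show i ≤ T.n from hi)] at this
    rw [T.flip_n]
    push_cast
    convert this using 2
    ring

lemma Tile.Aligned.flip_target {T : Tile} {φ : Cell → Cell} {κ : ℝ} {H σ : ℤ}
    (h : T.Aligned φ κ H σ) : T.Aligned (fun s => (φ s).flip) κ (-H) (-σ) := by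
  obtain ⟨hs, B, hB, hc, hl⟩ := h
  refine ⟨by rcases hs with h | h <;> simp [h], B, hB, hc, fun p hp hpB i hi => ?_⟩
  have := hl p hp hpB i hi
  rw [← abs_neg] at this
  convert this using 2
  simp only [line, ht, Cell.flip_k]
  push_cast
  ring

open Classical in
/-- An aligned tile has a column most of whose lines are aligned. -/
lemma Tile.exists_typical (T : Tile) {B : Finset (ℤ × ℤ)} (hc : 64 * (B.card : ℝ) ≤ 4 ^ T.n) :
    ∃ u ∈ T.us, 8 * ((T.vs.filter (fun v => (u, v) ∈ B)).card : ℝ) ≤ 2 ^ T.n := by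
  by_contra! hcon
  have := T.card_untypical_us (θ := 1 / 64) (by linarith : (B.card : ℝ) ≤ _)
  rw [Finset.filter_true_of_mem hcon, T.card_us] at this
  push_cast at this
  linarith [pow_pos (two_pos : (0:ℝ) < 2) T.n]

section
variable {A : ℕ} {φ ψ : Cell → Cell} (H : CQI A φ ψ)
include H

lemma CQI.aligned {κ : ℝ} (hκ : 0 < κ) (hκ1 : κ ≤ 1 / 64) : ∃ n₀ : ℕ, ∀ T : Tile, n₀ ≤ T.n →
    ∃ h σ : ℤ, T.Aligned φ κ h σ := by
  classical
  obtain ⟨n₁, hn₁⟩ := H.lines_straight (κ := κ / 5) (θ := 1 / 2048) (by positivity) (by linarith) (by norm_num)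
  obtain ⟨n₂, hn₂⟩ := H.sign_eq_bot
  obtain ⟨n₃, hn₃⟩ := H.sign_eq_top
  refine ⟨n₁ + n₂ + n₃, fun T hT => ?_⟩
  obtain ⟨B, hB, hBc, hBs⟩ := hn₁ T (by omega)
  have hex : ∀ p, ∃ σ : ℤ, p ∈ T.lines → p ∉ B → T.Straight φ (κ / 5) p σ := by
    intro p
    by_cases h : p ∈ T.lines ∧ p ∉ B
    · obtain ⟨σ, hσ⟩ := hBs p h.1 h.2
      exact ⟨σ, fun _ _ => hσ⟩
    · exact ⟨0, fun h1 h2 => (h ⟨h1, h2⟩).elim⟩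
  choose σ hσ using hex
  have bot := hn₂ T (by omega) (κ / 5) (by linarith) (fun p => p ∈ B) σ hσ
  have top := hn₃ T (by omega) (κ / 5) (by linarith) (fun p => p ∈ B) σ hσ
  have h2 : (0:ℝ) < 2 ^ T.n := by positivity
  have h4 : (4:ℝ) ^ T.n = 2 ^ T.n * 2 ^ T.n := by rw [← mul_pow]; norm_num
  set WU := T.us.filter (fun u => 2 ^ T.n < 8 * ((T.vs.filter (fun v => (u, v) ∈ B)).card : ℝ)) with hWU
  set WV := T.vs.filter (fun v => 2 ^ T.n < 8 * ((T.us.filter (fun u => (u, v) ∈ B)).card : ℝ)) with hWV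
  have hWUc : (WU.card : ℝ) ≤ 8 * (1 / 2048) * 2 ^ T.n := T.card_untypical_us hBc
  have hWVc : (WV.card : ℝ) ≤ 8 * (1 / 2048) * 2 ^ T.n := by
    have := T.flip.card_untypical_us (B := B.map (Equiv.prodComm ℤ ℤ).toEmbedding) (θ := 1 / 2048)
      (by simpa using hBc)
    simp only [Finset.mem_map_equiv] at this
    exact this
  have hUt : ∀ u ∈ T.us, u ∉ WU → 8 * ((T.vs.filter (fun v => (u, v) ∈ B)).card : ℝ) ≤ 2 ^ T.n := by
    intro u hu h
    by_contra hcon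
    exact h (Finset.mem_filter.2 ⟨hu, not_le.1 hcon⟩)
  have hVt : ∀ v ∈ T.vs, v ∉ WV → 8 * ((T.us.filter (fun u => (u, v) ∈ B)).card : ℝ) ≤ 2 ^ T.n := by
    intro v hv h
    by_contra hcon
    exact h (Finset.mem_filter.2 ⟨hv, not_le.1 hcon⟩)
  -- two typical columns have a common typical row
  have common : ∀ u ∈ T.us, u ∉ WU → ∀ u' ∈ T.us, u' ∉ WU →
      ∃ v ∈ T.vs, v ∉ WV ∧ (u, v) ∉ B ∧ (u', v) ∉ B := by
    intro u hu huW u' hu' huW'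
    by_contra! hcon
    have hsub : T.vs.filter (fun v => ¬ (u, v) ∈ B ∧ ¬ (u', v) ∈ B) ⊆ WV := by
      intro v hv
      obtain ⟨hv, h1, h2⟩ := Finset.mem_filter.1 hv
      by_contra hvW
      exact h2 (hcon v hv hvW h1)
    have hc : (_ : ℝ) ≤ _ := Nat.cast_le.2 (Finset.card_le_card hsub)
    have := two_pow_le_two_mul_card T.card_vs (hUt u hu huW) (hUt u' hu' huW')
    linarith
  obtain ⟨u₀, hu₀, hu₀W⟩ : ∃ u₀ ∈ T.us, u₀ ∉ WU := by
    by_contra! hcon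
    have hc : (T.us.card : ℝ) ≤ _ := Nat.cast_le.2 (Finset.card_le_card hcon)
    rw [T.card_us] at hc
    push_cast at hc
    linarith
  obtain ⟨v₀, hv₀, hv₀W, hp₀, -⟩ := common u₀ hu₀ hu₀W u₀ hu₀ hu₀W
  have hg₀ := hσ _ (T.mem_lines.2 ⟨hu₀, hv₀⟩) hp₀
  refine ⟨ht φ (T.gpt u₀ v₀ 0), σ (u₀, v₀), hg₀.1, B ∪ (WU ×ˢ T.vs ∪ T.us ×ˢ WV), ?_, ?_, ?_⟩
  · exact Finset.union_subset hB (Finset.union_subset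
      (Finset.product_subset_product_left (Finset.filter_subset _ _))
      (Finset.product_subset_product_right (Finset.filter_subset _ _)))
  · have c1 := Finset.card_union_le B (WU ×ˢ T.vs ∪ T.us ×ˢ WV)
    have c2 := Finset.card_union_le (WU ×ˢ T.vs) (T.us ×ˢ WV)
    rw [Finset.card_product, Finset.card_product, T.card_us, T.card_vs] at c2
    have c3 : ((B ∪ (WU ×ˢ T.vs ∪ T.us ×ˢ WV)).card : ℝ) ≤ B.card + (WU.card * 2 ^ T.n + 2 ^ T.n * WV.card) := by
      exact_mod_cast c1.trans (Nat.add_le_add_left c2 _)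
    rw [h4] at hBc ⊢
    nlinarith
  · rintro ⟨u, v⟩ hp hpB h hh
    simp only [Finset.mem_union, Finset.mem_product, not_or, not_and] at hpB
    obtain ⟨hpB, hpU, hpV⟩ := hpB
    obtain ⟨hu, hv⟩ := T.mem_lines.1 hp
    have huW : u ∉ WU := fun h => hpU h hv
    have hvW : v ∉ WV := hpV hu
    obtain ⟨v₁, hv₁, hv₁W, hp1, hp2⟩ := common u hu huW u₀ hu₀ hu₀W
    have e1 := bot v hv v₁ hv₁ (by convert hVt v hv hvW) (by convert hVt v₁ hv₁ hv₁W) u hu hpB hp1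
    have e2 := top u hu u₀ hu₀ (by convert hUt u hu huW) (by convert hUt u₀ hu₀ hu₀W) v₁ hv₁ hp1 hp2
    have e3 := bot v₁ hv₁ v₀ hv₀ (by convert hVt v₁ hv₁ hv₁W) (by convert hVt v₀ hv₀ hv₀W) u₀ hu₀ hp2 hp₀
    have g1 := abs_le.1 ((hσ _ hp hpB).2 h hh)
    have g2 := abs_le.1 ((hσ _ (T.mem_lines.2 ⟨hu, hv₁⟩) hp1).2 T.n le_rfl)
    have g3 := abs_le.1 ((hσ _ (T.mem_lines.2 ⟨hu₀, hv₁⟩) hp2).2 T.n le_rfl)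
    rw [e1, e2, e3] at g1
    rw [e2, e3, T.line_top φ v₁ hu hu₀, ← T.line_bot φ u hv hv₁] at g2
    rw [e3, ← T.line_bot φ u₀ hv₀ hv₁] at g3
    change |T.line φ (u, v) h - T.line φ (u₀, v₀) 0 - σ (u₀, v₀) * h| ≤ _
    rw [abs_le]
    constructor <;> nlinarith [mul_nonneg hκ.le (T.n.cast_nonneg (α := ℝ))]

end

/-! ### Comparison of tiles with a common bottom -/

/-- The tile `T'` is the part of height at most `T.n - d` of `T`, over an interval of the bottom. -/
structure Tile.Child (T' T : Tile) (d : ℕ) : Prop where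
  n_eq : T.n = T'.n + d
  k₀_eq : T.k₀ = T'.k₀
  b_eq : T.b = T'.b
  a_eq : T.a = T'.a / 2 ^ d

namespace Tile.Child

variable {T' T : Tile} {d : ℕ} (hc : T'.Child T d)
include hc

lemma mem_us {u : ℤ} (hu : u ∈ T'.us) : u ∈ T.us := by
  rw [us, Finset.mem_Ico] at *
  have e := T'.ediv_us (by rw [us, Finset.mem_Ico]; exact hu)
  have e2 : u / 2 ^ T.n = T.a := by
    rw [hc.n_eq, pow_add, ← Int.ediv_ediv_of_nonneg (by positivity), e, hc.a_eq]
  rw [Int.ediv_eq_iff_of_pos (by positivity)] at e2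
  constructor <;> linarith

lemma ediv_mem_vs {v : ℤ} (hv : v ∈ T.vs) : v / 2 ^ d ∈ T'.vs := by
  have e := T.ediv_vs hv
  rw [hc.n_eq, add_comm, pow_add, ← Int.ediv_ediv_of_nonneg (by positivity), hc.b_eq,
    Int.ediv_eq_iff_of_pos (by positivity)] at e
  rw [vs, Finset.mem_Ico]
  constructor <;> linarith

lemma gpt_cell (u v : ℤ) {h : ℕ} (hh : h ≤ T'.n) :
    (T.gpt u v h).cell = (T'.gpt u (v / 2 ^ d) h).cell := by
  rw [T'.gpt_cell _ _ hh, T.gpt_cell _ _ (by have := hc.n_eq; omega), hc.k₀_eq,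
    Int.ediv_ediv_of_nonneg (by positivity), ← pow_add, hc.n_eq,
    show T'.n + d - h = d + (T'.n - h) by omega]

lemma line_eq (φ : Cell → Cell) (u v : ℤ) {h : ℕ} (hh : h ≤ T'.n) :
    T.line φ (u, v) h = T'.line φ (u, v / 2 ^ d) h := by
  simp only [line, ht, hc.gpt_cell u v hh]

open Classical in
lemma card_filter_ediv_le (Q : ℤ → Prop) :
    (T.vs.filter (fun v => Q (v / 2 ^ d))).card ≤ (T'.vs.filter Q).card * 2 ^ d := by
  rw [mul_comm]
  refine Finset.card_le_mul_card_image_of_maps_to (f := fun v => v / 2 ^ d) ?_ _ ?_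
  · intro v hv
    exact Finset.mem_filter.2 ⟨hc.ediv_mem_vs (Finset.mem_filter.1 hv).1, (Finset.mem_filter.1 hv).2⟩
  · intro w _
    refine (Finset.card_le_card (t := Finset.Ico (w * 2 ^ d) ((w + 1) * 2 ^ d)) ?_).trans ?_
    · intro v hv
      have := (Finset.mem_filter.1 hv).2
      rw [Int.ediv_eq_iff_of_pos (by positivity)] at this
      rw [Finset.mem_Ico]
      constructor <;> linarith
    · rw [Int.card_Ico, ← sub_mul]; simp [two_pow_toNat]

end Tile.Child

section
variable {A : ℕ} {φ ψ : Cell → Cell} (H : CQI A φ ψ)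
include H

lemma CQI.abs_line_sub_top_le {T' T : Tile} {d : ℕ} (hc : T'.Child T d)
    (hd : 16 * (A + 1) * d ≤ T.n) (p : ℤ × ℤ) {h : ℕ} (h1 : T'.n ≤ h) (h2 : h ≤ T.n) :
    |T.line φ p T.n - T.line φ p h| ≤ T.n / 16 := by
  have h3 := H.abs_line_sub_le T p h (T.n - h)
  rw [Nat.add_sub_cancel' h2] at h3
  refine h3.trans ?_
  have h4 : T.n - h ≤ d := by have := hc.n_eq; omega
  have h5 : 16 * ((T.n - h) * A) ≤ T.n := by nlinarith
  have h6 : 16 * (((T.n - h : ℕ) : ℝ) * A) ≤ T.n := by exact_mod_cast h5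
  linarith

omit H in
open Classical in
lemma Tile.Child.card_common {T' T : Tile} {d : ℕ} (hc : T'.Child T d) {B B' : Finset (ℤ × ℤ)} {u u' : ℤ}
    (hu : 8 * ((T.vs.filter (fun v => (u, v) ∈ B)).card : ℝ) ≤ 2 ^ T.n)
    (hu' : 8 * ((T'.vs.filter (fun v => (u', v) ∈ B')).card : ℝ) ≤ 2 ^ T'.n) :
    (2:ℝ) ^ T.n ≤ 2 * ((T.vs.filter (fun v => ¬ (u, v) ∈ B ∧ ¬ (u', v / 2 ^ d) ∈ B')).card : ℝ) := by
  refine two_pow_le_two_mul_card T.card_vs hu ?_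
  have h1 : ((T.vs.filter (fun v => (u', v / 2 ^ d) ∈ B')).card : ℝ) ≤
      (T'.vs.filter (fun v => (u', v) ∈ B')).card * 2 ^ d := by
    have e := hc.card_filter_ediv_le fun v => (u', v) ∈ B'
    refine (Nat.cast_le (α := ℝ).2 (by convert e)).trans_eq (by push_cast; congr!)
  have h2 := mul_le_mul_of_nonneg_right hu' (by positivity : (0:ℝ) ≤ 2 ^ d)
  rw [hc.n_eq, pow_add]
  linarith

omit H in
lemma Tile.Child.bounds {T' T : Tile} {d : ℕ} (hc : T'.Child T d) (hd : 16 * (A + 1) * d ≤ T.n) :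
    (15 / 16 : ℝ) * T.n ≤ T'.n ∧ (T'.n : ℝ) ≤ T.n ∧ (T.n : ℝ) = T'.n + d := by
  have e : (T.n : ℝ) = T'.n + d := by exact_mod_cast hc.n_eq
  have h1 : 16 * d ≤ T.n := by nlinarith
  have h2 : (16:ℝ) * d ≤ T.n := by exact_mod_cast h1
  have h3 : (0:ℝ) ≤ d := by positivity
  refine ⟨by linarith, by linarith, e⟩

open Classical in
/-- Aligned tiles of comparable sizes with a common bottom have the same sign. -/
lemma CQI.not_opposite : ∃ n₀ : ℕ, ∀ (T' T : Tile) (d : ℕ), n₀ ≤ T'.n → T'.Child T d →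
    16 * (A + 1) * d ≤ T.n → ∀ κ : ℝ, 0 < κ → κ ≤ 1 / 64 → ∀ h h' : ℤ,
    T.Aligned φ κ h 1 → T'.Aligned φ κ h' (-1) → False := by
  obtain ⟨n₀, hn₀⟩ := H.pinch_top (ε := 1 / 2) (by norm_num)
  refine ⟨n₀, fun T' T d hT' hc hd κ hκ hκ1 h h' hT hTa => ?_⟩
  obtain ⟨-, B, hB, hBc, hl⟩ := hT
  obtain ⟨-, B', hB', hBc', hl'⟩ := hTa
  obtain ⟨u, hu, hut⟩ := T.exists_typical hBc
  obtain ⟨u', hu', hut'⟩ := T'.exists_typical hBc'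
  have hV := hc.card_common hut hut'
  set V := T.vs.filter (fun v => ¬ (u, v) ∈ B ∧ ¬ (u', v / 2 ^ d) ∈ B') with hVdef
  obtain ⟨b1, b2, -⟩ := hc.bounds hd
  have hn0 : (0:ℝ) ≤ T.n := by positivity
  have hκn := mul_le_mul_of_nonneg_right hκ1 hn0
  have hκn' := mul_le_mul_of_nonneg_left b2 hκ.le
  have up : ∀ v ∈ V, ∀ i ≤ T.n, |T.line φ (u, v) i - h - (1:ℤ) * i| ≤ κ * T.n := fun v hv i hi => by
    obtain ⟨hv, h1, -⟩ := Finset.mem_filter.1 hv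
    exact hl _ (T.mem_lines.2 ⟨hu, hv⟩) h1 i hi
  have down : ∀ v ∈ V, ∀ i ≤ T'.n, |T.line φ (u', v) i - h' - (-1:ℤ) * i| ≤ κ * T'.n := fun v hv i hi => by
    obtain ⟨hv, -, h1⟩ := Finset.mem_filter.1 hv
    rw [hc.line_eq φ u' v hi]
    exact hl' _ (T'.mem_lines.2 ⟨hu', hc.ediv_mem_vs hv⟩) h1 i hi
  have hne : V.Nonempty := by
    rw [← Finset.card_pos]
    have : (0:ℝ) < 2 ^ T.n := by positivity
    exact_mod_cast (by linarith : (0:ℝ) < V.card)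
  obtain ⟨v₀, hv₀⟩ := hne
  refine absurd (hn₀ T (by have := hc.n_eq; omega) u' (hc.mem_us hu') u hu V (Finset.filter_subset _ _)
    (h + T.n + κ * T.n) (h' - T'.n - κ * T'.n - T.n / 8) ?_ ?_) (not_lt.2 hV)
  · have t1 := abs_le.1 (up v₀ hv₀ T.n le_rfl)
    have t2 := abs_le.1 (down v₀ hv₀ T'.n le_rfl)
    have t3 := abs_le.1 (H.abs_line_sub_top_le hc hd (u', v₀) le_rfl (by have := hc.n_eq; omega))
    rw [T.line_top φ v₀ (hc.mem_us hu') hu] at t3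
    push_cast at *
    linarith
  · intro v hv i hi
    have hi' : (i:ℝ) ≤ T.n := by exact_mod_cast hi
    have t1 := abs_le.1 (up v hv i hi)
    refine ⟨?_, by push_cast at t1; linarith⟩
    rcases le_total i T'.n with hle | hle
    · have t2 := abs_le.1 (down v hv i hle)
      have hi2 : (i:ℝ) ≤ T'.n := by exact_mod_cast hle
      push_cast at t2
      linarith
    · have t2 := abs_le.1 (down v hv T'.n le_rfl)
      have t3 := abs_le.1 (H.abs_line_sub_top_le hc hd (u', v) le_rfl (by have := hc.n_eq; omega))
      have t4 := abs_le.1 (H.abs_line_sub_top_le hc hd (u', v) hle hi)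
      push_cast at t2
      linarith

open Classical in
lemma CQI.aligned_height_le {κ : ℝ} (hκ : 0 < κ) : ∃ n₀ : ℕ, ∀ (T' T : Tile) (d : ℕ), n₀ ≤ T'.n → T'.Child T d →
    16 * (A + 1) * d ≤ T.n → κ ≤ 1 / 64 → ∀ h h' : ℤ,
    T.Aligned φ κ h 1 → T'.Aligned φ κ h' 1 → (h':ℝ) ≤ h + 4 * κ * T.n := by
  obtain ⟨n₀, hn₀⟩ := H.pinch_top hκ
  refine ⟨n₀, fun T' T d hT' hc hd hκ1 h h' hT hTa => ?_⟩
  obtain ⟨-, B, hB, hBc, hl⟩ := hT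
  obtain ⟨-, B', hB', hBc', hl'⟩ := hTa
  obtain ⟨u, hu, hut⟩ := T.exists_typical hBc
  obtain ⟨u', hu', hut'⟩ := T'.exists_typical hBc'
  have hV := hc.card_common hut hut'
  set V := T.vs.filter (fun v => ¬ (u, v) ∈ B ∧ ¬ (u', v / 2 ^ d) ∈ B') with hVdef
  obtain ⟨b1, b2, -⟩ := hc.bounds hd
  have hn0 : (0:ℝ) ≤ T.n := by positivity
  have hκn := mul_le_mul_of_nonneg_right hκ1 hn0
  have hκn' := mul_le_mul_of_nonneg_left b2 hκ.le
  have hκ0 := mul_nonneg hκ.le hn0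
  by_contra! hcon
  refine absurd (hn₀ T (by have := hc.n_eq; omega) u' (hc.mem_us hu') u hu V (Finset.filter_subset _ _)
    (h + T.n + κ * T.n) (h' - κ * T'.n) ?_ ?_) (not_lt.2 hV)
  · linarith
  · intro v hv i hi
    obtain ⟨hv, hv1, hv2⟩ := Finset.mem_filter.1 hv
    have down : ∀ i ≤ T'.n, |T.line φ (u', v) i - h' - (1:ℤ) * i| ≤ κ * T'.n := fun i hi => by
      rw [hc.line_eq φ u' v hi]
      exact hl' _ (T'.mem_lines.2 ⟨hu', hc.ediv_mem_vs hv⟩) hv2 i hi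
    have hi' : (i:ℝ) ≤ T.n := by exact_mod_cast hi
    have hi0 : (0:ℝ) ≤ i := by positivity
    have t1 := abs_le.1 (hl _ (T.mem_lines.2 ⟨hu, hv⟩) hv1 i hi)
    refine ⟨?_, by push_cast at t1; linarith⟩
    rcases le_total i T'.n with hle | hle
    · have t2 := abs_le.1 (down i hle)
      push_cast at t2
      linarith
    · have t2 := abs_le.1 (down T'.n le_rfl)
      have t3 := abs_le.1 (H.abs_line_sub_top_le hc hd (u', v) le_rfl (by have := hc.n_eq; omega))
      have t4 := abs_le.1 (H.abs_line_sub_top_le hc hd (u', v) hle hi)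
      push_cast at t2
      linarith

open Classical in
lemma CQI.le_aligned_height {κ : ℝ} (hκ : 0 < κ) : ∃ n₀ : ℕ, ∀ (T' T : Tile) (d : ℕ), n₀ ≤ T'.n → T'.Child T d →
    16 * (A + 1) * d ≤ T.n → κ ≤ 1 / 64 → ∀ h h' : ℤ,
    T.Aligned φ κ h 1 → T'.Aligned φ κ h' 1 → (h:ℝ) ≤ h' + 4 * κ * T.n := by
  obtain ⟨n₀, hn₀⟩ := H.count_small (A + 4) hκ (ε' := 1 / 4) (by norm_num)
  refine ⟨n₀, fun T' T d hT' hc hd hκ1 h h' hT hTa => ?_⟩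
  obtain ⟨-, B, hB, hBc, hl⟩ := hT
  obtain ⟨-, B', hB', hBc', hl'⟩ := hTa
  obtain ⟨u, hu, hut⟩ := T.exists_typical hBc
  obtain ⟨u', hu', hut'⟩ := T'.exists_typical hBc'
  have hV := hc.card_common hut hut'
  set V := T.vs.filter (fun v => ¬ (u, v) ∈ B ∧ ¬ (u', v / 2 ^ d) ∈ B') with hVdef
  obtain ⟨b1, b2, b3⟩ := hc.bounds hd
  have hn0 : (0:ℝ) ≤ T.n := by positivity
  have hd0 : (0:ℝ) ≤ d := by positivity
  have hκn := mul_le_mul_of_nonneg_right hκ1 hn0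
  have hκn' := mul_le_mul_of_nonneg_left b2 hκ.le
  have hκ0 := mul_nonneg hκ.le hn0
  by_contra! hcon
  have hVim : V.card ≤ (V.image (fun v => v / 2 ^ d)).card * 2 ^ d := by
    rw [mul_comm]
    refine Finset.card_le_mul_card_image _ _ fun w _ => ?_
    refine (Finset.card_le_card (t := Finset.Ico (w * 2 ^ d) ((w + 1) * 2 ^ d)) ?_).trans ?_
    · intro v hv
      have := (Finset.mem_filter.1 hv).2
      rw [Int.ediv_eq_iff_of_pos (by positivity)] at this
      rw [Finset.mem_Ico]
      constructor <;> linarith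
    · rw [Int.card_Ico, ← sub_mul]; simp [two_pow_toNat]
  have hV' : (2:ℝ) ^ T'.n ≤ 2 * (V.image (fun v => v / 2 ^ d)).card := by
    have e : (V.card:ℝ) ≤ (V.image (fun v => v / 2 ^ d)).card * 2 ^ d := by exact_mod_cast hVim
    have p : (0:ℝ) < 2 ^ d := by positivity
    rw [hc.n_eq, pow_add] at hV
    refine (mul_le_mul_iff_left₀ p).1 (by linarith)
  have hne : V.Nonempty := by
    rw [← Finset.card_pos]
    have : (0:ℝ) < 2 ^ T.n := by positivity
    exact_mod_cast (by linarith : (0:ℝ) < V.card)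
  obtain ⟨v₀, hv₀⟩ := hne
  have hv₀' := (Finset.mem_filter.1 hv₀).1
  set α : ℝ := h' + T'.n + κ * T'.n with hα
  set β : ℝ := h - κ * T.n with hβ
  have hnn' : T'.n ≤ T.n := by have := hc.n_eq; omega
  have hpow : ∀ m : ℤ, ∀ r : ℝ, r ≤ T.n + d → r * 2 ^ (m + (A:ℤ)) ≤
      ((A + 4 : ℕ):ℝ) * (T'.n + 1) * 2 ^ (m + (A + 4 : ℕ)) := by
    intro m r hr
    have h2 : (2:ℝ) ^ (m + (A:ℤ)) ≤ 2 ^ (m + (A + 4 : ℕ)) := two_zpow_le (by push_cast; linarith)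
    push_cast at *
    have : r ≤ (A + 4) * (T'.n + 1) := by
      nlinarith [mul_nonneg (A.cast_nonneg (α := ℝ)) (T'.n.cast_nonneg (α := ℝ)), A.cast_nonneg (α := ℝ)]
    exact mul_le_mul this h2 (by positivity) (by positivity)
  have := hn₀ T'.n hT' ((V.image (fun v => v / 2 ^ d)).image fun w => ⟨T'.a, w, T'.k₀ + T'.n⟩)
    (img φ (T.gpt u' v₀ 0)).x (img φ (T.gpt u v₀ 0)).y ⌊α⌋ ⌈β⌉ ?_ ?_
  · rw [Finset.card_image_of_injOn fun w _ w' _ e => (Cell.ext_iff.1 e).2.1] at this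
    have hn : (0:ℝ) ≤ T'.n := by positivity
    have h2 : (0:ℝ) < 2 ^ T'.n := by positivity
    nlinarith
  · push_cast
    linarith [Int.floor_le α, Int.le_ceil β]
  · intro s hs
    obtain ⟨w, hw, rfl⟩ := Finset.mem_image.1 hs
    obtain ⟨v, hvV, rfl⟩ := Finset.mem_image.1 hw
    obtain ⟨hv, hv1, hv2⟩ := Finset.mem_filter.1 hvV
    have up : ∀ i ≤ T.n, |T.line φ (u, v) i - h - (1:ℤ) * i| ≤ κ * T.n := fun i hi =>
      hl _ (T.mem_lines.2 ⟨hu, hv⟩) hv1 i hi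
    have down : ∀ i ≤ T'.n, |T.line φ (u', v) i - h' - (1:ℤ) * i| ≤ κ * T'.n := fun i hi => by
      rw [hc.line_eq φ u' v hi]
      exact hl' _ (T'.mem_lines.2 ⟨hu', hc.ediv_mem_vs hv⟩) hv2 i hi
    have low : ∀ i, T'.n ≤ i → i ≤ T.n → β ≤ T.line φ (u', v) i := fun i hi1 hi2 => by
      have t1 := abs_le.1 (up T.n le_rfl)
      have t2 := abs_le.1 (H.abs_line_sub_top_le hc hd (u', v) hi1 hi2)
      rw [T.line_top φ v (hc.mem_us hu') hu] at t2
      push_cast at t1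
      linarith
    have high : ∀ i ≤ T'.n, T.line φ (u', v) i ≤ α := fun i hi => by
      have t1 := abs_le.1 (down i hi)
      have : (i:ℝ) ≤ T'.n := by exact_mod_cast hi
      push_cast at t1
      linarith
    have cell : (⟨T'.a, v / 2 ^ d, T'.k₀ + T'.n⟩ : Cell) = (T.gpt u' v T'.n).cell := by
      rw [hc.gpt_cell u' v le_rfl, T'.cell_top _ hu']
    have bot : ∀ w, img φ (T.gpt w v 0) = img φ (T.gpt w v₀ 0) := fun w => by
      simp only [img, T.cell_bot w hv, T.cell_bot w hv₀']
    have x1 := H.line_img_x T u' v 0 T'.n (α := ⌊α⌋) fun i _ hi => by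
      have := high i (by omega)
      rw [Tile.line] at this ⊢
      exact_mod_cast Int.le_floor.2 this
    have y1 := H.line_img_y T u v 0 T.n (β := ⌈β⌉) fun i _ hi => by
      have : β ≤ T.line φ (u, v) i := by
        have t1 := abs_le.1 (up i (by omega))
        have : (0:ℝ) ≤ i := by positivity
        push_cast at t1
        linarith
      rw [Tile.line] at this ⊢
      exact_mod_cast Int.ceil_le.2 this
    have y2 := H.line_img_y T u' v T'.n d (β := ⌈β⌉) fun i hi1 hi2 => by
      have := low i hi1 (by have := hc.n_eq; omega)
      rw [Tile.line] at this ⊢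
      exact_mod_cast Int.ceil_le.2 this
    have htop : img φ (T.gpt u' v T.n) = img φ (T.gpt u v T.n) := by
      simp only [img, T.cell_top v (hc.mem_us hu'), T.cell_top v hu]
    rw [← hc.n_eq, htop] at y2
    simp only [zero_add, Nat.cast_zero, bot] at x1 y1
    rw [cell]
    refine ⟨x1.trans (hpow _ _ (by linarith)), ?_, ?_, ?_⟩
    · refine le_trans ?_ (hpow _ (T.n + d) le_rfl)
      have := abs_sub_le (img φ (T.gpt u' v T'.n)).y (img φ (T.gpt u v T.n)).y (img φ (T.gpt u v₀ 0)).y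
      rw [abs_sub_comm (img φ (T.gpt u' v T'.n)).y (img φ (T.gpt u v T.n)).y] at this
      rw [add_mul]
      exact this.trans (by linarith)
    · have := low T'.n le_rfl hnn'
      rw [Tile.line] at this
      exact Int.ceil_le.2 this
    · have := high T'.n le_rfl
      rw [Tile.line] at this
      exact Int.le_floor.2 this

/-- Aligned tiles of comparable sizes with a common bottom have comparable heights. -/
lemma CQI.abs_aligned_height_sub_le {κ : ℝ} (hκ : 0 < κ) (hκ1 : κ ≤ 1 / 64) : ∃ n₀ : ℕ, ∀ (T' T : Tile) (d : ℕ),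
    n₀ ≤ T'.n → T'.Child T d → 16 * (A + 1) * d ≤ T.n → ∀ h h' σ σ' : ℤ,
    T.Aligned φ κ h σ → T'.Aligned φ κ h' σ' → |(h:ℝ) - h'| ≤ 4 * κ * T.n := by
  obtain ⟨n₁, hn₁⟩ := H.not_opposite
  obtain ⟨n₂, hn₂⟩ := H.flip_target.not_opposite
  obtain ⟨n₃, hn₃⟩ := H.aligned_height_le hκ
  obtain ⟨n₄, hn₄⟩ := H.flip_target.aligned_height_le hκ
  obtain ⟨n₅, hn₅⟩ := H.le_aligned_height hκ
  obtain ⟨n₆, hn₆⟩ := H.flip_target.le_aligned_height hκ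
  refine ⟨n₁ + n₂ + n₃ + n₄ + n₅ + n₆, fun T' T d hn hc hd h h' σ σ' hT hT' => ?_⟩
  rcases hT.1 with rfl | rfl <;> rcases hT'.1 with rfl | rfl
  · have := hn₃ T' T d (by omega) hc hd hκ1 h h' hT hT'
    have := hn₅ T' T d (by omega) hc hd hκ1 h h' hT hT'
    rw [abs_le]; constructor <;> linarith
  · exact (hn₁ T' T d (by omega) hc hd κ hκ hκ1 h h' hT hT').elim
  · exact (hn₂ T' T d (by omega) hc hd κ hκ hκ1 _ _ (by simpa using hT.flip_target)
      (by simpa using hT'.flip_target)).elim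
  · have := hn₄ T' T d (by omega) hc hd hκ1 _ _ (by simpa using hT.flip_target)
      (by simpa using hT'.flip_target)
    have := hn₆ T' T d (by omega) hc hd hκ1 _ _ (by simpa using hT.flip_target)
      (by simpa using hT'.flip_target)
    push_cast at *
    rw [abs_le]; constructor <;> linarith

end

/-! ### Heights along a vertical line -/

/-- The tile of height `n` having the cell of `p` at its bottom. -/
def Pt.tile (p : Pt) (n : ℕ) : Tile := ⟨p.cell.i / 2 ^ n, p.cell.j, p.k, n⟩

namespace Pt

@[simp] lemma tile_n (p : Pt) (n : ℕ) : (p.tile n).n = n := rfl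
@[simp] lemma tile_k₀ (p : Pt) (n : ℕ) : (p.tile n).k₀ = p.k := rfl
@[simp] lemma tile_b (p : Pt) (n : ℕ) : (p.tile n).b = p.cell.j := rfl

lemma tile_child (p : Pt) (n d : ℕ) : (p.tile n).Child (p.tile (n + d)) d where
  n_eq := rfl
  k₀_eq := rfl
  b_eq := rfl
  a_eq := by
    simp only [tile]
    rw [Int.ediv_ediv_of_nonneg (by positivity), pow_add]

lemma cell_mem_us (p : Pt) (n : ℕ) : p.cell.i ∈ (p.tile n).us := by
  rw [Tile.us, Finset.mem_Ico]
  have h := (Int.ediv_eq_iff_of_pos (by positivity : (0:ℤ) < 2 ^ n)).1 (rfl : p.cell.i / 2 ^ n = p.cell.i / 2 ^ n)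
  simp only [tile]
  constructor <;> linarith

lemma flip_tile (p : Pt) (n : ℕ) : (p.tile n).flip = ((p.up n).flip).tile n := by
  have h2 : ((2:ℕ) ^ n : ℕ) ≠ 0 := by positivity
  have e1 : p.cell.j = (p.up n).cell.j / 2 ^ n := by
    have := Int.mul_natCast_floor_div_cancel h2 (p.y * 2 ^ p.k)
    simp only [cell_j, up_y, up_k, two_zpow_add, zpow_natCast]
    rw [← this]
    push_cast
    ring_nf
  have e2 : p.cell.i / 2 ^ n = (p.up n).cell.i := by
    have := Int.mul_natCast_floor_div_cancel h2 (p.x * 2 ^ (-(p.k + n)))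
    simp only [cell_i, up_x, up_k]
    rw [← this]
    have e : p.x * 2 ^ (-(p.k + n)) * ((2 ^ n : ℕ) : ℝ) = p.x * 2 ^ (-p.k) := by
      rw [neg_add, two_zpow_add, zpow_neg _ (n:ℤ), zpow_natCast]
      push_cast
      field_simp
    rw [e]
    push_cast
    rfl
  simp only [Tile.flip, tile, flip_cell, Cell.flip_i, Cell.flip_j, flip_k, up_k, ← e1, e2]

end Pt

lemma Tile.Aligned.exists_line {T : Tile} {φ : Cell → Cell} {κ : ℝ} {h σ : ℤ} (hT : T.Aligned φ κ h σ) :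
    ∃ p ∈ T.lines, ∀ i ≤ T.n, |T.line φ p i - h - σ * i| ≤ κ * T.n := by
  obtain ⟨-, B, hB, hBc, hl⟩ := hT
  have hlt : B.card < T.lines.card := by
    have := T.card_lines
    have p : (0:ℝ) < 4 ^ T.n := by positivity
    exact_mod_cast (by linarith : (B.card:ℝ) < T.lines.card)
  obtain ⟨p, hp, hpB⟩ := Finset.exists_mem_notMem_of_card_lt_card hlt
  exact ⟨p, hp, hl p hp hpB⟩

section
variable {A : ℕ} {φ ψ : Cell → Cell} (H : CQI A φ ψ)
include H

lemma CQI.abs_ht_sub_height_le {κ : ℝ} {p : Pt} {n : ℕ} {h σ : ℤ} (hT : (p.tile n).Aligned φ κ h σ) :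
    |(ht φ p : ℝ) - h| ≤ κ * n + (5 * n + 4) * (A + 1) := by
  obtain ⟨⟨u, v⟩, huv, hl⟩ := hT.exists_line
  obtain ⟨hu, hv⟩ := (p.tile n).mem_lines.1 huv
  have h0 := hl 0 (Nat.zero_le _)
  simp only [Nat.cast_zero, mul_zero, sub_zero] at h0
  have hp : ht φ ((p.tile n).gpt p.cell.i v 0) = ht φ p := by
    simp only [ht]
    rw [(p.tile n).cell_bot _ hv]; rfl
  have hnear : Near n ((p.tile n).gpt p.cell.i v 0) ((p.tile n).gpt u v 0) := by
    refine ⟨by simp, ?_, by simp; positivity⟩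
    have h1 := p.cell_mem_us n
    rw [Tile.us, Finset.mem_Ico] at h1 hu
    have h2 : |p.cell.i - u| ≤ 2 ^ n := by
      rw [abs_le, Pt.tile_n] at *
      constructor <;> linarith
    have h3 : |(p.cell.i : ℝ) - u| ≤ 2 ^ n := by exact_mod_cast h2
    simp only [Tile.gpt, ← sub_mul, abs_mul, abs_of_pos (two_zpow_pos _), Pt.tile_k₀, add_zero]
    rw [add_comm, two_zpow_add, zpow_natCast]
    exact mul_le_mul_of_nonneg_right h3 (by positivity)
  have h4 := (H.img_near hnear).1
  simp only [img_k, hp] at h4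
  have h5 : |(ht φ p : ℝ) - (p.tile n).line φ (u, v) 0| ≤ (5 * n + 4) * (A + 1) := by
    simp only [Tile.line, Nat.cast_zero]
    exact_mod_cast h4
  have := abs_sub_le (ht φ p : ℝ) ((p.tile n).line φ (u, v) 0) h
  simp only [Pt.tile_n] at h0
  linarith

/-- The height of an aligned tile is close to the height of the image of its bottom cells. -/
lemma CQI.abs_ht_sub_le {κ δ : ℝ} (hκ : 0 < κ) (hκ1 : κ ≤ 1 / 64) (hδ : 128 * (A + 1) * κ ≤ δ) :
    ∃ (n₀ : ℕ) (C : ℝ), 0 ≤ C ∧ ∀ (p : Pt) (n : ℕ), n₀ ≤ n → ∀ h σ : ℤ, (p.tile n).Aligned φ κ h σ →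
      |(ht φ p : ℝ) - h| ≤ δ * n + C := by
  obtain ⟨n₁, hn₁⟩ := H.aligned hκ hκ1
  obtain ⟨n₂, hn₂⟩ := H.abs_aligned_height_sub_le hκ hκ1
  set q : ℕ := 16 * (A + 1) with hq
  set N : ℕ := 2 * (n₁ + n₂) + q with hN
  have hδ0 : 0 ≤ δ := le_trans (by positivity) hδ
  refine ⟨n₁ + n₂, κ * N + (5 * N + 4) * (A + 1), by positivity, fun p n => ?_⟩
  induction n using Nat.strong_induction_on with
  | _ n ih =>
    intro hn h σ hT
    rcases lt_or_ge n N with hlt | hge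
    · have h1 := H.abs_ht_sub_height_le hT
      have h2 : (n:ℝ) ≤ N := by exact_mod_cast hlt.le
      have h3 : κ * n ≤ κ * N := by gcongr
      have h4 : (5 * n + 4) * (A + 1 : ℝ) ≤ (5 * N + 4) * (A + 1) := by gcongr
      have h5 : 0 ≤ δ * n := by positivity
      linarith
    · set d := n / q with hd
      have hq0 : 16 ≤ q := by omega
      have hd1 : 1 ≤ d := (Nat.one_le_div_iff (by omega)).2 (by omega)
      have hdq : q * d ≤ n := Nat.mul_div_le n q
      have hdq' : n < q * d + q := by
        have := Nat.lt_div_mul_add (a := n) (b := q) (by omega)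
        rw [mul_comm q]; exact this
      have h16 : 16 * d ≤ n := le_trans (Nat.mul_le_mul_right _ hq0) hdq
      obtain ⟨m, hm⟩ : ∃ m, n = m + d := ⟨n - d, by omega⟩
      have hm1 : n₁ + n₂ ≤ m := by omega
      obtain ⟨h', σ', hT'⟩ := hn₁ (p.tile m) (by simp; omega)
      have i1 := ih m (by omega) hm1 h' σ' hT'
      have hc := p.tile_child m d
      rw [← hm] at hc
      have i2 := hn₂ _ _ d (by simp; omega) hc hdq h h' σ σ' hT hT'
      have h2 : (n:ℝ) ≤ 2 * q * d := by
        have : n ≤ 2 * q * d := by nlinarith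
        exact_mod_cast this
      have h3 : 4 * κ * n ≤ δ * d := by
        calc 4 * κ * n ≤ 4 * κ * (2 * q * d) := by gcongr
          _ = 128 * (A + 1) * κ * d := by rw [hq]; push_cast; ring
          _ ≤ δ * d := by gcongr
      have h4 : (n:ℝ) = m + d := by exact_mod_cast hm
      have := abs_sub_le (ht φ p : ℝ) h' h
      rw [abs_sub_comm (h' : ℝ)] at this
      simp only [Pt.tile_n] at i2
      rw [h4]
      rw [h4] at i2 h3
      linarith

/-- Vertical lines are coarsely mapped to vertical lines. -/
lemma CQI.exists_sign : ∃ C : ℝ, 0 ≤ C ∧ ∀ (p : Pt) (n : ℕ), ∃ σ : ℤ, (σ = 1 ∨ σ = -1) ∧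
    |(ht φ (p.up n) : ℝ) - ht φ p - σ * n| ≤ n / 4 + C := by
  set κ : ℝ := 1 / (1024 * (A + 1)) with hκd
  have hκ : 0 < κ := by positivity
  have e : 128 * (A + 1) * κ = 1 / 8 := by rw [hκd]; field_simp; norm_num
  have hκ1 : κ ≤ 1 / 64 := by nlinarith [mul_nonneg (A.cast_nonneg (α := ℝ)) hκ.le]
  obtain ⟨n₁, hn₁⟩ := H.aligned hκ hκ1
  obtain ⟨n₂, C₂, hC₂, hn₂⟩ := H.abs_ht_sub_le hκ hκ1 e.le
  obtain ⟨n₃, C₃, hC₃, hn₃⟩ := H.flip_source.abs_ht_sub_le hκ hκ1 e.le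
  set N := n₁ + n₂ + n₃
  refine ⟨C₂ + C₃ + N * (A + 1), by positivity, fun p n => ?_⟩
  rcases lt_or_ge n N with hlt | hge
  · refine ⟨1, Or.inl rfl, ?_⟩
    have h1 := H.ht_up_real p n
    have h2 : (n:ℝ) ≤ N := by exact_mod_cast hlt.le
    have h3 : n * (A + 1 : ℝ) ≤ N * (A + 1) := by gcongr
    have h0 : (0:ℝ) ≤ n := by positivity
    have := abs_sub ((ht φ (p.up n) : ℝ) - ht φ p) ((1:ℤ) * n)
    rw [abs_of_nonneg (by push_cast; linarith : (0:ℝ) ≤ (1:ℤ) * n)] at this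
    push_cast at *
    linarith
  · obtain ⟨h, σ, hT⟩ := hn₁ (p.tile n) (by simp; omega)
    refine ⟨σ, hT.1, ?_⟩
    have h1 := hn₂ p n (by omega) h σ hT
    have hT' := hT.flip
    rw [p.flip_tile] at hT'
    have h2 := hn₃ _ n (by omega) _ _ hT'
    have e2 : ht (fun s => φ s.flip) (p.up n).flip = ht φ (p.up n) := by simp [ht]
    rw [e2] at h2
    have h3 : 0 ≤ N * (A + 1 : ℝ) := by positivity
    have := abs_sub ((ht φ (p.up n) : ℝ) - (h + σ * n)) (ht φ p - h)
    rw [show (ht φ (p.up n) : ℝ) - ht φ p - σ * n = (ht φ (p.up n) : ℝ) - (h + σ * n) - (ht φ p - h) by ring]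
    simp only [Pt.tile_n] at h2
    push_cast at h2
    linarith

end

/-! ### The orientation of vertical lines -/

/-- The segment of length `n` above `p` is mapped to a rising path. -/
def Rises (φ : Cell → Cell) (C : ℝ) (n : ℕ) (p : Pt) : Prop :=
  3 / 4 * (n : ℝ) - C ≤ (ht φ (p.up n) : ℝ) - ht φ p

lemma exists_nat_two_pow_ge (r : ℝ) (k : ℤ) : ∃ m : ℕ, ∀ n ≥ m, r ≤ 2 ^ (k + n) := by
  obtain ⟨m, hm⟩ := pow_unbounded_of_one_lt (r / 2 ^ k) one_lt_two
  refine ⟨m, fun n hn => ?_⟩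
  rw [two_zpow_add, zpow_natCast, mul_comm]
  rw [div_lt_iff₀ (by positivity)] at hm
  exact hm.le.trans (by gcongr; norm_num)

section
variable {A : ℕ} {φ ψ : Cell → Cell} (H : CQI A φ ψ)
include H

section
variable {C : ℝ} (hC : ∀ (p : Pt) (n : ℕ), Rises φ C n p ∨ (ht φ (p.up n) : ℝ) - ht φ p ≤ -(3 / 4 * n) + C)
include hC

omit H in
lemma Rises.transfer {m n : ℕ} {p q : Pt} {D : ℝ}
    (h : |((ht φ (p.up n) : ℝ) - ht φ p) - ((ht φ (q.up m) : ℝ) - ht φ q)| ≤ D)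
    (hn : 2 * C + D < 3 / 4 * (n + m)) (hp : Rises φ C n p) : Rises φ C m q := by
  refine (hC q m).resolve_right fun hq => ?_
  rw [Rises] at hp
  have := abs_le.1 h
  linarith

lemma CQI.rises_succ {n : ℕ} (hn : 2 * C + 2 * A < n) (p : Pt) : Rises φ C (n + 1) p ↔ Rises φ C n p := by
  have h := H.ht_up_real (p.up n) 1
  rw [Pt.up_up, Nat.cast_one, Nat.cast_one, one_mul] at h
  have hA : (0:ℝ) ≤ A := by positivity
  have hn0 : (0:ℝ) ≤ n := by positivity
  constructor
  · refine fun hp => hp.transfer hC (D := A) ?_ (by push_cast; linarith)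
    push_cast
    rwa [sub_sub_sub_cancel_right]
  · refine fun hp => hp.transfer hC (D := A) ?_ (by push_cast; linarith)
    push_cast
    rwa [sub_sub_sub_cancel_right, abs_sub_comm]

lemma CQI.rises_iff {N n : ℕ} (hN : 2 * C + 2 * A < N) (hn : N ≤ n) (p : Pt) : Rises φ C n p ↔ Rises φ C N p := by
  induction n, hn using Nat.le_induction with
  | base => rfl
  | succ n hn ih => exact (H.rises_succ hC (hN.trans_le (by exact_mod_cast hn)) p).trans ih

lemma CQI.rises_up_one {N : ℕ} (hN : 2 * C + 2 * A < N) (p : Pt) : Rises φ C N (p.up 1) ↔ Rises φ C N p := by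
  have h1 := abs_le.1 (H.ht_up_real (p.up N) 1)
  have h2 := abs_le.1 (H.ht_up_real p 1)
  rw [Pt.up_up] at h1
  push_cast at h1 h2
  have hN0 : (0:ℝ) ≤ N := by positivity
  have key : |((ht φ ((p.up 1).up N) : ℝ) - ht φ (p.up 1)) - ((ht φ (p.up N) : ℝ) - ht φ p)| ≤ 2 * A := by
    rw [Pt.up_up, add_comm, abs_le]
    constructor <;> linarith
  exact ⟨fun hp => hp.transfer hC key (by linarith),
    fun hp => hp.transfer hC (D := 2 * A) (by rwa [abs_sub_comm]) (by linarith)⟩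

lemma CQI.rises_up {N : ℕ} (hN : 2 * C + 2 * A < N) (m : ℕ) (p : Pt) : Rises φ C N (p.up m) ↔ Rises φ C N p := by
  induction m with
  | zero => simp
  | succ m ih =>
    rw [← ih, ← H.rises_up_one hC hN (p.up m), Pt.up_up]
    rw [Nat.cast_succ]

lemma CQI.rises_shift_x {N : ℕ} (hN : 2 * C + 2 * A < N) {p q : Pt} (hk : p.k = q.k) (hy : p.y = q.y)
    (hp : Rises φ C N p) : Rises φ C N q := by
  obtain ⟨m, hm⟩ := exists_nat_two_pow_ge |p.x - q.x| p.k
  obtain ⟨m', hm'⟩ := exists_nat_gt |(ht φ p : ℝ) - ht φ q|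
  set n := m + m' + N with hn
  rw [← H.rises_iff hC hN (by omega : N ≤ n)] at hp ⊢
  have h1 := H.ht_jump (a := p.up n) (b := q.up n) (by simp [hk]) (hm n (by omega)) (by simp [hy]; positivity)
  have h3 : (n:ℝ) = m + m' + N := by rw [hn]; push_cast; ring
  have hm0 : (0:ℝ) ≤ m := by positivity
  have hm0' : (0:ℝ) ≤ m' := by positivity
  have hN0 : (0:ℝ) ≤ N := by positivity
  have hA : (0:ℝ) ≤ A := by positivity
  refine hp.transfer hC (D := A + m') ?_ (by linarith)
  have h2 := abs_le.1 hm'.le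
  have h1 := abs_le.1 h1
  rw [abs_le]
  constructor <;> linarith

lemma CQI.rises_shift_y {N : ℕ} (hN : 2 * C + 2 * A < N) {p q : Pt} (hk : p.k = q.k) (hx : p.x = q.x)
    (hp : Rises φ C N p) : Rises φ C N q := by
  obtain ⟨m, hm⟩ := exists_nat_two_pow_ge |p.y - q.y| (-p.k)
  obtain ⟨m', hm'⟩ := exists_nat_gt |(ht φ p : ℝ) - ht φ q|
  set n := m + m' + N with hn
  have ep : p = (p.up (-n)).up n := by simp [Pt.up_up]
  have eq : q = (q.up (-n)).up n := by simp [Pt.up_up]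
  rw [ep, H.rises_up hC hN, ← H.rises_iff hC hN (by omega : N ≤ n)] at hp
  rw [eq, H.rises_up hC hN, ← H.rises_iff hC hN (by omega : N ≤ n)]
  have h1 := H.ht_jump (a := p.up (-n)) (b := q.up (-n)) (by simp [hk]) (by simp [hx]; positivity)
    (by
      have := hm n (by omega)
      simp only [Pt.up_y, Pt.up_k]
      rwa [neg_add, neg_neg])
  have h3 : (n:ℝ) = m + m' + N := by rw [hn]; push_cast; ring
  have hm0 : (0:ℝ) ≤ m := by positivity
  have hm0' : (0:ℝ) ≤ m' := by positivity
  have hN0 : (0:ℝ) ≤ N := by positivity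
  have hA : (0:ℝ) ≤ A := by positivity
  refine hp.transfer hC (D := A + m') ?_ (by linarith)
  rw [← ep, ← eq]
  have h2 := abs_le.1 hm'.le
  have h1 := abs_le.1 h1
  rw [abs_le]
  constructor <;> linarith

lemma CQI.rises_of_rises {N : ℕ} (hN : 2 * C + 2 * A < N) {p : Pt} (hp : Rises φ C N p) (q : Pt) :
    Rises φ C N q := by
  set a : Pt := ⟨q.x, p.y, p.k⟩
  set b : Pt := ⟨q.x, q.y, p.k⟩
  have hb : Rises φ C N b :=
    H.rises_shift_y hC hN (p := a) rfl rfl (H.rises_shift_x hC hN (p := p) (q := a) rfl rfl hp)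
  rcases le_total p.k q.k with h | h
  · have e : q = b.up ((q.k - p.k).toNat : ℕ) := by ext <;> simp [b, h]
    rw [e, H.rises_up hC hN]
    exact hb
  · have e : b = q.up ((p.k - q.k).toNat : ℕ) := by ext <;> simp [b, h]
    rw [e, H.rises_up hC hN] at hb
    exact hb

end

/-- All vertical lines are mapped to rising paths, or all are mapped to descending ones. -/
lemma CQI.exists_orientation : ∃ C : ℕ,
    (∀ (p : Pt) (j : ℕ), ht φ p + j ≤ ht φ (p.up (2 * j : ℕ)) + C) ∨
    (∀ (p : Pt) (j : ℕ), ht φ (p.up (2 * j : ℕ)) + j ≤ ht φ p + C) := by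
  obtain ⟨C, hC0, hC⟩ := H.exists_sign
  have hC' : ∀ (p : Pt) (n : ℕ), Rises φ C n p ∨ (ht φ (p.up n) : ℝ) - ht φ p ≤ -(3 / 4 * n) + C := by
    intro p n
    obtain ⟨σ, rfl | rfl, h⟩ := hC p n
    · left
      rw [Rises]
      have := abs_le.1 h
      push_cast at this
      linarith
    · right
      have := abs_le.1 h
      push_cast at this
      linarith
  obtain ⟨N, hN⟩ := exists_nat_gt (2 * C + 2 * A)
  have hA : (0:ℝ) ≤ A := by positivity
  refine ⟨N * (A + 1) + N, ?_⟩
  have hle : C ≤ (N * (A + 1) + N : ℕ) := by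
    push_cast
    have : 0 ≤ (N:ℝ) * (A + 1) := by positivity
    linarith
  have small : ∀ (p : Pt) (j : ℕ), 2 * j < N →
      |(ht φ (p.up (2 * j : ℕ)) : ℤ) - ht φ p| + j ≤ (N * (A + 1) + N : ℕ) := by
    intro p j hj
    have h1 := H.ht_up p (2 * j)
    have h2 : (2 * j) * A + j ≤ N * (A + 1) + N := by nlinarith
    have h3 : ((2 * j : ℕ) : ℤ) * A + j ≤ (N * (A + 1) + N : ℕ) := by exact_mod_cast h2
    linarith
  by_cases h : Rises φ C N ⟨0, 0, 0⟩
  · left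
    intro p j
    rcases lt_or_ge (2 * j) N with hj | hj
    · have := abs_le.1 (le_sub_iff_add_le.2 (small p j hj))
      linarith
    · have h1 := H.rises_of_rises hC' hN h p
      rw [← H.rises_iff hC' hN hj, Rises] at h1
      push_cast at h1
      have h2 : (ht φ p : ℝ) + j ≤ ht φ (p.up (2 * j : ℕ)) + (N * (A + 1) + N : ℕ) := by
        push_cast at hle ⊢
        have : (0:ℝ) ≤ j := by positivity
        linarith
      exact_mod_cast h2
  · right
    intro p j
    rcases lt_or_ge (2 * j) N with hj | hj
    · have := abs_le.1 (le_sub_iff_add_le.2 (small p j hj))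
      linarith
    · have h1 : ¬ Rises φ C N p := fun hp => h (H.rises_of_rises hC' hN hp _)
      rw [← H.rises_iff hC' hN hj] at h1
      have h1 := (hC' p (2 * j)).resolve_left h1
      push_cast at h1
      have h2 : (ht φ (p.up (2 * j : ℕ)) : ℝ) + j ≤ ht φ p + (N * (A + 1) + N : ℕ) := by
        push_cast at hle ⊢
        have : (0:ℝ) ≤ j := by positivity
        linarith
      exact_mod_cast h2

end

/-! ### Coarse equivalences respect the height -/

/-- Vertical lines are mapped to rising paths. -/
def Upward (φ : Cell → Cell) (C : ℕ) : Prop :=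
  ∀ (p : Pt) (j : ℕ), ht φ p + j ≤ ht φ (p.up (2 * j : ℕ)) + C

lemma ht_flip_flip (φ : Cell → Cell) (p : Pt) : ht (fun s => (φ s.flip).flip) p.flip = -ht φ p := by
  simp [ht]

lemma img_flip_flip (φ : Cell → Cell) (p : Pt) : img (fun s => (φ s.flip).flip) p.flip = (img φ p).flip := by
  simp [img]

lemma Pt.flip_up (p : Pt) (h : ℤ) : (p.up h).flip = p.flip.up (-h) := by
  ext <;> simp [add_comm]

lemma Upward.flip_flip {φ : Cell → Cell} {C : ℕ} (hP : Upward φ C) : Upward (fun s => (φ s.flip).flip) C := by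
  intro p j
  have h := hP (p.flip.up (-(2 * j : ℕ))) j
  rw [Pt.up_up, neg_add_cancel, Pt.up_zero] at h
  have e1 := ht_flip_flip φ p.flip
  have e2 := ht_flip_flip φ (p.flip.up (-(2 * j : ℕ)))
  rw [Pt.flip_up, neg_neg] at e2
  rw [Pt.flip_flip] at e1 e2
  rw [e1, e2]
  linarith

lemma Upward.down {φ : Cell → Cell} {C : ℕ} (hP : Upward φ C) (p : Pt) (j : ℕ) :
    ht φ (p.up (-(2 * j : ℕ))) + j ≤ ht φ p + C := by
  have := hP (p.up (-(2 * j : ℕ))) j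
  rwa [Pt.up_up, neg_add_cancel, Pt.up_zero] at this

section
variable {A C : ℕ} {φ ψ : Cell → Cell} (H : CQI A φ ψ) (hP : Upward φ C)
include H hP

lemma CQI.abs_img_down_x_sub_le (p : Pt) (m : ℕ) :
    |(img φ (p.up (-(2 * m : ℕ)))).x - (img φ p).x| ≤ 2 ^ (ht φ p + (C + 2 * A + 3 : ℕ)) := by
  set K : ℝ := 2 ^ (ht φ p + (C + 2 * A + 2 : ℕ)) with hK
  have key : |(img φ (p.up (-(2 * m : ℕ)))).x - (img φ p).x| ≤ K * (2 - 2 * 2 ^ (-(m:ℤ))) := by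
    induction m with
    | zero => simp
    | succ m ih =>
      set b := p.up (-(2 * (m + 1) : ℕ)) with hb
      have e : b.up (2 : ℕ) = p.up (-(2 * m : ℕ)) := by
        rw [hb, Pt.up_up]; congr 1; push_cast; ring
      have h1 := (H.img_down_nat b 2).2.1
      rw [e, img_k, abs_sub_comm] at h1
      have h2 := hP.down p m
      have h3 : (2:ℝ) ^ (ht φ (p.up (-(2 * m : ℕ))) + (2 * (A + 1) : ℕ)) ≤ K * 2 ^ (-(m:ℤ)) := by
        rw [hK, ← two_zpow_add]
        refine two_zpow_le ?_
        push_cast at h2 ⊢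
        linarith
      have h4 : (2:ℝ) ^ (-(m:ℤ)) = 2 * 2 ^ (-((m + 1 : ℕ):ℤ)) := by
        rw [← two_zpow_succ]; congr 1; push_cast; ring
      have := abs_sub_le (img φ b).x (img φ (p.up (-(2 * m : ℕ)))).x (img φ p).x
      rw [h4] at ih h3
      linarith
  have h1 : (2:ℝ) ^ (ht φ p + (C + 2 * A + 3 : ℕ)) = 2 * K := by
    rw [hK, ← two_zpow_succ]; congr 1; push_cast; ring
  have h2 := mul_pos (two_zpow_pos (ht φ p + (C + 2 * A + 2 : ℕ))) (two_zpow_pos (-(m:ℤ)))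
  rw [h1]
  rw [← hK] at h2
  linarith

lemma CQI.abs_img_up_y_sub_le (p : Pt) (m : ℕ) :
    |(img φ (p.up (2 * m : ℕ))).y - (img φ p).y| ≤ 2 ^ (-ht φ p + (C + 2 * A + 3 : ℕ)) := by
  have := H.flip_source.flip_target.abs_img_down_x_sub_le hP.flip_flip p.flip m
  rwa [← Pt.flip_up, ht_flip_flip, img_flip_flip, img_flip_flip] at this

lemma CQI.exists_down (p : Pt) (T : ℕ) : ∃ j : ℕ, j ≤ T + C ∧ ht φ (p.up (-(2 * j : ℕ))) ≤ ht φ p - T ∧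
    ht φ p - T - 2 * A ≤ ht φ (p.up (-(2 * j : ℕ))) := by
  have hex : ∃ j : ℕ, ht φ (p.up (-(2 * j : ℕ))) ≤ ht φ p - T :=
    ⟨T + C, by have := hP.down p (T + C); push_cast at *; linarith⟩
  classical
  refine ⟨Nat.find hex, Nat.find_min' hex (by have := hP.down p (T + C); push_cast at *; linarith),
    Nat.find_spec hex, ?_⟩
  rcases Nat.eq_zero_or_pos (Nat.find hex) with h0 | h0
  · rw [h0]; simp only [mul_zero, Nat.cast_zero, neg_zero, Pt.up_zero]; linarith [T.cast_nonneg (α := ℤ), A.cast_nonneg (α := ℤ)]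
  · obtain ⟨j, hj⟩ := Nat.exists_eq_add_of_lt h0
    rw [zero_add] at hj
    have h1 := Nat.find_min hex (m := j) (by omega)
    rw [hj]
    have h2 := H.ht_up (p.up (-(2 * (j + 1) : ℕ))) 2
    rw [Pt.up_up, show -((2 * (j + 1) : ℕ) : ℤ) + (2:ℕ) = -((2 * j : ℕ) : ℤ) by push_cast; ring, abs_le] at h2
    push_cast at h1 h2 ⊢
    linarith

lemma CQI.abs_img_down_jump_le {p q : Pt} (hk : q.k = p.k) (hy : q.y = p.y) (hx : |p.x - q.x| ≤ 2 ^ p.k) (m : ℕ) :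
    |(img φ (p.up (-(2 * m : ℕ)))).x - (img φ (q.up (-(2 * m : ℕ)))).x| ≤
      2 ^ (ht φ p + (C + 3 * A + 5 : ℕ)) := by
  have h1 := H.abs_img_down_x_sub_le hP p m
  have h2 := H.abs_img_down_x_sub_le hP q m
  have h3 := H.img_jump hk.symm hx (by simp [hy]; positivity)
  have h4 := abs_le.1 h3.1
  simp only [img_k] at h4
  have e : (2:ℝ) ^ (ht φ p + (C + 3 * A + 5 : ℕ)) = 2 * (2 * 2 ^ (ht φ p + (C + 3 * A + 3 : ℕ))) := by
    rw [← two_zpow_succ, ← two_zpow_succ]; congr 1; push_cast; ring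
  have l1 : (2:ℝ) ^ (ht φ p + (C + 2 * A + 3 : ℕ)) ≤ 2 ^ (ht φ p + (C + 3 * A + 3 : ℕ)) :=
    two_zpow_le (by push_cast; linarith)
  have l2 : (2:ℝ) ^ (ht φ q + (C + 2 * A + 3 : ℕ)) ≤ 2 ^ (ht φ p + (C + 3 * A + 3 : ℕ)) :=
    two_zpow_le (by push_cast; linarith)
  have l3 : (2:ℝ) ^ (ht φ p + (A:ℤ)) ≤ 2 ^ (ht φ p + (C + 3 * A + 3 : ℕ)) :=
    two_zpow_le (by push_cast; linarith)
  have h3 := h3.2.1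
  rw [img_k] at h3
  have t1 := abs_sub_le (img φ (p.up (-(2 * m : ℕ)))).x (img φ p).x (img φ (q.up (-(2 * m : ℕ)))).x
  have t2 := abs_sub_le (img φ p).x (img φ q).x (img φ (q.up (-(2 * m : ℕ)))).x
  rw [abs_sub_comm (img φ q).x] at t2
  have := two_zpow_pos (ht φ p + (C + 3 * A + 3 : ℕ))
  linarith

/-- If the images of two neighbouring vertical lines stay close when going down, then points on them
have close images. -/
lemma CQI.near_of_down_lt {p q : Pt} (hk : q.k = p.k) (hy : q.y = p.y) (hx : |p.x - q.x| ≤ 2 ^ p.k) {T m : ℕ}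
    (hm : T + C ≤ m) (hlt : |(img φ (p.up (-(2 * m : ℕ)))).x - (img φ (q.up (-(2 * m : ℕ)))).x| ≤
      2 ^ (ht φ p - (T + 2 * A : ℕ))) : ∃ i j : ℕ, ht φ (p.up (-(2 * i : ℕ))) ≤ ht φ p - T ∧
      Near (C + 5 * A + 5) (img φ (p.up (-(2 * i : ℕ)))) (img φ (q.up (-(2 * j : ℕ)))) := by
  obtain ⟨i, hi, hi1, hi2⟩ := H.exists_down hP p T
  obtain ⟨j, hj, hj1, hj2⟩ := H.exists_down hP q T
  have hpq := H.img_jump hk.symm hx (by simp [hy]; positivity)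
  have hpq1 := abs_le.1 hpq.1
  simp only [img_k] at hpq1
  refine ⟨i, j, hi1, ?_⟩
  obtain ⟨i', rfl⟩ : ∃ i', m = i + i' := ⟨m - i, by omega⟩
  obtain ⟨j', hj'⟩ : ∃ j', i + i' = j + j' := ⟨i + i' - j, by omega⟩
  have x1 := H.abs_img_down_x_sub_le hP (p.up (-(2 * i : ℕ))) i'
  have x2 := H.abs_img_down_x_sub_le hP (q.up (-(2 * j : ℕ))) j'
  have y1 := H.abs_img_up_y_sub_le hP (p.up (-(2 * i : ℕ))) i
  have y2 := H.abs_img_up_y_sub_le hP (q.up (-(2 * j : ℕ))) j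
  have e (i i' : ℕ) : -((2 * i : ℕ) : ℤ) + -((2 * i' : ℕ) : ℤ) = -((2 * (i + i') : ℕ) : ℤ) := by push_cast; ring
  rw [Pt.up_up, e] at x1 x2
  rw [Pt.up_up, neg_add_cancel, Pt.up_zero] at y1 y2
  rw [← hj'] at x2
  set a := p.up (-(2 * i : ℕ))
  set b := q.up (-(2 * j : ℕ))
  set a' := p.up (-(2 * (i + i') : ℕ))
  set b' := q.up (-(2 * (i + i') : ℕ))
  refine ⟨?_, ?_, ?_⟩
  · simp only [img_k]
    rw [abs_le]
    push_cast
    constructor <;> linarith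
  · have e : (2:ℝ) ^ (ht φ a + (C + 5 * A + 5 : ℕ)) = 2 * (2 * 2 ^ (ht φ a + (C + 5 * A + 3 : ℕ))) := by
      rw [← two_zpow_succ, ← two_zpow_succ]; congr 1; push_cast; ring
    have l1 : (2:ℝ) ^ (ht φ a + (C + 2 * A + 3 : ℕ)) ≤ 2 ^ (ht φ a + (C + 5 * A + 3 : ℕ)) :=
      two_zpow_le (by push_cast; linarith)
    have l2 : (2:ℝ) ^ (ht φ b + (C + 2 * A + 3 : ℕ)) ≤ 2 ^ (ht φ a + (C + 5 * A + 3 : ℕ)) :=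
      two_zpow_le (by push_cast; linarith)
    have l3 : (2:ℝ) ^ (ht φ p - (T + 2 * A : ℕ)) ≤ 2 ^ (ht φ a + (C + 5 * A + 3 : ℕ)) :=
      two_zpow_le (by push_cast; linarith)
    have t1 := abs_sub_le (img φ a).x (img φ a').x (img φ b).x
    have t2 := abs_sub_le (img φ a').x (img φ b').x (img φ b).x
    rw [abs_sub_comm (img φ a).x (img φ a').x] at t1
    have := two_zpow_pos (ht φ a + (C + 5 * A + 3 : ℕ))
    rw [img_k]
    linarith
  · have e : (2:ℝ) ^ (-ht φ a + (C + 5 * A + 5 : ℕ)) = 2 * (2 * 2 ^ (-ht φ a + (C + 5 * A + 3 : ℕ))) := by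
      rw [← two_zpow_succ, ← two_zpow_succ]; congr 1; push_cast; ring
    have l1 : (2:ℝ) ^ (-ht φ a + (C + 2 * A + 3 : ℕ)) ≤ 2 ^ (-ht φ a + (C + 5 * A + 3 : ℕ)) :=
      two_zpow_le (by push_cast; linarith)
    have l2 : (2:ℝ) ^ (-ht φ b + (C + 2 * A + 3 : ℕ)) ≤ 2 ^ (-ht φ a + (C + 5 * A + 3 : ℕ)) :=
      two_zpow_le (by push_cast; linarith)
    have l3 : (2:ℝ) ^ (-ht φ p + (A:ℤ)) ≤ 2 ^ (-ht φ a + (C + 5 * A + 3 : ℕ)) :=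
      two_zpow_le (by push_cast; linarith [T.cast_nonneg (α := ℤ)])
    have t1 := abs_sub_le (img φ a).y (img φ p).y (img φ b).y
    have t2 := abs_sub_le (img φ p).y (img φ q).y (img φ b).y
    rw [abs_sub_comm (img φ a).y (img φ p).y] at t1
    have t3 := hpq.2.2
    rw [img_k] at t3
    have := two_zpow_pos (-ht φ a + (C + 5 * A + 3 : ℕ))
    rw [img_k]
    linarith

/-- The images of neighbouring vertical lines diverge when going down. -/
lemma CQI.lt_abs_img_down_jump : ∃ t m₀ : ℕ, ∀ p q : Pt, q.k = p.k → q.y = p.y → |p.x - q.x| = 2 ^ p.k →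
    ∀ m ≥ m₀, (2:ℝ) ^ (ht φ p - t) < |(img φ (p.up (-(2 * m : ℕ)))).x - (img φ (q.up (-(2 * m : ℕ)))).x| := by
  set R : ℕ := (5 * (C + 5 * A + 5) + 4) * (A + 1) + 3 * A + 2 with hR
  set T : ℕ := (R + 2) * A + 1 with hT
  refine ⟨T + 2 * A, T + C, fun p q hk hy hx m hm => ?_⟩
  by_contra! hcon
  obtain ⟨i, j, h1, h2⟩ := H.near_of_down_lt hP hk hy hx.le hm hcon
  have h3 := H.near_of_img_eq h2
  have h4 := (((p.up (-(2 * i : ℕ))).near_corner.symm.trans h3).trans (q.up (-(2 * j : ℕ))).near_corner).2.1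
  simp only [Pt.up_x, hx, Pt.up_k, two_zpow_le_iff, ← hR] at h4
  have h5 : 2 * i ≤ R + 2 := by push_cast at h4; omega
  have h6 := H.ht_up (p.up (-(2 * i : ℕ))) (2 * i)
  rw [Pt.up_up, neg_add_cancel, Pt.up_zero, abs_le] at h6
  have h7 : 2 * i * A ≤ (R + 2) * A := Nat.mul_le_mul_right _ h5
  have h8 : (((2 * i : ℕ) : ℤ)) * A ≤ ((R + 2) * A : ℕ) := by exact_mod_cast h7
  rw [hT] at h1
  push_cast at *
  linarith

lemma CQI.ht_le_of_shift_y : ∃ B : ℕ, ∀ p q : Pt, p.k = q.k → p.x = q.x → ht φ p ≤ ht φ q + B := by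
  obtain ⟨t, m₀, hlow⟩ := H.lt_abs_img_down_jump hP
  refine ⟨t + C + 3 * A + 7, fun p q hk hx => ?_⟩
  obtain ⟨m₁, hm₁⟩ := exists_nat_two_pow_ge |p.y - q.y| (-p.k)
  set m := m₀ + m₁ + 2 * A + C + t + 2 with hm
  set p₂ : Pt := ⟨p.x + 2 ^ p.k, p.y, p.k⟩ with hp₂
  set q₂ : Pt := ⟨p.x + 2 ^ p.k, q.y, p.k⟩ with hq₂
  have hp0 := two_zpow_pos p.k
  have h1 := hlow p p₂ rfl rfl (by simp [hp₂, abs_of_pos hp0]) m (by omega)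
  have h2 := H.abs_img_down_jump_le hP (p := q) (q := q₂) hk rfl (by simp [hq₂, hx, ← hk, abs_of_pos hp0]) m
  have hjump : ∀ a b : Pt, a.k = p.k → a.k = b.k → a.x = b.x → |a.y - b.y| = |p.y - q.y| → ht φ a ≤ ht φ p + A →
      |(img φ (a.up (-(2 * m : ℕ)))).x - (img φ (b.up (-(2 * m : ℕ)))).x| ≤ 2 ^ (ht φ p - t - 2) := by
    intro a b hp hk hx hy hle
    have := (H.img_jump (a := a.up (-(2 * m : ℕ))) (b := b.up (-(2 * m : ℕ))) (by simp [hk])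
      (by simp [hx]; positivity) (by
        have := hm₁ (2 * m) (by omega)
        simp only [Pt.up_y, Pt.up_k, hy, hp]
        rwa [neg_add, neg_neg])).2.1
    refine this.trans (two_zpow_le ?_)
    have := hP.down a m
    rw [img_k]
    push_cast [hm] at this ⊢
    linarith [m₀.cast_nonneg (α := ℤ), m₁.cast_nonneg (α := ℤ)]
  have h3 := hjump p q rfl hk hx rfl (by linarith [A.cast_nonneg (α := ℤ)])
  have h4 := hjump p₂ q₂ rfl rfl rfl rfl (by
    have := (H.img_jump (a := p) (b := p₂) rfl (by simp [hp₂, abs_of_pos hp0]) (by simp [hp₂]; positivity)).1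
    rw [img_k, img_k, abs_le] at this
    linarith)
  have e : (2:ℝ) ^ (ht φ p - t) = 2 * (2 * 2 ^ (ht φ p - t - 2)) := by
    rw [← two_zpow_succ, ← two_zpow_succ]; congr 1; ring
  have t1 := abs_sub_le (img φ (p.up (-(2 * m : ℕ)))).x (img φ (q.up (-(2 * m : ℕ)))).x (img φ (p₂.up (-(2 * m : ℕ)))).x
  have t2 := abs_sub_le (img φ (q.up (-(2 * m : ℕ)))).x (img φ (q₂.up (-(2 * m : ℕ)))).x (img φ (p₂.up (-(2 * m : ℕ)))).x
  rw [abs_sub_comm (img φ (q₂.up (-(2 * m : ℕ)))).x] at t2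
  have h5 : (2:ℝ) ^ (ht φ p - t - 2) ≤ 2 ^ (ht φ q + (C + 3 * A + 5 : ℕ)) := by
    have := two_zpow_pos (ht φ p - t - 2)
    linarith
  rw [two_zpow_le_iff] at h5
  push_cast at h5 ⊢
  linarith

lemma CQI.abs_ht_sub_le_of_upward : ∃ B : ℕ, ∀ p q : Pt, p.k = q.k → |ht φ p - ht φ q| ≤ B := by
  obtain ⟨B₁, h₁⟩ := H.ht_le_of_shift_y hP
  obtain ⟨B₂, h₂⟩ := H.flip_source.flip_target.ht_le_of_shift_y hP.flip_flip
  have key : ∀ p q : Pt, p.k = q.k → ht φ p ≤ ht φ q + (B₁ + B₂ : ℕ) := by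
    intro p q hk
    have t1 := h₁ p ⟨p.x, q.y, q.k⟩ hk rfl
    have t2 := h₂ q.flip (Pt.flip ⟨p.x, q.y, q.k⟩) rfl rfl
    rw [ht_flip_flip, ht_flip_flip] at t2
    push_cast
    linarith
  refine ⟨B₁ + B₂, fun p q hk => ?_⟩
  have t1 := key p q hk
  have t2 := key q p hk.symm
  rw [abs_le]
  constructor <;> linarith

omit hP in
/-- A coarse equivalence of the discrete model maps level sets of the height close to level sets. -/
theorem CQI.height_respecting : ∃ B : ℕ, ∀ p q : Pt, p.k = q.k → |ht φ p - ht φ q| ≤ B := by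
  obtain ⟨C, hC | hC⟩ := H.exists_orientation
  · exact H.abs_ht_sub_le_of_upward hC
  · have e : ∀ p : Pt, ht (fun s => (φ s).flip) p = -ht φ p := fun p => rfl
    obtain ⟨B, hB⟩ := H.flip_target.abs_ht_sub_le_of_upward (C := C) fun p j => by
      rw [e, e]; linarith [hC p j]
    refine ⟨B, fun p q hk => ?_⟩
    have := hB p q hk
    rwa [e, e, neg_sub_neg, abs_sub_comm] at this

end

/-! ### Comparing `dSol` with coordinates -/

lemma intervalIntegrable_deriv_of_contDiffOn {u : ℝ → ℝ} {a b : ℝ} (hab : a ≤ b)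
    (hu : ContDiffOn ℝ 1 u (Icc a b)) : IntervalIntegrable (deriv u) MeasureTheory.volume a b := by
  rcases hab.eq_or_lt with rfl | hab'
  · exact IntervalIntegrable.refl
  have hc := hu.continuousOn_derivWithin (uniqueDiffOn_Icc hab') le_rfl
  rw [← uIcc_of_le hab] at hc
  refine hc.intervalIntegrable.congr_uIoo fun t ht => ?_
  rw [uIoo_of_le hab] at ht
  rw [uIcc_of_le hab]
  exact derivWithin_of_mem_nhds (Icc_mem_nhds ht.1 ht.2)

lemma PiecewiseC1.comp_clm {E F : Type*} [NormedAddCommGroup E] [NormedSpace ℝ E]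
    [NormedAddCommGroup F] [NormedSpace ℝ F] {γ : ℝ → E} (h : PiecewiseC1 γ) (L : E →L[ℝ] F) :
    PiecewiseC1 fun t => L (γ t) := by
  obtain ⟨n, τ, h0, h1, hm, hC⟩ := h
  exact ⟨n, τ, h0, h1, hm, fun i hi => L.contDiff.comp_contDiffOn (hC i hi)⟩

lemma PiecewiseC1.intervalIntegrable_deriv {u : ℝ → ℝ} (h : PiecewiseC1 u) :
    IntervalIntegrable (deriv u) MeasureTheory.volume 0 1 := by
  obtain ⟨n, τ, h0, h1, hm, hC⟩ := h
  rw [← h0, ← h1]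
  exact IntervalIntegrable.trans_iterate fun i hi =>
    intervalIntegrable_deriv_of_contDiffOn (hm i hi) (hC i hi)

lemma PiecewiseC1.continuousOn_and_differentiableAt {u : ℝ → ℝ} (h : PiecewiseC1 u) :
    ContinuousOn u (Icc 0 1) ∧
      ∃ s : Set ℝ, s.Countable ∧ ∀ t ∈ Icc (0:ℝ) 1, t ∉ s → DifferentiableAt ℝ u t := by
  obtain ⟨n, τ, h0, h1, hm, hC⟩ := h
  have key : ∀ m ≤ n, τ 0 ≤ τ m ∧ ContinuousOn u (Icc (τ 0) (τ m)) ∧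
      ∀ t ∈ Icc (τ 0) (τ m), t ∉ range τ → DifferentiableAt ℝ u t := by
    intro m
    induction m with
    | zero =>
      refine fun _ => ⟨le_rfl, by simp, fun t ht hs => ?_⟩
      exact absurd ⟨0, le_antisymm ht.1 ht.2⟩ hs
    | succ m ih =>
      intro hmn
      obtain ⟨i1, i2, i3⟩ := ih (by omega)
      have hle := hm m (by omega)
      have hcd := hC m (by omega)
      refine ⟨i1.trans hle, ?_, fun t ht hs => ?_⟩
      · rw [← Icc_union_Icc_eq_Icc i1 hle]
        exact i2.union_of_isClosed hcd.continuousOn isClosed_Icc isClosed_Icc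
      · rcases le_total t (τ m) with h | h
        · exact i3 t ⟨ht.1, h⟩ hs
        · have n1 : τ m < t := lt_of_le_of_ne h fun e => hs ⟨m, e⟩
          have n2 : t < τ (m + 1) := lt_of_le_of_ne ht.2 fun e => hs ⟨m + 1, e.symm⟩
          exact (hcd.differentiableOn one_ne_zero).differentiableAt (Icc_mem_nhds n1 n2)
  obtain ⟨-, k2, k3⟩ := key n le_rfl
  rw [h0, h1] at k2 k3
  exact ⟨k2, range τ, countable_range τ, k3⟩

lemma PiecewiseC1.abs_sub_le {u G : ℝ → ℝ} (h : PiecewiseC1 u)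
    (hG : IntervalIntegrable G MeasureTheory.volume 0 1)
    (hle : ∀ t ∈ Icc (0:ℝ) 1, |deriv u t| ≤ G t) {t : ℝ} (ht : t ∈ Icc (0:ℝ) 1) :
    |u t - u 0| ≤ ∫ s in (0:ℝ)..1, G s := by
  obtain ⟨hc, s, hs, hd⟩ := h.continuousOn_and_differentiableAt
  have hsub : uIcc 0 t ⊆ uIcc (0:ℝ) 1 := by
    rw [uIcc_of_le ht.1, uIcc_of_le zero_le_one]; exact Icc_subset_Icc_right ht.2
  have hi := h.intervalIntegrable_deriv.mono_set hsub
  have e := MeasureTheory.integral_eq_of_hasDerivAt_off_countable_of_le u (deriv u) ht.1 hs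
    (hc.mono (Icc_subset_Icc_right ht.2))
    (fun x hx => (hd x ⟨hx.1.1.le, hx.1.2.le.trans ht.2⟩ hx.2).hasDerivAt) hi
  rw [← e]
  calc |∫ s in (0:ℝ)..t, deriv u s| ≤ ∫ s in (0:ℝ)..t, |deriv u s| :=
        intervalIntegral.abs_integral_le_integral_abs ht.1
    _ ≤ ∫ s in (0:ℝ)..t, G s := intervalIntegral.integral_mono_on ht.1 hi.abs (hG.mono_set hsub)
        fun x hx => hle x ⟨hx.1, hx.2.trans ht.2⟩
    _ ≤ ∫ s in (0:ℝ)..1, G s := by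
        refine intervalIntegral.integral_mono_interval le_rfl ht.1 ht.2 ?_ hG
        refine (MeasureTheory.ae_restrict_iff' measurableSet_Ioc).2 (.of_forall fun x hx => ?_)
        exact (abs_nonneg _).trans (hle x ⟨hx.1.le, hx.2⟩)

lemma sqrt_exp_mul_sq (z a : ℝ) : Real.sqrt (Real.exp z * a ^ 2) = Real.exp (z / 2) * |a| := by
  rw [Real.sqrt_mul (Real.exp_nonneg _), Real.sqrt_sq_eq_abs, Real.exp_half]

lemma solLength_nonneg (γ : ℝ → ℝ × ℝ × ℝ) : 0 ≤ solLength γ :=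
  intervalIntegral.integral_nonneg zero_le_one fun _ _ => Real.sqrt_nonneg _

lemma intervalIntegrable_speed {x y z : ℝ → ℝ} (hx : PiecewiseC1 x) (hy : PiecewiseC1 y)
    (hz : PiecewiseC1 z) :
    IntervalIntegrable (fun t => Real.sqrt (Real.exp (-z t) * deriv x t ^ 2 +
      Real.exp (z t) * deriv y t ^ 2 + deriv z t ^ 2)) MeasureTheory.volume 0 1 := by
  have hzc := hz.continuousOn_and_differentiableAt.1
  rw [← uIcc_of_le zero_le_one] at hzc
  have i1 := hx.intervalIntegrable_deriv.abs.continuousOn_mul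
    (f := fun t => |deriv x t|) (g := fun t => Real.exp (-z t / 2)) (by fun_prop)
  have i2 := hy.intervalIntegrable_deriv.abs.continuousOn_mul
    (f := fun t => |deriv y t|) (g := fun t => Real.exp (z t / 2)) (by fun_prop)
  have i3 := (i1.add i2).add hz.intervalIntegrable_deriv.abs
  refine i3.mono_fun' ?_ (.of_forall fun t => ?_)
  · have hzm : AEMeasurable z (MeasureTheory.volume.restrict (uIoc (0:ℝ) 1)) :=
      (hzc.mono uIoc_subset_uIcc).aemeasurable measurableSet_uIoc
    have m1 := (measurable_deriv x).aemeasurable (μ := MeasureTheory.volume.restrict (uIoc (0:ℝ) 1))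
    have m2 := (measurable_deriv y).aemeasurable (μ := MeasureTheory.volume.restrict (uIoc (0:ℝ) 1))
    have m3 := (measurable_deriv z).aemeasurable (μ := MeasureTheory.volume.restrict (uIoc (0:ℝ) 1))
    refine AEMeasurable.aestronglyMeasurable ?_
    fun_prop
  · beta_reduce
    rw [Real.norm_of_nonneg (Real.sqrt_nonneg _)]
    refine Real.sqrt_le_iff.2 ⟨by positivity, ?_⟩
    have e1 : Real.exp (-z t) = Real.exp (-z t / 2) ^ 2 := by
      rw [← Real.exp_nat_mul]; push_cast; ring_nf
    have e2 : Real.exp (z t) = Real.exp (z t / 2) ^ 2 := by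
      rw [← Real.exp_nat_mul]; push_cast; ring_nf
    rw [e1, e2, ← sq_abs (deriv x t), ← sq_abs (deriv y t), ← sq_abs (deriv z t), ← mul_pow,
      ← mul_pow]
    have n1 : 0 ≤ Real.exp (-z t / 2) * |deriv x t| := by positivity
    have n2 : 0 ≤ Real.exp (z t / 2) * |deriv y t| := by positivity
    have n3 := abs_nonneg (deriv z t)
    nlinarith [mul_nonneg n1 n2, mul_nonneg n1 n3, mul_nonneg n2 n3]

/-- Coarse closeness of points in coordinates. -/
def NearS (R : ℝ) (p q : ℝ × ℝ × ℝ) : Prop :=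
  |q.2.2 - p.2.2| ≤ R ∧ |q.1 - p.1| ≤ Real.exp (p.2.2 / 2 + R) ∧
    |q.2.1 - p.2.1| ≤ Real.exp (-p.2.2 / 2 + R)

lemma nearS_of_solLength_le {γ : ℝ → ℝ × ℝ × ℝ} (h : PiecewiseC1 γ) {R : ℝ}
    (hR : solLength γ ≤ R) : NearS (2 * R) (γ 0) (γ 1) := by
  have hx : PiecewiseC1 fun t => (γ t).1 := h.comp_clm (.fst ℝ ℝ (ℝ × ℝ))
  have hy : PiecewiseC1 fun t => (γ t).2.1 :=
    h.comp_clm ((ContinuousLinearMap.fst ℝ ℝ ℝ).comp (.snd ℝ ℝ (ℝ × ℝ)))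
  have hz : PiecewiseC1 fun t => (γ t).2.2 :=
    h.comp_clm ((ContinuousLinearMap.snd ℝ ℝ ℝ).comp (.snd ℝ ℝ (ℝ × ℝ)))
  have hF := intervalIntegrable_speed hx hy hz
  have h0 := solLength_nonneg γ
  have hexp : R ≤ Real.exp R := by linarith [Real.add_one_le_exp R]
  have m1 : (1:ℝ) ∈ Icc (0:ℝ) 1 := ⟨zero_le_one, le_rfl⟩
  have hzb : ∀ t ∈ Icc (0:ℝ) 1, |(γ t).2.2 - (γ 0).2.2| ≤ R := fun t ht => by
    refine (hz.abs_sub_le hF (fun s _ => ?_) ht).trans hR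
    refine Real.le_sqrt_of_sq_le ?_
    rw [sq_abs]
    have := Real.exp_nonneg (-(γ s).2.2)
    have := Real.exp_nonneg ((γ s).2.2)
    nlinarith [sq_nonneg (deriv (fun s => (γ s).1) s), sq_nonneg (deriv (fun s => (γ s).2.1) s), mul_nonneg ‹0 ≤ Real.exp (-(γ s).2.2)› (sq_nonneg (deriv (fun s => (γ s).1) s)), mul_nonneg ‹0 ≤ Real.exp ((γ s).2.2)› (sq_nonneg (deriv (fun s => (γ s).2.1) s))]
  have fin : ∀ c : ℝ, Real.exp ((c + R) / 2) * solLength γ ≤ Real.exp (c / 2 + 2 * R) := fun c => by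
    calc _ ≤ Real.exp ((c + R) / 2) * Real.exp R :=
          mul_le_mul_of_nonneg_left (hR.trans hexp) (Real.exp_nonneg _)
      _ ≤ _ := by rw [← Real.exp_add, Real.exp_le_exp]; linarith
  refine ⟨(hzb 1 m1).trans (by linarith), ?_, ?_⟩
  · refine (hx.abs_sub_le (hF.const_mul (Real.exp (((γ 0).2.2 + R) / 2))) (fun s hs => ?_)
      m1).trans ?_
    · have hb := abs_le.1 (hzb s hs)
      have : |deriv (fun t => (γ t).1) s| =
          Real.exp ((γ s).2.2 / 2) * (Real.exp (-(γ s).2.2 / 2) * |deriv (fun t => (γ t).1) s|) := by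
        rw [← mul_assoc, ← Real.exp_add]; ring_nf; simp
      rw [this, ← sqrt_exp_mul_sq]
      gcongr
      · linarith
      · have := mul_nonneg (Real.exp_nonneg ((γ s).2.2)) (sq_nonneg (deriv (fun s => (γ s).2.1) s))
        linarith [sq_nonneg (deriv (fun s => (γ s).2.2) s)]
    · rw [intervalIntegral.integral_const_mul]
      exact fin _
  · refine (hy.abs_sub_le (hF.const_mul (Real.exp ((-(γ 0).2.2 + R) / 2))) (fun s hs => ?_)
      m1).trans ?_
    · have hb := abs_le.1 (hzb s hs)
      have : |deriv (fun t => (γ t).2.1) s| =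
          Real.exp (-(γ s).2.2 / 2) * (Real.exp ((γ s).2.2 / 2) * |deriv (fun t => (γ t).2.1) s|) := by
        rw [← mul_assoc, ← Real.exp_add]; ring_nf; simp
      rw [this, ← sqrt_exp_mul_sq]
      gcongr
      · linarith
      · have := mul_nonneg (Real.exp_nonneg (-(γ s).2.2)) (sq_nonneg (deriv (fun s => (γ s).1) s))
        linarith [sq_nonneg (deriv (fun s => (γ s).2.2) s)]
    · rw [intervalIntegral.integral_const_mul]
      exact fin _

lemma piecewiseC1_affine {E : Type*} [NormedAddCommGroup E] [NormedSpace ℝ E] (p v : E) :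
    PiecewiseC1 fun t : ℝ => p + t • v :=
  ⟨1, fun i => i, by simp, by simp, fun i _ => by simp, fun i _ => by fun_prop⟩

lemma affine_mem (p q : ℝ × ℝ × ℝ) :
    solLength (fun t : ℝ => p + t • (q - p)) ∈ {ℓ : ℝ | ∃ γ : ℝ → ℝ × ℝ × ℝ,
      γ 0 = p ∧ γ 1 = q ∧ PiecewiseC1 γ ∧ solLength γ = ℓ} :=
  ⟨fun t : ℝ => p + t • (q - p), by simp, by simp, piecewiseC1_affine _ _, rfl⟩

lemma dSol_le_affine (p q : ℝ × ℝ × ℝ) :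
    dSol p q ≤ solLength fun t : ℝ => p + t • (q - p) := by
  refine csInf_le ⟨0, ?_⟩ (affine_mem p q)
  rintro _ ⟨γ, -, -, -, rfl⟩
  exact solLength_nonneg γ

lemma dSol_le_of_nearS {R : ℝ} {p q : ℝ × ℝ × ℝ} (h : NearS R p q) :
    dSol p q ≤ Real.sqrt (2 * Real.exp (3 * R) + R ^ 2) := by
  obtain ⟨h1, h2, h3⟩ := h
  have hR : 0 ≤ R := (abs_nonneg _).trans h1
  refine (dSol_le_affine p q).trans ?_
  have d : ∀ a b t : ℝ, deriv (fun s => a + s * b) t = b := fun a b t => by simp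
  have := intervalIntegral.norm_integral_le_of_norm_le_const (a := (0:ℝ)) (b := 1)
    (f := fun t => Real.sqrt (Real.exp (-(p + t • (q - p)).2.2) *
      (deriv (fun s : ℝ => (p + s • (q - p)).1) t) ^ 2 +
      Real.exp ((p + t • (q - p)).2.2) * (deriv (fun s : ℝ => (p + s • (q - p)).2.1) t) ^ 2 +
      (deriv (fun s : ℝ => (p + s • (q - p)).2.2) t) ^ 2))
    (C := Real.sqrt (2 * Real.exp (3 * R) + R ^ 2)) ?_
  · simp only [sub_zero, abs_one, mul_one] at this
    exact (le_abs_self _).trans this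
  · intro t ht
    rw [uIoc_of_le zero_le_one] at ht
    rw [Real.norm_of_nonneg (Real.sqrt_nonneg _)]
    simp only [Prod.fst_add, Prod.snd_add, Prod.smul_fst, Prod.smul_snd, Prod.fst_sub,
      Prod.snd_sub, smul_eq_mul, d]
    apply Real.sqrt_le_sqrt
    have hz : |t * (q.2.2 - p.2.2)| ≤ R := by
      rw [abs_mul, abs_of_pos ht.1]
      calc _ ≤ 1 * R := mul_le_mul ht.2 h1 (abs_nonneg _) zero_le_one
        _ = R := one_mul R
    rw [abs_le] at hz
    have c1 : Real.exp (-(p.2.2 + t * (q.2.2 - p.2.2))) * (q.1 - p.1) ^ 2 ≤ Real.exp (3 * R) := by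
      calc _ ≤ Real.exp (-p.2.2 + R) * Real.exp (p.2.2 / 2 + R) ^ 2 := by
            rw [← sq_abs (q.1 - p.1)]
            gcongr
            linarith
        _ = _ := by rw [← Real.exp_nat_mul, ← Real.exp_add]; push_cast; ring_nf
    have c2 : Real.exp (p.2.2 + t * (q.2.2 - p.2.2)) * (q.2.1 - p.2.1) ^ 2 ≤ Real.exp (3 * R) := by
      calc _ ≤ Real.exp (p.2.2 + R) * Real.exp (-p.2.2 / 2 + R) ^ 2 := by
            rw [← sq_abs (q.2.1 - p.2.1)]
            gcongr
            linarith
        _ = _ := by rw [← Real.exp_nat_mul, ← Real.exp_add]; push_cast; ring_nf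
    have c3 : (q.2.2 - p.2.2) ^ 2 ≤ R ^ 2 := sq_le_sq' (abs_le.1 h1).1 (abs_le.1 h1).2
    linarith

lemma nearS_of_dSol_le {R : ℝ} {p q : ℝ × ℝ × ℝ} (h : dSol p q ≤ R) :
    NearS (2 * (R + 1)) p q := by
  obtain ⟨_, ⟨γ, h0, h1, hγ, rfl⟩, hl⟩ := exists_lt_of_csInf_lt
    ⟨_, affine_mem p q⟩ (h.trans_lt (lt_add_one R))
  rw [← h0, ← h1]
  exact nearS_of_solLength_le hγ hl.le

/-! ### Discretising `Sol` -/

/-- The point of `Sol` associated with a cell. -/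
def Cell.toSol (s : Cell) : ℝ × ℝ × ℝ := (s.corner.x, s.corner.y, 2 * Real.log 2 * s.k)

/-- Discretising the height. -/
def solPt (p : ℝ × ℝ × ℝ) : Pt := ⟨p.1, p.2.1, ⌊p.2.2 / (2 * Real.log 2)⌋⟩

lemma one_lt_two_mul_log_two : 1 < 2 * Real.log 2 := by linarith [Real.log_two_gt_d9]

lemma two_mul_log_two_lt : 2 * Real.log 2 < 2 := by linarith [Real.log_two_lt_d9]

@[simp] lemma solPt_toSol (s : Cell) : solPt s.toSol = s.corner := by
  have := one_lt_two_mul_log_two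
  ext
  · rfl
  · rfl
  · simp only [solPt, Cell.toSol, Cell.corner_k]
    rw [mul_div_cancel_left₀ _ (by linarith), Int.floor_intCast]

lemma solPt_height (p : ℝ × ℝ × ℝ) :
    2 * Real.log 2 * (solPt p).k ≤ p.2.2 ∧ p.2.2 < 2 * Real.log 2 * (solPt p).k + 2 * Real.log 2 := by
  have h := one_lt_two_mul_log_two
  have h1 := Int.floor_le (p.2.2 / (2 * Real.log 2))
  have h2 := Int.lt_floor_add_one (p.2.2 / (2 * Real.log 2))
  rw [le_div_iff₀ (by linarith)] at h1
  rw [div_lt_iff₀ (by linarith)] at h2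
  simp only [solPt]
  constructor <;> linarith

lemma two_zpow_eq_exp (k : ℤ) : (2:ℝ) ^ k = Real.exp (k * Real.log 2) := by
  rw [← Real.rpow_intCast, Real.rpow_def_of_pos two_pos, mul_comm]

lemma near_solPt {R : ℝ} {N : ℕ} (hN : 2 * R + 1 ≤ N) {p q : ℝ × ℝ × ℝ} (h : NearS R p q) :
    Near N (solPt p) (solPt q) := by
  obtain ⟨h1, h2, h3⟩ := h
  have hR : 0 ≤ R := (abs_nonneg _).trans h1
  have e1 := solPt_height p
  have e2 := solPt_height q
  have l1 := one_lt_two_mul_log_two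
  rw [abs_le] at h1
  have hNl : R + Real.log 2 ≤ N * Real.log 2 := by nlinarith
  refine ⟨?_, ?_, ?_⟩
  · have a1 : ((solPt p).k - (solPt q).k : ℝ) < R + 1 := by
      by_contra! hc
      nlinarith
    have a2 : ((solPt q).k - (solPt p).k : ℝ) < R + 1 := by
      by_contra! hc
      nlinarith
    have : ((|(solPt p).k - (solPt q).k| : ℤ) : ℝ) ≤ N := by
      push_cast
      rw [abs_le]
      constructor <;> linarith
    exact_mod_cast this
  · rw [abs_sub_comm]
    refine h2.trans ?_
    rw [two_zpow_eq_exp, Real.exp_le_exp]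
    push_cast
    nlinarith
  · rw [abs_sub_comm]
    refine h3.trans ?_
    rw [two_zpow_eq_exp, Real.exp_le_exp]
    push_cast
    nlinarith

lemma nearS_of_near_solPt {N : ℕ} {p q : ℝ × ℝ × ℝ} (h : Near N (solPt p) (solPt q)) :
    NearS (2 * N + 2) p q := by
  obtain ⟨h1, h2, h3⟩ := h
  have e1 := solPt_height p
  have e2 := solPt_height q
  have l1 := one_lt_two_mul_log_two
  have l2 := two_mul_log_two_lt
  have h1' : |((solPt p).k - (solPt q).k : ℝ)| ≤ N := by exact_mod_cast h1
  rw [abs_le] at h1'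
  have hN : N * Real.log 2 ≤ N := by nlinarith [N.cast_nonneg (α := ℝ)]
  have hN0 := N.cast_nonneg (α := ℝ)
  refine ⟨?_, ?_, ?_⟩
  · rw [abs_le]
    constructor <;> nlinarith
  · rw [abs_sub_comm]
    refine h2.trans ?_
    rw [two_zpow_eq_exp, Real.exp_le_exp]
    push_cast
    nlinarith
  · rw [abs_sub_comm]
    refine h3.trans ?_
    rw [two_zpow_eq_exp, Real.exp_le_exp]
    push_cast
    nlinarith

lemma exists_near_of_dSol_le (D : ℝ) :
    ∃ N : ℕ, ∀ p q, dSol p q ≤ D → Near N (solPt p) (solPt q) := by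
  obtain ⟨N, hN⟩ := exists_nat_ge (2 * (2 * (D + 1)) + 1)
  exact ⟨N, fun p q h => near_solPt hN (nearS_of_dSol_le h)⟩

lemma exists_dSol_le_of_near (N : ℕ) :
    ∃ D : ℝ, ∀ p q, Near N (solPt p) (solPt q) → dSol p q ≤ D :=
  ⟨_, fun _ _ h => dSol_le_of_nearS (nearS_of_near_solPt h)⟩

section
variable {K C : ℝ} {φ : ℝ × ℝ × ℝ → ℝ × ℝ × ℝ}

lemma IsQIE.exists_near (hK : 1 ≤ K) (h : IsQIE dSol dSol K C φ) (N : ℕ) :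
    ∃ M : ℕ, ∀ p q, Near N (solPt p) (solPt q) → Near M (solPt (φ p)) (solPt (φ q)) := by
  obtain ⟨D, hD⟩ := exists_dSol_le_of_near N
  obtain ⟨M, hM⟩ := exists_near_of_dSol_le (K * D + C)
  refine ⟨M, fun p q hpq => hM _ _ ((h p q).2.trans ?_)⟩
  have := hD p q hpq
  gcongr

lemma IsQIE.exists_near_of_near_image (hK : 1 ≤ K) (h : IsQIE dSol dSol K C φ) (N : ℕ) :
    ∃ M : ℕ, ∀ p q, Near N (solPt (φ p)) (solPt (φ q)) → Near M (solPt p) (solPt q) := by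
  obtain ⟨D, hD⟩ := exists_dSol_le_of_near N
  obtain ⟨M, hM⟩ := exists_near_of_dSol_le (K * (D + C))
  refine ⟨M, fun p q hpq => hM _ _ ?_⟩
  have h1 := hD _ _ hpq
  have h2 := (h p q).1
  have hK0 : 0 < K := by linarith
  rw [← div_le_iff₀' hK0]
  have : dSol p q / K = 1 / K * dSol p q := by ring
  linarith

lemma IsQI.exists_cqi (hK : 1 ≤ K) (h : IsQI dSol dSol K C φ) :
    ∃ (A : ℕ) (ψ : Cell → Cell), CQI A (fun s => (solPt (φ s.toSol)).cell) ψ := by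
  obtain ⟨hq, hs⟩ := h
  choose ξ hξ using hs
  obtain ⟨c, hc⟩ := exists_near_of_dSol_le C
  obtain ⟨m, hm⟩ := hq.exists_near hK 1
  obtain ⟨m', hm'⟩ := hq.exists_near hK 0
  obtain ⟨n, hn⟩ := hq.exists_near_of_near_image hK (2 * c + 2 + (2 * c + 1) + 10)
  obtain ⟨n', hn'⟩ := hq.exists_near_of_near_image hK (c + 1)
  have cells : ∀ {N : ℕ} {a b : Pt}, Near N a b → Near (N + 2) a.cell.corner b.cell.corner :=
    fun {N a b} hab => ((a.near_corner.trans hab).trans b.near_corner.symm).mono (by omega)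
  have hr : ∀ s : Cell, Near c (solPt (φ (ξ s.toSol))) s.corner := fun s => by
    simpa using hc _ _ (hξ s.toSol)
  refine ⟨m + m' + n + n' + c + 10, fun s => (solPt (ξ s.toSol)).cell, ⟨?_, ?_, ?_, ?_⟩⟩
  · intro s u hsu
    refine (cells (hm s.toSol u.toSol (by simpa using hsu))).mono (by omega)
  · intro s u hsu
    refine (cells (hn _ _ (((hr s).trans (hsu.trans (hr u).symm)).mono ?_))).mono (by omega)
    omega
  · intro s
    have h1 := cells (hm' (solPt (ξ s.toSol)).cell.toSol (ξ s.toSol)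
      (by simpa using (solPt (ξ s.toSol)).near_corner))
    have h2 := (Pt.near_corner _).trans (hr s)
    exact (h1.trans h2).mono (by omega)
  · intro s
    have h1 := (hr (solPt (φ s.toSol)).cell).trans (Pt.near_corner _)
    have h2 := hn' _ _ h1
    rw [solPt_toSol] at h2
    exact ((Pt.near_corner _).trans h2).mono (by omega)

/-- Every quasi-isometry of `Sol` is height-respecting. -/
theorem IsQI.heightRespectingSol (hK : 1 ≤ K) (h : IsQI dSol dSol K C φ) :
    HeightRespectingSol φ := by
  obtain ⟨A, ψ, H⟩ := h.exists_cqi hK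
  obtain ⟨B, hB⟩ := H.height_respecting
  obtain ⟨M, hM⟩ := h.1.exists_near hK 0
  set φ' : Cell → Cell := fun s => (solPt (φ s.toSol)).cell with hφ'
  refine ⟨2 * (M + B + 1), by positivity, fun z => 2 * Real.log 2 *
    ht φ' ⟨0, 0, ⌊z / (2 * Real.log 2)⌋⟩, fun p => ?_⟩
  have h1 := (hM (solPt p).cell.toSol p (by simpa using (solPt p).near_corner)).1
  have h2 : |(solPt (φ (solPt p).cell.toSol)).k - ht φ' ⟨0, 0, (solPt p).k⟩| ≤ B :=
    hB (solPt p) ⟨0, 0, (solPt p).k⟩ rfl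
  have h1' : |((solPt (φ (solPt p).cell.toSol)).k - (solPt (φ p)).k : ℝ)| ≤ M := by
    exact_mod_cast h1
  have h2' : |((solPt (φ (solPt p).cell.toSol)).k - ht φ' ⟨0, 0, (solPt p).k⟩ : ℝ)| ≤ B := by
    exact_mod_cast h2
  have h3 := solPt_height (φ p)
  have l1 := one_lt_two_mul_log_two
  have l2 := two_mul_log_two_lt
  have h4 : |((solPt (φ p)).k - ht φ' ⟨0, 0, (solPt p).k⟩ : ℝ)| ≤ M + B := by
    rw [abs_le] at *
    constructor <;> linarith
  change |(φ p).2.2 - 2 * Real.log 2 * ht φ' ⟨0, 0, (solPt p).k⟩| ≤ _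
  rw [abs_le] at h4 ⊢
  constructor <;> nlinarith

end

lemma dSol_self_nonpos (p : ℝ × ℝ × ℝ) : dSol p p ≤ 0 := by
  simpa [solLength] using dSol_le_affine p p

/-- **Theorem (Eskin–Fisher–Whyte).** Any `(K,C)`-quasi-isometry of `Sol` is within uniformly
bounded distance of a height-respecting `(K',C')`-quasi-isometry, with `K', C'` and the bound
depending only on `K` and `C`. -/
theorem sol_qi_close_to_height_respecting :
    ∀ K C : ℝ, 1 ≤ K → 0 ≤ C →
      ∃ K' C' D : ℝ, 1 ≤ K' ∧ 0 ≤ C' ∧ 0 ≤ D ∧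
        ∀ φ : ℝ × ℝ × ℝ → ℝ × ℝ × ℝ, IsQI dSol dSol K C φ →
          ∃ φhat : ℝ × ℝ × ℝ → ℝ × ℝ × ℝ,
            IsQI dSol dSol K' C' φhat ∧ HeightRespectingSol φhat ∧
            ∀ p : ℝ × ℝ × ℝ, dSol (φ p) (φhat p) ≤ D := by
  intro K C hK hC
  exact ⟨K, C, 0, hK, hC, le_rfl, fun φ h =>
    ⟨φ, h, h.heightRespectingSol hK, fun p => dSol_self_nonpos (φ p)⟩⟩

end
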